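/- Let {G_n}_{n≥1} be a sequence of uniformly nonamenable, transitive, locally finite, infinite connected graphs that converges locally to a transitive, locally finite, infinite connected graph G satisfying Assumption 1. Then for every ε > 0 and ε₁ > 0 there exists N ∈ ℕ such that p_c(G_n) ≤ p_c(G) + 2ε + ε₁ for all n ≥ N. -/

import Mathlib

/-!
Statement 0 (He–Xiang–Zhu, Theorem 1): locality of the percolation critical
probability for uniformly nonamenable sequences of transitive graphs whose
local limit satisfies Assumption 1.
-/

open Filter

namespace Loc

variable {V : Type*}

/-- `x` lies in the ball of radius `n` around `v` in `G` (graph distance via walks). -/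
def inBall (G : SimpleGraph V) (v : V) (n : ℕ) (x : V) : Prop :=
  ∃ w : G.Walk v x, w.length ≤ n

/-- `x` lies on the sphere `∂B_G(u,n) = B_G(u,n) \ B_G(u,n-1)`. -/
def onSphere (G : SimpleGraph V) (u : V) (n : ℕ) (x : V) : Prop :=
  inBall G u n x ∧ ¬ inBall G u (n - 1) x

/-- `x` and `y` are joined by a walk of `G` all of whose edges lie in the finite set `S`
(the set of open edges). -/
def connectedVia (G : SimpleGraph V) (S : Finset (Sym2 V)) (x y : V) : Prop :=
  ∃ w : G.Walk x y, ∀ e ∈ w.edges, e ∈ S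

open Classical in
/-- The probability, under i.i.d. Bernoulli(`p`) bond percolation on the finite edge set `E`,
of the event `A`; a configuration is recorded as its (finite) set of open edges. -/
noncomputable def cylProb (p : ℝ) (E : Finset (Sym2 V)) (A : Finset (Sym2 V) → Prop) : ℝ :=
  ∑ S ∈ E.powerset, if A S then p ^ S.card * (1 - p) ^ (E.card - S.card) else 0

/-- The probability of an increasing event `A` (an event witnessed by finitely many open
edges) under Bernoulli(`p`) bond percolation: the supremum over finite edge sets of the
finite-volume probabilities. -/
noncomputable def prob (p : ℝ) (A : Finset (Sym2 V) → Prop) : ℝ :=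
  ⨆ E : Finset (Sym2 V), cylProb p E A

/-- `θ_G(p)` at the vertex `v`: the probability that `v` lies in an infinite open cluster,
i.e. the infimum over `n` of the probability that `v` is connected to the complement of
the ball of radius `n`. -/
noncomputable def theta (G : SimpleGraph V) (p : ℝ) (v : V) : ℝ :=
  ⨅ n : ℕ, prob p (fun S => ∃ x : V, ¬ inBall G v n x ∧ connectedVia G S v x)

/-- The critical probability of Bernoulli bond percolation on `G`:
`p_c(G) = inf {p ∈ [0,1] : ℙ_p(∃ infinite open cluster) > 0}`.  (For a countable graph
there is an infinite cluster with positive probability iff `θ` is positive at some vertex.) -/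
noncomputable def pc (G : SimpleGraph V) : ℝ :=
  sInf {p : ℝ | 0 ≤ p ∧ p ≤ 1 ∧ ∃ v : V, 0 < theta G p v}

/-- `b_n(x,u)`: the probability that `x` is connected to `u` by open edges inside the
ball `B_G(u,n)` under Bernoulli(`p`) bond percolation. -/
noncomputable def bconn (G : SimpleGraph V) (p : ℝ) (u : V) (n : ℕ) (x : V) : ℝ :=
  prob p (fun S => ∃ w : G.Walk u x, (∀ e ∈ w.edges, e ∈ S) ∧ ∀ y ∈ w.support, inBall G u n y)

/-- `μ_n(x)`: the harmonic measure at `x ∈ ∂B_G(u,n)` of simple random walk on the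
`d`-regular graph `G` started at `u`, i.e. `∑_γ d^{-|γ|}`, summed over all walks `γ`
from `u` to `x` whose vertices, except the last one, lie in `B_G(u,n-1)`. -/
noncomputable def harm (G : SimpleGraph V) (d : ℕ) (u : V) (n : ℕ) (x : V) : ℝ :=
  ∑' w : {w : G.Walk u x // ∀ y ∈ w.support.dropLast, inBall G u (n - 1) y},
    ((d : ℝ))⁻¹ ^ (w : G.Walk u x).length

/-- `λ₁(G)`: the bottom of the spectrum of `I - P` for simple random walk on `G`,
computed in `ℓ²(V, deg)`; the infimum of the Rayleigh quotients of finitely supported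
nonzero functions.  `G` is nonamenable iff `0 < lambda1 G`. -/
noncomputable def lambda1 (G : SimpleGraph V) : ℝ :=
  sInf {r : ℝ | ∃ f : V →₀ ℝ, f ≠ 0 ∧
    r = (∑ x ∈ f.support,
          (((G.neighborSet x).ncard : ℝ) * f x - ∑' y : G.neighborSet x, f (y : V)) * f x) /
        (∑ x ∈ f.support, ((G.neighborSet x).ncard : ℝ) * f x ^ 2)}

/-- `G` is vertex-transitive. -/
def IsTransitive (G : SimpleGraph V) : Prop :=
  ∀ u v : V, ∃ φ : G ≃g G, φ u = v

/-- The balls `B_G(v,R)` and `B_H(w,R)` are isomorphic as rooted graphs. -/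
def BallIso {W : Type*} (G : SimpleGraph V) (H : SimpleGraph W) (v : V) (w : W) (R : ℕ) :
    Prop :=
  ∃ φ : {x : V // inBall G v R x} ≃ {y : W // inBall H w R y},
    (φ ⟨v, ⟨SimpleGraph.Walk.nil, by simp⟩⟩).1 = w ∧
    ∀ a b : {x : V // inBall G v R x}, G.Adj a.1 b.1 ↔ H.Adj (φ a).1 (φ b).1

/-- The sequence of transitive graphs `G n` converges locally to the transitive graph `H`:
for every radius `R` there is `N` such that for `n ≥ N` all `R`-balls of `G n` are
isomorphic, as rooted graphs, to the `R`-balls of `H`. -/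
def ConvergesLocally {Vn : ℕ → Type*} {W : Type*} (G : ∀ n, SimpleGraph (Vn n))
    (H : SimpleGraph W) : Prop :=
  ∀ R : ℕ, ∃ N : ℕ, ∀ n, N ≤ n → ∀ (vn : Vn n) (w : W), BallIso (G n) H vn w R

/-- Assumption 1(i): the harmonic measures on the spheres `∂B_G(u,n)` are roughly uniform,
with constants independent of `u` and `n`. -/
def Assumption1i (G : SimpleGraph V) (d : ℕ) : Prop :=
  ∃ c C : ℝ, 0 < c ∧ 0 < C ∧ ∀ (u : V) (n : ℕ), 1 ≤ n → ∀ x y : V,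
    onSphere G u n x → onSphere G u n y →
      c * harm G d u n y ≤ harm G d u n x ∧ harm G d u n x ≤ C * harm G d u n y

/-- Assumption 1(ii): for every `p ∈ (p_c(G), 1)` the in-ball connection probabilities
`b_n(·,u)` on the spheres `∂B_G(u,n)` are roughly uniform, with constants depending only
on `p`. -/
def Assumption1ii (G : SimpleGraph V) : Prop :=
  ∀ p : ℝ, pc G < p → p < 1 →
    ∃ c₁ c₂ : ℝ, 0 < c₁ ∧ 0 < c₂ ∧ ∀ (u : V) (n : ℕ), 1 ≤ n → ∀ x y : V,
      onSphere G u n x → onSphere G u n y →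
        c₁ * bconn G p u n y ≤ bconn G p u n x ∧ bconn G p u n x ≤ c₂ * bconn G p u n y

set_option linter.unusedSectionVars false

section Expectation

variable {α : Type*} [DecidableEq α]

/-- Expectation of `f` when every edge `e` of the finite set `E` is independently open with
probability `q e`; the configuration is the set of open edges. -/
noncomputable def Ex (q : α → ℝ) (E : Finset α) (f : Finset α → ℝ) : ℝ :=
  ∑ T ∈ E.powerset, (∏ e ∈ T, q e) * (∏ e ∈ E \ T, (1 - q e)) * f T

lemma Ex_empty (q : α → ℝ) (f : Finset α → ℝ) : Ex q ∅ f = f ∅ := by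
  simp [Ex]

lemma Ex_insert (q : α → ℝ) {E : Finset α} {e : α} (he : e ∉ E) (f : Finset α → ℝ) :
    Ex q (insert e E) f =
      q e * Ex q E (fun T => f (insert e T)) + (1 - q e) * Ex q E f := by
  unfold Ex
  rw [Finset.sum_powerset_insert he, add_comm, Finset.mul_sum, Finset.mul_sum]
  congr 1
  · refine Finset.sum_congr rfl fun T hT => ?_
    have hT' := Finset.mem_powerset.1 hT
    have heT : e ∉ T := fun h => he (hT' h)
    rw [Finset.prod_insert heT, Finset.insert_sdiff_insert, Finset.sdiff_insert_of_notMem he]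
    ring
  · refine Finset.sum_congr rfl fun T hT => ?_
    have hT' := Finset.mem_powerset.1 hT
    have heT : e ∉ T := fun h => he (hT' h)
    rw [Finset.insert_sdiff_of_notMem _ heT, Finset.prod_insert (by simp [he])]
    ring

variable {q q' : α → ℝ} {E E' : Finset α} {f g : Finset α → ℝ}

lemma Ex_congr (h : ∀ T ⊆ E, f T = g T) : Ex q E f = Ex q E g :=
  Finset.sum_congr rfl fun T hT => by rw [h T (Finset.mem_powerset.1 hT)]

lemma Ex_mono (hq : ∀ e, q e ∈ Set.Icc (0 : ℝ) 1) (h : ∀ T ⊆ E, f T ≤ g T) :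
    Ex q E f ≤ Ex q E g :=
  Finset.sum_le_sum fun T hT => mul_le_mul_of_nonneg_left (h T (Finset.mem_powerset.1 hT))
    (mul_nonneg (Finset.prod_nonneg fun e _ => (hq e).1)
      (Finset.prod_nonneg fun e _ => sub_nonneg.2 (hq e).2))

lemma Ex_nonneg (hq : ∀ e, q e ∈ Set.Icc (0 : ℝ) 1) (h : ∀ T ⊆ E, 0 ≤ f T) :
    0 ≤ Ex q E f :=
  Finset.sum_nonneg fun T hT => mul_nonneg
    (mul_nonneg (Finset.prod_nonneg fun e _ => (hq e).1)
      (Finset.prod_nonneg fun e _ => sub_nonneg.2 (hq e).2)) (h T (Finset.mem_powerset.1 hT))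

lemma Ex_const (q : α → ℝ) (E : Finset α) (c : ℝ) : Ex q E (fun _ => c) = c := by
  induction E using Finset.induction_on with
  | empty => exact Ex_empty _ _
  | insert e E he ih => rw [Ex_insert q he, ih]; ring

lemma Ex_add (q : α → ℝ) (E : Finset α) (f g : Finset α → ℝ) :
    Ex q E (fun T => f T + g T) = Ex q E f + Ex q E g := by
  simp only [Ex, mul_add, Finset.sum_add_distrib]

lemma Ex_sub (q : α → ℝ) (E : Finset α) (f g : Finset α → ℝ) :
    Ex q E (fun T => f T - g T) = Ex q E f - Ex q E g := by
  simp only [Ex, mul_sub, Finset.sum_sub_distrib]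

lemma Ex_mul_left (q : α → ℝ) (E : Finset α) (c : ℝ) (f : Finset α → ℝ) :
    Ex q E (fun T => c * f T) = c * Ex q E f := by
  simp only [Ex, Finset.mul_sum]
  exact Finset.sum_congr rfl fun T _ => by ring

lemma Ex_sum {ι : Type*} (q : α → ℝ) (E : Finset α) (s : Finset ι) (f : ι → Finset α → ℝ) :
    Ex q E (fun T => ∑ i ∈ s, f i T) = ∑ i ∈ s, Ex q E (f i) := by
  simp only [Ex, Finset.mul_sum]
  exact Finset.sum_comm

lemma Ex_split {e : α} (he : e ∈ E) (q : α → ℝ) (f : Finset α → ℝ) :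
    Ex q E f = q e * Ex q E (fun T => f (insert e T)) +
      (1 - q e) * Ex q E (fun T => f (T.erase e)) := by
  obtain ⟨E', he', rfl⟩ : ∃ E', e ∉ E' ∧ E = insert e E' :=
    ⟨E.erase e, Finset.notMem_erase _ _, (Finset.insert_erase he).symm⟩
  have h1 : Ex q E' (fun T => f (T.erase e)) = Ex q E' f :=
    Ex_congr fun T hT => by rw [Finset.erase_eq_of_notMem fun h => he' (hT h)]
  have h2 : Ex q E' (fun T => f ((insert e T).erase e)) = Ex q E' f :=
    Ex_congr fun T hT => by rw [Finset.erase_insert fun h => he' (hT h)]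
  rw [Ex_insert q he', Ex_insert q he', Ex_insert q he', h1, h2]
  simp only [Finset.insert_idem]
  ring

lemma Ex_insert_le (hq : ∀ e, q e ∈ Set.Icc (0 : ℝ) 1) {e : α} (he : e ∈ E)
    (hf : ∀ T ⊆ E, 0 ≤ f T) :
    q e * Ex q E (fun T => f (insert e T)) ≤ Ex q E f := by
  rw [Ex_split he q f]
  have : 0 ≤ Ex q E (fun T => f (T.erase e)) :=
    Ex_nonneg hq fun T hT => hf _ ((Finset.erase_subset _ _).trans hT)
  have := mul_nonneg (sub_nonneg.2 (hq e).2) this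
  linarith

lemma Monotone.insert_comp (hf : Monotone f) (e : α) : Monotone (fun T => f (insert e T)) :=
  fun _ _ h => hf (Finset.insert_subset_insert _ h)

lemma Ex_harris (hq : ∀ e, q e ∈ Set.Icc (0 : ℝ) 1) (hf : Monotone f) (hg : Monotone g) :
    Ex q E f * Ex q E g ≤ Ex q E (fun T => f T * g T) := by
  induction E using Finset.induction_on generalizing f g with
  | empty => simp [Ex_empty]
  | insert e E he ih =>
    rw [Ex_insert q he, Ex_insert q he, Ex_insert q he]
    have h1 := ih hf hg
    have h2 := ih (Monotone.insert_comp hf e) (Monotone.insert_comp hg e)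
    have h3 : Ex q E f ≤ Ex q E (fun T => f (insert e T)) :=
      Ex_mono hq fun T _ => hf (Finset.subset_insert _ _)
    have h4 : Ex q E g ≤ Ex q E (fun T => g (insert e T)) :=
      Ex_mono hq fun T _ => hg (Finset.subset_insert _ _)
    have h5 := (hq e).1
    have h6 := sub_nonneg.2 (hq e).2
    have h7 := mul_nonneg (mul_nonneg h5 h6) (mul_nonneg (sub_nonneg.2 h3) (sub_nonneg.2 h4))
    have h8 := mul_le_mul_of_nonneg_left h2 h5
    have h9 := mul_le_mul_of_nonneg_left h1 h6
    nlinarith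

lemma Ex_mono_param (hq : ∀ e, q e ∈ Set.Icc (0 : ℝ) 1) (hq' : ∀ e, q' e ∈ Set.Icc (0 : ℝ) 1)
    (hqq : ∀ e, q e ≤ q' e) (hf : Monotone f) : Ex q E f ≤ Ex q' E f := by
  induction E using Finset.induction_on generalizing f with
  | empty => simp [Ex_empty]
  | insert e E he ih =>
    rw [Ex_insert q he, Ex_insert q' he]
    have h1 := ih hf
    have h2 := ih (Monotone.insert_comp hf e)
    have h3 : Ex q E f ≤ Ex q E (fun T => f (insert e T)) :=
      Ex_mono hq fun T _ => hf (Finset.subset_insert _ _)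
    have h5 := (hq' e).1
    have h6 := sub_nonneg.2 (hq' e).2
    have h8 := mul_le_mul_of_nonneg_left h2 h5
    have h9 := mul_le_mul_of_nonneg_left h1 h6
    nlinarith [mul_nonneg (sub_nonneg.2 (hqq e)) (sub_nonneg.2 h3)]

lemma Ex_mono_set (hq : ∀ e, q e ∈ Set.Icc (0 : ℝ) 1) (hE : E ⊆ E') (hf : Monotone f) :
    Ex q E f ≤ Ex q E' f := by
  have key : ∀ D : Finset α, Disjoint E D → Ex q E f ≤ Ex q (E ∪ D) f := by
    intro D
    induction D using Finset.induction_on with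
    | empty => simp
    | insert e D he ih =>
      intro hd
      rw [Finset.disjoint_insert_right] at hd
      have h1 := ih hd.2
      have hn : e ∉ E ∪ D := by simp [hd.1, he]
      rw [Finset.union_insert, Ex_insert q hn]
      have h3 : Ex q (E ∪ D) f ≤ Ex q (E ∪ D) (fun T => f (insert e T)) :=
        Ex_mono hq fun T _ => hf (Finset.subset_insert _ _)
      nlinarith [mul_le_mul_of_nonneg_left h3 (hq e).1]
  have := key (E' \ E) Finset.disjoint_sdiff
  rwa [Finset.union_sdiff_of_subset hE] at this

lemma Ex_inter (hE : E' ⊆ E) : Ex q E (fun T => f (T ∩ E')) = Ex q E' f := by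
  have key : ∀ D : Finset α, Disjoint E' D → Ex q (E' ∪ D) (fun T => f (T ∩ E')) = Ex q E' f := by
    intro D
    induction D using Finset.induction_on with
    | empty =>
      intro _
      rw [Finset.union_empty]
      exact Ex_congr fun T hT => by rw [Finset.inter_eq_left.2 hT]
    | insert e D he ih =>
      intro hd
      rw [Finset.disjoint_insert_right] at hd
      have hn : e ∉ E' ∪ D := by simp [hd.1, he]
      rw [Finset.union_insert, Ex_insert q hn]
      simp only [Finset.insert_inter_of_notMem hd.1]
      rw [ih hd.2]
      ring
  have := key (E \ E') Finset.disjoint_sdiff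
  rwa [Finset.union_sdiff_of_subset hE] at this

lemma Ex_indep (h : ∀ e ∈ E, (∀ T ⊆ E, e ∉ T → f (insert e T) = f T) ∨
      (∀ T ⊆ E, e ∉ T → g (insert e T) = g T)) :
    Ex q E (fun T => f T * g T) = Ex q E f * Ex q E g := by
  induction E using Finset.induction_on generalizing f g with
  | empty => simp [Ex_empty]
  | insert e E he ih =>
    rw [Ex_insert q he, Ex_insert q he, Ex_insert q he]
    have hsub : ∀ {T}, T ⊆ E → T ⊆ insert e E := fun h => h.trans (Finset.subset_insert _ _)
    have h1 : Ex q E (fun T => f T * g T) = Ex q E f * Ex q E g := by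
      refine ih fun e' he' => (h e' (Finset.mem_insert_of_mem he')).imp ?_ ?_ <;>
      exact fun H T hT => H T (hsub hT)
    have h2 : Ex q E (fun T => f (insert e T) * g (insert e T)) =
        Ex q E (fun T => f (insert e T)) * Ex q E (fun T => g (insert e T)) := by
      refine ih fun e' he' => (h e' (Finset.mem_insert_of_mem he')).imp ?_ ?_ <;>
      · intro H T hT hn
        rw [Finset.insert_comm]
        refine H _ (Finset.insert_subset_insert _ hT) ?_
        rw [Finset.mem_insert, not_or]
        exact ⟨fun h => he (h ▸ he'), hn⟩
    rw [h1, h2]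
    rcases h e (Finset.mem_insert_self _ _) with H | H
    · have : Ex q E (fun T => f (insert e T)) = Ex q E f :=
        Ex_congr fun T hT => H T (hsub hT) fun h => he (hT h)
      rw [this]; ring
    · have : Ex q E (fun T => g (insert e T)) = Ex q E g :=
        Ex_congr fun T hT => H T (hsub hT) fun h => he (hT h)
      rw [this]; ring

lemma Ex_congr_param (h : ∀ e ∈ E, q e = q' e ∨ ∀ T ⊆ E, e ∉ T → f (insert e T) = f T) :
    Ex q E f = Ex q' E f := by
  induction E using Finset.induction_on generalizing f with
  | empty => simp [Ex_empty]
  | insert e E he ih =>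
    rw [Ex_insert q he, Ex_insert q' he]
    have hsub : ∀ {T}, T ⊆ E → T ⊆ insert e E := fun h => h.trans (Finset.subset_insert _ _)
    have h1 : Ex q E f = Ex q' E f := by
      refine ih fun e' he' => (h e' (Finset.mem_insert_of_mem he')).imp id ?_
      exact fun H T hT => H T (hsub hT)
    have h2 : Ex q E (fun T => f (insert e T)) = Ex q' E (fun T => f (insert e T)) := by
      refine ih fun e' he' => (h e' (Finset.mem_insert_of_mem he')).imp id ?_
      intro H T hT hn
      rw [Finset.insert_comm]
      refine H _ (Finset.insert_subset_insert _ hT) ?_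
      rw [Finset.mem_insert, not_or]
      exact ⟨fun h => he (h ▸ he'), hn⟩
    rcases h e (Finset.mem_insert_self _ _) with H | H
    · rw [h1, h2, H]
    · have : Ex q' E (fun T => f (insert e T)) = Ex q' E f :=
        Ex_congr fun T hT => H T (hsub hT) fun h => he (hT h)
      rw [h2, h1, this]; ring

lemma Ex_image {β : Type*} [DecidableEq β] (φ : β → α) (D : Finset β)
    (hφ : Set.InjOn φ D) :
    Ex q (D.image φ) f = Ex (fun b => q (φ b)) D (fun T => f (T.image φ)) := by
  induction D using Finset.induction_on generalizing f with
  | empty => simp [Ex_empty]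
  | insert b D hb ih =>
    have hn : φ b ∉ D.image φ := by
      intro h
      obtain ⟨b', hb', h⟩ := Finset.mem_image.1 h
      have := hφ (by simp [hb']) (by simp) h
      exact hb (this ▸ hb')
    have hφ' : Set.InjOn φ D := hφ.mono (by simp)
    rw [Finset.image_insert, Ex_insert q hn, Ex_insert _ hb, ih hφ', ih hφ']
    simp only [Finset.image_insert]

lemma Ex_hasDerivAt {F : ℝ → Finset α → ℝ} {F' : Finset α → ℝ} {p : ℝ}
    (hF : ∀ T, HasDerivAt (fun p => F p T) (F' T) p) (E : Finset α) :
    HasDerivAt (fun p => Ex (fun _ => p) E (F p))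
      (∑ e ∈ E, Ex (fun _ => p) E (fun T => F p (insert e T) - F p (T.erase e)) +
        Ex (fun _ => p) E F') p := by
  induction E using Finset.induction_on generalizing F F' with
  | empty => simpa [Ex_empty] using hF ∅
  | insert e E he ih =>
    have h1 := ih hF
    have h2 := ih (F := fun p T => F p (insert e T)) (F' := fun T => F' (insert e T))
      (fun T => hF _)
    have h3 := ((hasDerivAt_id p).mul h2).add (((hasDerivAt_const p (1 : ℝ)).sub
      (hasDerivAt_id p)).mul h1)
    simp only [Ex_insert _ he]
    refine h3.congr_deriv ?_
    simp only [id, Pi.sub_apply, Finset.sum_insert he, Finset.insert_idem]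
    have h4 : Ex (fun _ => p) E (fun T => F p (insert e T) - F p ((insert e T).erase e)) =
        Ex (fun _ => p) E (fun T => F p (insert e T)) - Ex (fun _ => p) E (F p) := by
      rw [← Ex_sub]
      exact Ex_congr fun T hT => by rw [Finset.erase_insert fun h => he (hT h)]
    have h5 : Ex (fun _ => p) E (fun T => F p (insert e T) - F p (T.erase e)) =
        Ex (fun _ => p) E (fun T => F p (insert e T)) - Ex (fun _ => p) E (F p) := by
      rw [← Ex_sub]
      exact Ex_congr fun T hT => by rw [Finset.erase_eq_of_notMem fun h => he (hT h)]
    have h6 : ∀ x ∈ E, Ex (fun _ => p) E (fun T => F p (insert x (insert e T)) -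
        F p ((insert e T).erase x)) = Ex (fun _ => p) E (fun T => F p (insert e (insert x T)) -
        F p (insert e (T.erase x))) := by
      intro x hx
      refine Ex_congr fun T _ => ?_
      rw [Finset.insert_comm, Finset.erase_insert_of_ne (by rintro rfl; exact he hx)]
    rw [h4, h5, Finset.sum_add_distrib, ← Finset.mul_sum, ← Finset.mul_sum,
      Finset.sum_congr rfl h6]
    ring

end Expectation

section Clusters
open Classical

variable {V : Type*}

/-- The indicator of a proposition, as a real number. -/
noncomputable def ind (P : Prop) : ℝ := if P then 1 else 0

lemma ind_nonneg (P : Prop) : 0 ≤ ind P := by unfold ind; split_ifs <;> norm_num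
lemma ind_le_one (P : Prop) : ind P ≤ 1 := by unfold ind; split_ifs <;> norm_num
lemma ind_of {P : Prop} (h : P) : ind P = 1 := if_pos h
lemma ind_of_not {P : Prop} (h : ¬P) : ind P = 0 := if_neg h
lemma ind_mono {P Q : Prop} (h : P → Q) : ind P ≤ ind Q := by
  by_cases hP : P
  · rw [ind_of hP, ind_of (h hP)]
  · rw [ind_of_not hP]; exact ind_nonneg _
lemma ind_congr {P Q : Prop} (h : P ↔ Q) : ind P = ind Q := by rw [propext h]
lemma ind_not (P : Prop) : ind (¬P) = 1 - ind P := by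
  by_cases h : P <;> simp [ind, h]
lemma ind_mul_congr {P : Prop} {a b : ℝ} (h : P → a = b) : ind P * a = ind P * b := by
  by_cases hP : P
  · rw [h hP]
  · simp [ind_of_not hP]
lemma ind_mul_mono {P : Prop} {a b : ℝ} (h : P → a ≤ b) : ind P * a ≤ ind P * b := by
  by_cases hP : P
  · exact mul_le_mul_of_nonneg_left (h hP) (ind_nonneg _)
  · simp [ind_of_not hP]

/-- `y` is joined to `x` by a path of edges in `T`. -/
def Reach (T : Finset (Sym2 V)) (x y : V) : Prop :=
  Relation.ReflTransGen (fun a b => s(a, b) ∈ T) x y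

lemma Reach.refl (T : Finset (Sym2 V)) (x : V) : Reach T x x := Relation.ReflTransGen.refl

lemma Reach.trans {T : Finset (Sym2 V)} {x y z : V} (h : Reach T x y) (h' : Reach T y z) :
    Reach T x z := Relation.ReflTransGen.trans h h'

lemma Reach.symm {T : Finset (Sym2 V)} {x y : V} (h : Reach T x y) : Reach T y x := by
  induction h with
  | refl => exact Relation.ReflTransGen.refl
  | tail _ hbc ih => exact Relation.ReflTransGen.head (by rwa [Sym2.eq_swap]) ih

lemma Reach.mono {T T' : Finset (Sym2 V)} (hT : T ⊆ T') {x y : V} (h : Reach T x y) :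
    Reach T' x y := Relation.ReflTransGen.mono (fun _ _ h => hT h) _ _ h

lemma Reach.single {T : Finset (Sym2 V)} {x y : V} (h : s(x, y) ∈ T) : Reach T x y :=
  Relation.ReflTransGen.single h

lemma Reach.of_insert [DecidableEq V] {T : Finset (Sym2 V)} {x y a b : V}
    (h : Reach (insert s(x, y) T) a b) :
    Reach T a b ∨ (Reach T a x ∧ Reach T y b) ∨ (Reach T a y ∧ Reach T x b) := by
  induction h with
  | refl => exact Or.inl (Reach.refl _ _)
  | tail _ hbc ih =>
    rename_i b c _
    rcases Finset.mem_insert.1 hbc with h | h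
    · rcases Sym2.eq_iff.1 h with ⟨rfl, rfl⟩ | ⟨rfl, rfl⟩
      · rcases ih with ih | ⟨ih, _⟩ | ⟨ih, _⟩
        · exact Or.inr (Or.inl ⟨ih, Reach.refl _ _⟩)
        · exact Or.inr (Or.inl ⟨ih, Reach.refl _ _⟩)
        · exact Or.inl ih
      · rcases ih with ih | ⟨ih, _⟩ | ⟨ih, _⟩
        · exact Or.inr (Or.inr ⟨ih, Reach.refl _ _⟩)
        · exact Or.inl ih
        · exact Or.inr (Or.inr ⟨ih, Reach.refl _ _⟩)
    · have h := Reach.single h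
      rcases ih with ih | ⟨ih, ih'⟩ | ⟨ih, ih'⟩
      · exact Or.inl (ih.trans h)
      · exact Or.inr (Or.inl ⟨ih, ih'.trans h⟩)
      · exact Or.inr (Or.inr ⟨ih, ih'.trans h⟩)

lemma Reach.mem {Λ : Finset V} {T : Finset (Sym2 V)} (hT : T ⊆ Λ.sym2) {x y : V}
    (hx : x ∈ Λ) (h : Reach T x y) : y ∈ Λ := by
  induction h with
  | refl => exact hx
  | tail _ hbc _ => exact (Finset.mk_mem_sym2_iff.1 (hT hbc)).2

/-- The vertices of `Λ` joined to some vertex of `U` by edges in `T`. -/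
noncomputable def clU (Λ : Finset V) (T : Finset (Sym2 V)) (U : Finset V) : Finset V :=
  Λ.filter fun x => ∃ u ∈ U, Reach T u x

/-- The cluster of `v`. -/
noncomputable def cl (Λ : Finset V) (T : Finset (Sym2 V)) (v : V) : Finset V :=
  clU Λ T {v}

variable {Λ U A : Finset V} {T T' : Finset (Sym2 V)} {x y z v : V}

lemma mem_clU : x ∈ clU Λ T U ↔ x ∈ Λ ∧ ∃ u ∈ U, Reach T u x := Finset.mem_filter

lemma mem_cl : x ∈ cl Λ T v ↔ x ∈ Λ ∧ Reach T v x := by simp [cl, mem_clU]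

lemma mem_cl_self (hv : v ∈ Λ) : v ∈ cl Λ T v := mem_cl.2 ⟨hv, Reach.refl _ _⟩

lemma clU_subset : clU Λ T U ⊆ Λ := Finset.filter_subset _ _
lemma cl_subset : cl Λ T v ⊆ Λ := clU_subset

lemma subset_clU (hU : U ⊆ Λ) : U ⊆ clU Λ T U :=
  fun x hx => mem_clU.2 ⟨hU hx, x, hx, Reach.refl _ _⟩

lemma cl_mono (h : T ⊆ T') : cl Λ T v ⊆ cl Λ T' v := fun _ hx =>
  mem_cl.2 ⟨(mem_cl.1 hx).1, (mem_cl.1 hx).2.mono h⟩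

lemma clU_mono (h : T ⊆ T') : clU Λ T U ⊆ clU Λ T' U := fun x hx => by
  obtain ⟨h1, u, hu, h2⟩ := mem_clU.1 hx
  exact mem_clU.2 ⟨h1, u, hu, h2.mono h⟩

lemma cl_eq_of_reach (h : Reach T x y) : cl Λ T x = cl Λ T y := by
  ext z
  rw [mem_cl, mem_cl]
  exact and_congr_right fun _ => ⟨fun h' => h.symm.trans h', fun h' => h.trans h'⟩

lemma clU_congr (hT : T ⊆ Λ.sym2) (hU : U ⊆ Λ)
    (h : ∀ e, (∃ x ∈ e, x ∈ clU Λ T U) → (e ∈ T ↔ e ∈ T')) : clU Λ T' U = clU Λ T U := by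
  ext x
  rw [mem_clU, mem_clU]
  refine and_congr Iff.rfl (exists_congr fun u => and_congr_right fun hu => ?_)
  have hmem : ∀ {b}, Reach T u b → b ∈ clU Λ T U := fun {b} hb =>
    mem_clU.2 ⟨hb.mem hT (hU hu), u, hu, hb⟩
  constructor
  · intro hr
    induction hr with
    | refl => exact Reach.refl _ _
    | tail _ hbc ih =>
      exact ih.trans (Reach.single ((h _ ⟨_, Sym2.mem_mk_left _ _, hmem ih⟩).2 hbc))
  · intro hr
    induction hr with
    | refl => exact Reach.refl _ _
    | tail hb hbc ih =>
      exact ih.trans (Reach.single ((h _ ⟨_, Sym2.mem_mk_left _ _, hmem hb⟩).1 hbc))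

/-- The edges of `T` with no endpoint in `A`. -/
noncomputable def off (A : Finset V) (T : Finset (Sym2 V)) : Finset (Sym2 V) :=
  T.filter fun e => ∀ x ∈ e, x ∉ A

lemma off_subset : off A T ⊆ T := Finset.filter_subset _ _

lemma mem_off {e : Sym2 V} : e ∈ off A T ↔ e ∈ T ∧ ∀ x ∈ e, x ∉ A := Finset.mem_filter

lemma off_mono (h : T ⊆ T') : off A T ⊆ off A T' := Finset.filter_subset_filter _ h

lemma off_insert [DecidableEq V] {e : Sym2 V} (he : ∃ x ∈ e, x ∈ A) :
    off A (insert e T) = off A T := by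
  ext e'
  simp only [mem_off, Finset.mem_insert]
  constructor
  · rintro ⟨rfl | h, h'⟩
    · obtain ⟨x, hx, hA⟩ := he
      exact absurd hA (h' x hx)
    · exact ⟨h, h'⟩
  · rintro ⟨h, hr⟩
    exact ⟨Or.inr h, hr⟩

/-- If no edge of `T` leaves `A`, then connections outside `A` avoid `A`. -/
lemma Reach.off_of_closed (hA : ∀ a b, s(a, b) ∈ T → a ∈ A → b ∈ A) (hx : x ∉ A)
    (h : Reach T x y) : Reach (off A T) x y ∧ y ∉ A := by
  induction h with
  | refl => exact ⟨Reach.refl _ _, hx⟩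
  | tail _ hbc ih =>
    rename_i b c _
    have hc : c ∉ A := fun hc => ih.2 (hA c b (by rwa [Sym2.eq_swap]) hc)
    refine ⟨ih.1.trans (Reach.single (mem_off.2 ⟨hbc, fun z hz => ?_⟩)), hc⟩
    rcases Sym2.mem_iff.1 hz with rfl | rfl
    exacts [ih.2, hc]

lemma clU_closed (hT : T ⊆ Λ.sym2) : ∀ a b, s(a, b) ∈ T → a ∈ clU Λ T U → b ∈ clU Λ T U := by
  intro a b hab ha
  obtain ⟨_, u, hu, hr⟩ := mem_clU.1 ha
  exact mem_clU.2 ⟨(Finset.mk_mem_sym2_iff.1 (hT hab)).2, u, hu, hr.trans (Reach.single hab)⟩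

/-- A path ending outside `A` is, after its last visit to `A`, a path avoiding `A`. -/
lemma Reach.last_exit (h : Reach T x y) (hy : y ∉ A) :
    Reach (off A T) x y ∧ x ∉ A ∨
      ∃ a b, a ∈ A ∧ b ∉ A ∧ Reach T x a ∧ s(a, b) ∈ T ∧ Reach (off A T) b y := by
  induction h with
  | refl => exact Or.inl ⟨Reach.refl _ _, hy⟩
  | tail hxb hbc ih =>
    rename_i b c
    by_cases hb : b ∈ A
    · exact Or.inr ⟨b, c, hb, hy, hxb, hbc, Reach.refl _ _⟩
    · have hs : Reach (off A T) b c := by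
        refine Reach.single (mem_off.2 ⟨hbc, fun z hz => ?_⟩)
        rcases Sym2.mem_iff.1 hz with rfl | rfl
        exacts [hb, hy]
      rcases ih hb with ⟨h1, h2⟩ | ⟨a, b', h1, h2, h3, h4, h5⟩
      · exact Or.inl ⟨h1.trans hs, h2⟩
      · exact Or.inr ⟨a, b', h1, h2, h3, h4, h5.trans hs⟩

variable [DecidableEq V]

lemma clU_eq_iff_insert (hU : U ⊆ Λ) {e : Sym2 V}
    (hT : T ⊆ Λ.sym2) (he : e ∈ Λ.sym2) (hA : ∀ x ∈ e, x ∉ A) :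
    clU Λ (insert e T) U = A ↔ clU Λ T U = A := by
  have hT' : insert e T ⊆ Λ.sym2 := Finset.insert_subset he hT
  constructor
  · intro h
    rw [← h]
    refine clU_congr hT' hU ?_
    rintro e' ⟨x, hx, hxA⟩
    rw [h] at hxA
    have : e' ≠ e := by rintro rfl; exact hA x hx hxA
    simp [this]
  · intro h
    rw [← h]
    refine clU_congr hT hU ?_
    rintro e' ⟨x, hx, hxA⟩
    rw [h] at hxA
    have : e' ≠ e := by rintro rfl; exact hA x hx hxA
    simp [this]

variable {q : Sym2 V → ℝ} {E : Finset (Sym2 V)}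

lemma Ex_sum_clU (q : Sym2 V → ℝ) (E : Finset (Sym2 V)) (f : Finset (Sym2 V) → ℝ)
    (Λ U : Finset V) :
    Ex q E f = ∑ A ∈ Λ.powerset, Ex q E (fun T => ind (clU Λ T U = A) * f T) := by
  rw [← Ex_sum]
  refine Ex_congr fun T _ => ?_
  rw [Finset.sum_eq_single (clU Λ T U)]
  · simp [ind]
  · intro A _ hA
    rw [ind_of_not (Ne.symm hA), zero_mul]
  · intro h
    exact absurd (Finset.mem_powerset.2 clU_subset) h

lemma Ex_clU_indep (hE : E ⊆ Λ.sym2) (hU : U ⊆ Λ) (A : Finset V)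
    (g : Finset (Sym2 V) → ℝ) :
    Ex q E (fun T => ind (clU Λ T U = A) * g (off A T)) =
      Ex q E (fun T => ind (clU Λ T U = A)) * Ex q E (fun T => g (off A T)) := by
  refine Ex_indep fun e he => ?_
  by_cases h : ∃ x ∈ e, x ∈ A
  · exact Or.inr fun T _ _ => by rw [off_insert h]
  · push Not at h
    exact Or.inl fun T hT _ =>
      ind_congr (clU_eq_iff_insert hU (hT.trans hE) (hE he) h)

end Clusters

section Ghost
open Classical

lemma Ex_tilt {α : Type*} [DecidableEq α] (q u z : α → ℝ) (E : Finset α) (g : Finset α → ℝ)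
    (h : ∀ e ∈ E, q e * u e + (1 - q e) * z e = 1) :
    Ex q E (fun T => g T * ∏ e ∈ E, (if e ∈ T then u e else z e)) =
      Ex (fun e => q e * u e) E g := by
  refine Finset.sum_congr rfl fun T hT => ?_
  have hT := Finset.mem_powerset.1 hT
  beta_reduce
  rw [← Finset.prod_sdiff hT]
  have h1 : ∏ e ∈ T, (if e ∈ T then u e else z e) = ∏ e ∈ T, u e :=
    Finset.prod_congr rfl fun e he => if_pos he
  have h2 : ∏ e ∈ E \ T, (if e ∈ T then u e else z e) = ∏ e ∈ E \ T, z e :=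
    Finset.prod_congr rfl fun e he => if_neg (Finset.mem_sdiff.1 he).2
  have h3 : ∏ e ∈ E \ T, (1 - q e * u e) = ∏ e ∈ E \ T, ((1 - q e) * z e) :=
    Finset.prod_congr rfl fun e he => by linarith [h e (Finset.mem_sdiff.1 he).1]
  rw [h1, h2, h3, Finset.prod_mul_distrib, Finset.prod_mul_distrib]
  ring

lemma Ex_centered_mul {α : Type*} [DecidableEq α] (p : ℝ) {E : Finset α} {e : α} (he : e ∈ E)
    (f : Finset α → ℝ) :
    Ex (fun _ => p) E (fun T => (p - ind (e ∈ T)) * f T) =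
      p * (1 - p) * Ex (fun _ => p) E (fun T => f (T.erase e) - f (insert e T)) := by
  rw [Ex_split he, Ex_sub]
  simp only [ind_of (Finset.mem_insert_self _ _), ind_of_not (Finset.notMem_erase _ _),
    Ex_mul_left]
  ring

variable {V : Type*} [DecidableEq V]

/-- The weight `∏ γ x` of a vertex set. -/
noncomputable def tw (γ : V → ℝ) (K : Finset V) : ℝ := ∏ x ∈ K, γ x
/-- The complementary weight `1 - ∏ γ x`, the probability that `K` meets a ghost field. -/
noncomputable def sw (γ : V → ℝ) (K : Finset V) : ℝ := 1 - tw γ K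

variable {γ : V → ℝ}

lemma tw_nonneg (hγ : ∀ x, γ x ∈ Set.Icc (0 : ℝ) 1) (K : Finset V) : 0 ≤ tw γ K :=
  Finset.prod_nonneg fun x _ => (hγ x).1

lemma tw_le_one (hγ : ∀ x, γ x ∈ Set.Icc (0 : ℝ) 1) (K : Finset V) : tw γ K ≤ 1 :=
  Finset.prod_le_one (fun x _ => (hγ x).1) fun x _ => (hγ x).2

lemma tw_anti (hγ : ∀ x, γ x ∈ Set.Icc (0 : ℝ) 1) {K K' : Finset V} (h : K ⊆ K') :
    tw γ K' ≤ tw γ K := by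
  unfold tw
  rw [← Finset.prod_sdiff h]
  exact mul_le_of_le_one_left (tw_nonneg hγ K) (tw_le_one hγ _)

lemma tw_union (hγ : ∀ x, γ x ∈ Set.Icc (0 : ℝ) 1) (K K' : Finset V) :
    tw γ K * tw γ K' ≤ tw γ (K ∪ K') := by
  unfold tw
  rw [← Finset.prod_union_inter]
  exact mul_le_of_le_one_right (tw_nonneg hγ _) (tw_le_one hγ _)

lemma sw_nonneg (hγ : ∀ x, γ x ∈ Set.Icc (0 : ℝ) 1) (K : Finset V) : 0 ≤ sw γ K :=
  sub_nonneg.2 (tw_le_one hγ K)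

lemma sw_le_one (hγ : ∀ x, γ x ∈ Set.Icc (0 : ℝ) 1) (K : Finset V) : sw γ K ≤ 1 := by
  have := tw_nonneg hγ K
  unfold sw; linarith

lemma sw_mono (hγ : ∀ x, γ x ∈ Set.Icc (0 : ℝ) 1) {K K' : Finset V} (h : K ⊆ K') :
    sw γ K ≤ sw γ K' := by
  have := tw_anti hγ h
  unfold sw; linarith

/-- The total weight of the clusters meeting `W` which touch `e`. -/
noncomputable def touchWeight (γ : V → ℝ) (Λ W : Finset V) (e : Sym2 V)
    (T : Finset (Sym2 V)) : ℝ :=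
  ∑ K ∈ W.image (cl Λ T), ind (∃ x ∈ e, x ∈ K) * sw γ K

variable {Λ W : Finset V} {T : Finset (Sym2 V)} {x y v : V} {p : ℝ} {E B : Finset (Sym2 V)}

lemma cl_eq_iff (hx : x ∈ Λ) : cl Λ T y = cl Λ T x ↔ Reach T y x :=
  ⟨fun h => (mem_cl.1 (h ▸ mem_cl_self hx : x ∈ cl Λ T y)).2, cl_eq_of_reach⟩

lemma touchWeight_eq (hW : W ⊆ Λ) (hx : x ∈ W) (hy : y ∈ W) :
    touchWeight γ Λ W s(x, y) T =
      sw γ (cl Λ T x) + ind (¬ Reach T x y) * sw γ (cl Λ T y) := by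
  have hmem : ∀ K ∈ W.image (cl Λ T), (∃ z ∈ s(x, y), z ∈ K) ↔
      K ∈ ({cl Λ T x, cl Λ T y} : Finset (Finset V)) := by
    intro K hK
    obtain ⟨w, hw, rfl⟩ := Finset.mem_image.1 hK
    have key : ∀ z ∈ W, z ∈ cl Λ T w ↔ cl Λ T w = cl Λ T z := fun z hz => by
      rw [cl_eq_iff (hW hz), mem_cl]
      exact and_iff_right (hW hz)
    simp [key x hx, key y hy]
  have h1 : touchWeight γ Λ W s(x, y) T =
      ∑ K ∈ ({cl Λ T x, cl Λ T y} : Finset (Finset V)), sw γ K := by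
    unfold touchWeight
    rw [← Finset.sum_filter_add_sum_filter_not (W.image (cl Λ T))
      (fun K => ∃ z ∈ s(x, y), z ∈ K)]
    have h2 : ∑ K ∈ (W.image (cl Λ T)).filter (fun K => ¬ ∃ z ∈ s(x, y), z ∈ K),
        ind (∃ z ∈ s(x, y), z ∈ K) * sw γ K = 0 :=
      Finset.sum_eq_zero fun K hK => by rw [ind_of_not (Finset.mem_filter.1 hK).2, zero_mul]
    rw [h2, add_zero]
    have h3 : (W.image (cl Λ T)).filter (fun K => ∃ z ∈ s(x, y), z ∈ K) =
        ({cl Λ T x, cl Λ T y} : Finset (Finset V)) := by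
      ext K
      rw [Finset.mem_filter]
      constructor
      · exact fun h => (hmem K h.1).1 h.2
      · intro h
        have hK : K ∈ W.image (cl Λ T) := by
          rcases Finset.mem_insert.1 h with h | h
          · exact h ▸ Finset.mem_image_of_mem _ hx
          · exact Finset.mem_singleton.1 h ▸ Finset.mem_image_of_mem _ hy
        exact ⟨hK, (hmem K hK).2 h⟩
    rw [← h3]
    exact Finset.sum_congr rfl fun K hK => by rw [ind_of (Finset.mem_filter.1 hK).2, one_mul]
  rw [h1]
  by_cases h : Reach T x y
  · rw [cl_eq_of_reach h, Finset.pair_eq_singleton, Finset.sum_singleton,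
      ind_of_not (not_not.2 h)]
    ring
  · rw [Finset.sum_pair (fun h' => h ((cl_eq_iff (hW hy)).1 h')), ind_of h, one_mul]

lemma cl_insert_subset : cl Λ (insert s(x, y) T) x ⊆ cl Λ T x ∪ cl Λ T y := by
  intro z hz
  obtain ⟨hz, hr⟩ := mem_cl.1 hz
  rw [Finset.mem_union, mem_cl, mem_cl]
  rcases hr.of_insert with h | ⟨_, h⟩ | ⟨_, h⟩
  exacts [Or.inl ⟨hz, h⟩, Or.inr ⟨hz, h⟩, Or.inl ⟨hz, h⟩]

lemma touchWeight_sub (hγ : ∀ x, γ x ∈ Set.Icc (0 : ℝ) 1) (hW : W ⊆ Λ) (hx : x ∈ W)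
    (hy : y ∈ W) :
    ind (¬ Reach (T.erase s(x, y)) x y) *
        (sw γ (cl Λ (T.erase s(x, y)) x) * sw γ (cl Λ (T.erase s(x, y)) y)) ≤
      touchWeight γ Λ W s(x, y) (T.erase s(x, y)) -
        touchWeight γ Λ W s(x, y) (insert s(x, y) T) := by
  rw [touchWeight_eq hW hx hy, touchWeight_eq hW hx hy]
  have hr : Reach (insert s(x, y) T) x y := Reach.single (Finset.mem_insert_self _ _)
  rw [ind_of_not (not_not.2 hr), zero_mul, add_zero]
  have hins : insert s(x, y) T = insert s(x, y) (T.erase s(x, y)) := by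
    ext e; by_cases h : e = s(x, y) <;> simp [h]
  rw [hins]
  generalize T.erase s(x, y) = T'
  have h1 : sw γ (cl Λ (insert s(x, y) T') x) ≤ sw γ (cl Λ T' x ∪ cl Λ T' y) :=
    sw_mono hγ cl_insert_subset
  by_cases h : Reach T' x y
  · rw [ind_of_not (not_not.2 h)]
    rw [← cl_eq_of_reach h, Finset.union_self] at h1
    linarith
  · rw [ind_of h]
    have h2 := tw_union hγ (cl Λ T' x) (cl Λ T' y)
    unfold sw at h1 ⊢
    nlinarith

/-- The edges of `B` touching `K`. -/
noncomputable def touchSet (B : Finset (Sym2 V)) (K : Finset V) : Finset (Sym2 V) :=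
  B.filter fun e => ∃ x ∈ e, x ∈ K

lemma Ex_touch_prod (hE : E ⊆ Λ.sym2) (hB : B ⊆ E) (hv : v ∈ Λ)
    (w₁ w₀ : ℝ) (hw : p * w₁ + (1 - p) * w₀ = 1) :
    Ex (fun _ => p) E (fun T => ∏ e ∈ touchSet B (cl Λ T v), (if e ∈ T then w₁ else w₀)) = 1 := by
  have hv' : ({v} : Finset V) ⊆ Λ := Finset.singleton_subset_iff.2 hv
  rw [Ex_sum_clU _ E _ Λ {v}]
  have key : ∀ A : Finset V,
      Ex (fun _ => p) E (fun T => ind (clU Λ T {v} = A) *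
        ∏ e ∈ touchSet B (cl Λ T v), (if e ∈ T then w₁ else w₀)) =
      Ex (fun e => if e ∈ B then p * w₁ else p) E (fun T => ind (clU Λ T {v} = A)) := by
    intro A
    have h1 : Ex (fun _ => p) E (fun T => ind (clU Λ T {v} = A) *
        ∏ e ∈ touchSet B (cl Λ T v), (if e ∈ T then w₁ else w₀)) =
        Ex (fun _ => p) E (fun T => ind (clU Λ T {v} = A) * ∏ e ∈ E,
          (if e ∈ T then (if e ∈ touchSet B A then w₁ else 1)
            else (if e ∈ touchSet B A then w₀ else 1))) := by
      refine Ex_congr fun T _ => ind_mul_congr fun hA => ?_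
      have hA : cl Λ T v = A := hA
      have hsub : touchSet B A ⊆ E := (Finset.filter_subset _ _).trans hB
      rw [hA, ← Finset.prod_sdiff hsub]
      have h2 : ∏ e ∈ E \ touchSet B A, (if e ∈ T then (if e ∈ touchSet B A then w₁ else 1)
            else (if e ∈ touchSet B A then w₀ else 1)) = 1 :=
        Finset.prod_eq_one fun e he => by simp [(Finset.mem_sdiff.1 he).2]
      rw [h2, one_mul]
      exact Finset.prod_congr rfl fun e he => by simp [he]
    rw [h1, Ex_tilt (fun _ => p) (fun e => if e ∈ touchSet B A then w₁ else 1)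
      (fun e => if e ∈ touchSet B A then w₀ else 1)]
    · refine Ex_congr_param fun e he => ?_
      by_cases h : ∃ x ∈ e, x ∈ A
      · left
        by_cases heB : e ∈ B
        · simp [touchSet, heB, h]
        · simp [touchSet, heB]
      · push Not at h
        right
        exact fun T hT _ => ind_congr (clU_eq_iff_insert hv' (hT.trans hE) (hE he) h)
    · intro e _
      by_cases h : e ∈ touchSet B A
      · simp only [h, if_true, hw]
      · simp [h]
  rw [Finset.sum_congr rfl fun A _ => key A]
  have := Ex_sum_clU (fun e => if e ∈ B then p * w₁ else p) E (fun _ => 1) Λ {v}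
  simp only [mul_one] at this
  rw [← this, Ex_const]

/-- The centred count of closed edges of `B` touching `K`. -/
noncomputable def fluct (p : ℝ) (B T : Finset (Sym2 V)) (K : Finset V) : ℝ :=
  ∑ e ∈ touchSet B K, (p - ind (e ∈ T))

lemma Ex_exp_fluct (hp : p ∈ Set.Icc (0 : ℝ) 1) (hE : E ⊆ Λ.sym2) (hB : B ⊆ E) (hv : v ∈ Λ)
    {l : ℝ} (hl : 0 ≤ l) (hl1 : l ≤ 1) :
    Ex (fun _ => p) E (fun T => Real.exp (l * fluct p B T (cl Λ T v) -
      l ^ 2 * (touchSet B (cl Λ T v)).card)) ≤ 1 := by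
  obtain ⟨hp0, hp1⟩ := hp
  set Z : ℝ := p * Real.exp (l * (p - 1)) + (1 - p) * Real.exp (l * p) with hZ
  have hb1 : |l * (p - 1)| ≤ 1 := by
    rw [abs_le]; constructor <;> nlinarith
  have hb2 : |l * p| ≤ 1 := by
    rw [abs_le]; constructor <;> nlinarith
  have hZ1 : Z ≤ Real.exp (l ^ 2) := by
    have h1 := (abs_le.1 (Real.abs_exp_sub_one_sub_id_le hb1)).2
    have h2 := (abs_le.1 (Real.abs_exp_sub_one_sub_id_le hb2)).2
    have h3 := Real.add_one_le_exp (l ^ 2)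
    have h4 := mul_le_mul_of_nonneg_left h1 hp0
    have h5 := mul_le_mul_of_nonneg_left h2 (sub_nonneg.2 hp1)
    have h6 : p * (l * (p - 1)) ^ 2 + (1 - p) * (l * p) ^ 2 ≤ l ^ 2 := by
      have : p * (l * (p - 1)) ^ 2 + (1 - p) * (l * p) ^ 2 = (p * (1 - p)) * l ^ 2 := by ring
      rw [this]
      have : p * (1 - p) ≤ 1 := by nlinarith
      exact mul_le_of_le_one_left (sq_nonneg l) this
    nlinarith
  have hZ0 : 0 < Z := by
    rcases hp0.eq_or_lt with h | h
    · rw [hZ, ← h]; simp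
    · have := mul_pos h (Real.exp_pos (l * (p - 1)))
      have := mul_nonneg (sub_nonneg.2 hp1) (Real.exp_pos (l * p)).le
      linarith
  rw [← Ex_touch_prod (p := p) hE hB hv (Real.exp (l * (p - 1)) / Z) (Real.exp (l * p) / Z)
    (by rw [← mul_div_assoc, ← mul_div_assoc, ← add_div, ← hZ, div_self hZ0.ne'])]
  refine Ex_mono (fun _ => ⟨hp0, hp1⟩) fun T _ => ?_
  have h1 : Real.exp (l * fluct p B T (cl Λ T v) - l ^ 2 * (touchSet B (cl Λ T v)).card) =
      ∏ e ∈ touchSet B (cl Λ T v), Real.exp (l * (p - ind (e ∈ T)) - l ^ 2) := by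
    rw [← Real.exp_sum, Finset.sum_sub_distrib, ← Finset.mul_sum]
    simp [fluct, mul_comm]
  rw [h1]
  refine Finset.prod_le_prod (fun e _ => (Real.exp_pos _).le) fun e _ => ?_
  rw [Real.exp_sub]
  split_ifs with h
  · rw [ind_of h]
    exact div_le_div_of_nonneg_left (Real.exp_pos _).le hZ0 hZ1
  · rw [ind_of_not h, sub_zero]
    exact div_le_div_of_nonneg_left (Real.exp_pos _).le hZ0 hZ1

lemma fluct_tail (hp : p ∈ Set.Icc (0 : ℝ) 1) (hE : E ⊆ Λ.sym2) (hB : B ⊆ E) (hv : v ∈ Λ)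
    {a N : ℝ} (ha : 0 ≤ a) (ha2 : a ≤ 2) :
    Ex (fun _ => p) E (fun T => ind (a * (touchSet B (cl Λ T v)).card < fluct p B T (cl Λ T v) ∧
      N ≤ (touchSet B (cl Λ T v)).card)) ≤ Real.exp (-(a ^ 2 * N / 4)) := by
  have h := Ex_exp_fluct hp hE hB hv (l := a / 2) (by linarith) (by linarith)
  have h2 := mul_le_mul_of_nonneg_left h (Real.exp_pos (-(a ^ 2 * N / 4))).le
  rw [mul_one, ← Ex_mul_left] at h2
  refine le_trans (Ex_mono (fun _ => hp) fun T _ => ?_) h2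
  by_cases hc : a * (touchSet B (cl Λ T v)).card < fluct p B T (cl Λ T v) ∧
      N ≤ (touchSet B (cl Λ T v)).card
  · rw [ind_of hc, ← Real.exp_add]
    refine Real.one_le_exp ?_
    nlinarith [mul_le_mul_of_nonneg_left hc.1.le ha, mul_le_mul_of_nonneg_left hc.2 (sq_nonneg a)]
  · rw [ind_of_not hc]
    positivity

/-- A two-ghost inequality: pivotal edges for pairs of heavy clusters are controlled by the
expected total weight of clusters. -/
lemma sum_touchWeight_le (hγ : ∀ x, γ x ∈ Set.Icc (0 : ℝ) 1) (hp : p ∈ Set.Icc (0 : ℝ) 1)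
    (hE : E ⊆ Λ.sym2) (hB : B ⊆ E) (hW : W ⊆ Λ) (hBW : B ⊆ W.sym2) {d : ℕ}
    (hd : ∀ x, (B.filter (fun e => x ∈ e)).card ≤ d)
    {a N : ℝ} (ha : 0 ≤ a) (ha2 : a ≤ 2) (hN : 0 ≤ N) :
    p * (1 - p) * ∑ e ∈ B, Ex (fun _ => p) E (fun T =>
        touchWeight γ Λ W e (T.erase e) - touchWeight γ Λ W e (insert e T)) ≤
      N * Ex (fun _ => p) E (fun T => ∑ K ∈ W.image (cl Λ T), sw γ K) +
        d * (a + Real.exp (-(a ^ 2 * N / 4))) * W.card := by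
  rw [Finset.mul_sum, Finset.sum_congr rfl fun e he => (Ex_centered_mul p (hB he) _).symm,
    ← Ex_sum]
  have hcard : ∀ T, ∀ K ∈ W.image (cl Λ T), ((touchSet B K).card : ℝ) ≤
      ∑ y ∈ W.filter (fun y => cl Λ T y = K), (d : ℝ) := by
    intro T K hK
    rw [Finset.sum_const, nsmul_eq_mul]
    obtain ⟨w, hw, rfl⟩ := Finset.mem_image.1 hK
    have hsub : touchSet B (cl Λ T w) ⊆
        (W.filter (fun y => cl Λ T y = cl Λ T w)).biUnion fun y => B.filter (fun e => y ∈ e) := by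
      intro e he
      obtain ⟨heB, x, hx, hxK⟩ := Finset.mem_filter.1 he
      have hxW : x ∈ W := Finset.mem_sym2_iff.1 (hBW heB) x hx
      exact Finset.mem_biUnion.2 ⟨x, Finset.mem_filter.2 ⟨hxW,
        (cl_eq_of_reach (mem_cl.1 hxK).2).symm⟩, Finset.mem_filter.2 ⟨heB, hx⟩⟩
    have := (Finset.card_le_card hsub).trans (Finset.card_biUnion_le_card_mul _ _ d
      fun y _ => hd y)
    exact_mod_cast this
  have hpt : ∀ T ⊆ E, ∑ e ∈ B, (p - ind (e ∈ T)) * touchWeight γ Λ W e T ≤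
      N * ∑ K ∈ W.image (cl Λ T), sw γ K + d * (a * W.card + ∑ y ∈ W,
        ind (a * (touchSet B (cl Λ T y)).card < fluct p B T (cl Λ T y) ∧
          N ≤ (touchSet B (cl Λ T y)).card)) := by
    intro T _
    have h1 : ∑ e ∈ B, (p - ind (e ∈ T)) * touchWeight γ Λ W e T =
        ∑ K ∈ W.image (cl Λ T), sw γ K * fluct p B T K := by
      simp only [touchWeight, Finset.mul_sum]
      rw [Finset.sum_comm]
      refine Finset.sum_congr rfl fun K _ => ?_
      rw [fluct, touchSet, Finset.mul_sum, Finset.sum_filter]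
      refine Finset.sum_congr rfl fun e _ => ?_
      split_ifs with h
      · rw [ind_of h]; ring
      · rw [ind_of_not h]; ring
    have h2 : ∀ K ∈ W.image (cl Λ T), sw γ K * fluct p B T K ≤ N * sw γ K +
        ∑ y ∈ W.filter (fun y => cl Λ T y = K), d * (a +
          ind (a * (touchSet B (cl Λ T y)).card < fluct p B T (cl Λ T y) ∧
          N ≤ (touchSet B (cl Λ T y)).card)) := by
      intro K hK
      set I := ind (a * (touchSet B K).card < fluct p B T K ∧ N ≤ (touchSet B K).card) with hI
      have h3 : ∑ y ∈ W.filter (fun y => cl Λ T y = K), (d : ℝ) * (a +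
          ind (a * (touchSet B (cl Λ T y)).card < fluct p B T (cl Λ T y) ∧
          N ≤ (touchSet B (cl Λ T y)).card)) =
          (∑ y ∈ W.filter (fun y => cl Λ T y = K), (d : ℝ)) * (a + I) := by
        rw [Finset.sum_mul]
        exact Finset.sum_congr rfl fun y hy => by rw [(Finset.mem_filter.1 hy).2]
      rw [h3]
      have hI0 : 0 ≤ I := ind_nonneg _
      have h4 := mul_le_mul_of_nonneg_right (hcard T K hK) (add_nonneg ha hI0)
      refine le_trans ?_ (add_le_add le_rfl h4)
      have hs0 := sw_nonneg hγ K
      have hs1 := sw_le_one hγ K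
      have hfl : fluct p B T K ≤ (touchSet B K).card := by
        calc fluct p B T K ≤ ∑ e ∈ touchSet B K, (1 : ℝ) :=
              Finset.sum_le_sum fun e _ => by have := ind_nonneg (e ∈ T); linarith [hp.2]
          _ = _ := by simp
      have hn0 : (0 : ℝ) ≤ (touchSet B K).card := Nat.cast_nonneg _
      have han := mul_nonneg ha hn0
      by_cases hlt : N ≤ (touchSet B K).card
      · by_cases hgt : a * (touchSet B K).card < fluct p B T K
        · rw [hI, ind_of ⟨hgt, hlt⟩]
          have : sw γ K * fluct p B T K ≤ fluct p B T K :=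
            mul_le_of_le_one_left (han.trans hgt.le) hs1
          have := mul_nonneg hN hs0
          linarith
        · have hin := mul_nonneg hn0 hI0
          have h5 := mul_nonneg hN hs0
          have h6 : sw γ K * fluct p B T K ≤ sw γ K * (a * (touchSet B K).card) :=
            mul_le_mul_of_nonneg_left (not_lt.1 hgt) hs0
          have h7 : sw γ K * (a * (touchSet B K).card) ≤ a * (touchSet B K).card :=
            mul_le_of_le_one_left han hs1
          linarith
      · have hin := mul_nonneg hn0 hI0
        have h6 : sw γ K * fluct p B T K ≤ sw γ K * N :=
          mul_le_mul_of_nonneg_left (hfl.trans (not_le.1 hlt).le) hs0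
        linarith
    rw [h1]
    refine (Finset.sum_le_sum h2).trans (le_of_eq ?_)
    rw [Finset.sum_add_distrib, ← Finset.mul_sum]
    congr 1
    rw [Finset.sum_fiberwise_of_maps_to (fun y hy => Finset.mem_image_of_mem _ hy),
      ← Finset.mul_sum, Finset.sum_add_distrib, Finset.sum_const, nsmul_eq_mul]
    ring
  refine (Ex_mono (fun _ => hp) hpt).trans ?_
  rw [Ex_add, Ex_mul_left, Ex_mul_left, Ex_add, Ex_const, Ex_sum]
  have h8 : ∑ y ∈ W, Ex (fun _ => p) E (fun T =>
      ind (a * (touchSet B (cl Λ T y)).card < fluct p B T (cl Λ T y) ∧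
          N ≤ (touchSet B (cl Λ T y)).card)) ≤ ∑ y ∈ W, Real.exp (-(a ^ 2 * N / 4)) :=
    Finset.sum_le_sum fun y hy => fluct_tail hp hE hB (hW hy) ha ha2
  rw [Finset.sum_const, nsmul_eq_mul] at h8
  have h9 := mul_le_mul_of_nonneg_left h8 (Nat.cast_nonneg (α := ℝ) d)
  nlinarith

end Ghost

section Graph
open Classical

variable {V : Type*} [DecidableEq V] (G : SimpleGraph V) [G.LocallyFinite]

/-- The edges of `G` with both endpoints in `Λ`. -/
noncomputable def edgesIn (Λ : Finset V) : Finset (Sym2 V) :=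
  Λ.sym2.filter fun e => e ∈ G.edgeSet

/-- The `r`-neighbourhood of a finite vertex set. -/
def thick (r : ℕ) (A : Finset V) : Finset V :=
  (fun A => A ∪ A.biUnion fun x => G.neighborFinset x)^[r] A

variable {G} {Λ A W : Finset V} {T E : Finset (Sym2 V)} {x y z v : V} {r d : ℕ}

lemma mk_mem_edgesIn : s(x, y) ∈ edgesIn G Λ ↔ x ∈ Λ ∧ y ∈ Λ ∧ G.Adj x y := by
  rw [edgesIn, Finset.mem_filter, Finset.mk_mem_sym2_iff, SimpleGraph.mem_edgeSet, and_assoc]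

lemma edgesIn_subset : edgesIn G Λ ⊆ Λ.sym2 := Finset.filter_subset _ _

lemma edgesIn_mono {Λ' : Finset V} (h : Λ ⊆ Λ') : edgesIn G Λ ⊆ edgesIn G Λ' :=
  Finset.filter_subset_filter _ (Finset.sym2_mono h)

lemma card_edges_at (hd : ∀ x, (G.neighborFinset x).card ≤ d) (x : V) :
    ((edgesIn G Λ).filter (fun e => x ∈ e)).card ≤ d := by
  refine (Finset.card_le_card (t := (G.neighborFinset x).image fun y => s(x, y)) ?_).trans
    (Finset.card_image_le.trans (hd x))
  intro e he
  obtain ⟨h1, h2⟩ := Finset.mem_filter.1 he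
  obtain ⟨y, rfl⟩ := Sym2.mem_iff_exists.1 h2
  exact Finset.mem_image.2 ⟨y, by simpa using (mk_mem_edgesIn.1 h1).2.2, rfl⟩

lemma thick_zero : thick G 0 A = A := rfl

lemma thick_succ : thick G (r + 1) A = thick G r A ∪
    (thick G r A).biUnion fun x => G.neighborFinset x := by
  unfold thick
  rw [Function.iterate_succ_apply']

lemma thick_succ' : thick G (r + 1) A = thick G r (A ∪ A.biUnion fun x => G.neighborFinset x) := by
  unfold thick
  rw [Function.iterate_succ_apply]

lemma mem_thick : x ∈ thick G r A ↔ ∃ a ∈ A, inBall G a r x := by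
  induction r generalizing A with
  | zero =>
    rw [thick_zero]
    constructor
    · exact fun h => ⟨x, h, SimpleGraph.Walk.nil, le_rfl⟩
    · rintro ⟨a, ha, w, hw⟩
      rwa [← SimpleGraph.Walk.eq_of_length_eq_zero (Nat.le_zero.1 hw)]
  | succ r ih =>
    rw [thick_succ', ih]
    constructor
    · rintro ⟨b, hb, w, hw⟩
      rcases Finset.mem_union.1 hb with hb | hb
      · exact ⟨b, hb, w, hw.trans (Nat.le_succ _)⟩
      · obtain ⟨a, ha, hab⟩ := Finset.mem_biUnion.1 hb
        rw [SimpleGraph.mem_neighborFinset] at hab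
        exact ⟨a, ha, SimpleGraph.Walk.cons hab w, by simpa using hw⟩
    · rintro ⟨a, ha, w, hw⟩
      cases w with
      | nil => exact ⟨x, Finset.mem_union_left _ ha, SimpleGraph.Walk.nil, Nat.zero_le _⟩
      | cons h w =>
        refine ⟨_, Finset.mem_union_right _ (Finset.mem_biUnion.2 ⟨a, ha, ?_⟩), w, ?_⟩
        · rwa [SimpleGraph.mem_neighborFinset]
        · simpa using hw

lemma subset_thick : A ⊆ thick G r A := fun x hx =>
  mem_thick.2 ⟨x, hx, SimpleGraph.Walk.nil, by simp⟩

lemma thick_mono {A' : Finset V} (h : A ⊆ A') : thick G r A ⊆ thick G r A' := fun x hx => by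
  obtain ⟨a, ha, h'⟩ := mem_thick.1 hx
  exact mem_thick.2 ⟨a, h ha, h'⟩

lemma thick_thick {s : ℕ} : thick G r (thick G s A) = thick G (r + s) A := by
  unfold thick
  rw [Function.iterate_add_apply]

lemma thick_mono_radius {s : ℕ} (h : r ≤ s) : thick G r A ⊆ thick G s A := fun x hx => by
  obtain ⟨a, ha, w, hw⟩ := mem_thick.1 hx
  exact mem_thick.2 ⟨a, ha, w, hw.trans h⟩

lemma card_thick_le (hd : ∀ x, (G.neighborFinset x).card ≤ d) :
    (thick G r A).card ≤ (d + 1) ^ r * A.card := by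
  induction r with
  | zero => simp [thick_zero]
  | succ r ih =>
    rw [thick_succ]
    calc _ ≤ (thick G r A).card + (thick G r A).card * d :=
          (Finset.card_union_le _ _).trans (add_le_add le_rfl
            (Finset.card_biUnion_le_card_mul _ _ d fun x _ => hd x))
      _ = (d + 1) * (thick G r A).card := by ring
      _ ≤ (d + 1) * ((d + 1) ^ r * A.card) := Nat.mul_le_mul le_rfl ih
      _ = _ := by ring

lemma le_card_thick {h : ℝ} (h0 : 0 ≤ h)
    (hexp : ∀ A : Finset V, (1 + h) * A.card ≤ ((thick G 1 A).card : ℝ)) :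
    (1 + h) ^ r * A.card ≤ ((thick G r A).card : ℝ) := by
  induction r with
  | zero => simp [thick_zero]
  | succ r ih =>
    have h1 := hexp (thick G r A)
    rw [thick_thick, add_comm 1 r] at h1
    refine le_trans ?_ h1
    rw [pow_succ', mul_assoc]
    exact mul_le_mul_of_nonneg_left ih (by linarith)

lemma mem_thick_of_walk (w : G.Walk x y) (hw : w.length ≤ r) (hz : z ∈ w.support) :
    z ∈ thick G r {x} := by
  rw [mem_thick]
  exact ⟨x, Finset.mem_singleton_self _, w.takeUntil z hz,
    (w.length_takeUntil_le_length hz).trans hw⟩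

lemma mem_thick_symm : x ∈ thick G r {y} ↔ y ∈ thick G r {x} := by
  simp only [mem_thick, Finset.mem_singleton, exists_eq_left]
  constructor <;> rintro ⟨w, hw⟩ <;> exact ⟨w.reverse, by simpa using hw⟩

end Graph

section TwoArm
open Classical

variable {V : Type*} [DecidableEq V] {G : SimpleGraph V} [G.LocallyFinite]
variable {Λ A W : Finset V} {T E : Finset (Sym2 V)} {x y z v : V} {r d : ℕ} {γ : V → ℝ} {p : ℝ}

/-- The expected product of weights of the clusters of `x` and `y` when these are distinct. -/
noncomputable def twoArm (γ : V → ℝ) (Λ : Finset V) (x y : V) (T : Finset (Sym2 V)) : ℝ :=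
  ind (¬ Reach T x y) * (sw γ (cl Λ T x) * sw γ (cl Λ T y))

lemma twoArm_nonneg (hγ : ∀ x, γ x ∈ Set.Icc (0 : ℝ) 1) : 0 ≤ twoArm γ Λ x y T :=
  mul_nonneg (ind_nonneg _) (mul_nonneg (sw_nonneg hγ _) (sw_nonneg hγ _))

lemma twoArm_step (hγ : ∀ x, γ x ∈ Set.Icc (0 : ℝ) 1) (x y z : V) (T : Finset (Sym2 V)) :
    twoArm γ Λ x y T ≤ twoArm γ Λ x z (T.erase s(x, z)) +
      twoArm γ Λ z y (insert s(x, z) T) := by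
  have h0 : 0 ≤ twoArm γ Λ x z (T.erase s(x, z)) := twoArm_nonneg hγ
  have h1 : 0 ≤ twoArm γ Λ z y (insert s(x, z) T) := twoArm_nonneg hγ
  by_cases hxy : Reach T x y
  · have : twoArm γ Λ x y T = 0 := by rw [twoArm, ind_of_not (not_not.2 hxy), zero_mul]
    linarith
  have hxz : Reach (insert s(x, z) T) x z := Reach.single (Finset.mem_insert_self _ _)
  by_cases hzy : Reach (insert s(x, z) T) z y
  · have he : s(x, z) ∉ T := fun he => by
      rw [Finset.insert_eq_of_mem he] at hxz hzy
      exact hxy (hxz.trans hzy)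
    have hzy' : Reach T z y := by
      rcases hzy.of_insert with h | ⟨_, h⟩ | ⟨_, h⟩
      exacts [h, h, absurd h hxy]
    have hxz' : ¬ Reach T x z := fun h => hxy (h.trans hzy')
    have : twoArm γ Λ x y T = twoArm γ Λ x z (T.erase s(x, z)) := by
      rw [Finset.erase_eq_of_notMem he, twoArm, twoArm, ind_of hxy, ind_of hxz',
        cl_eq_of_reach hzy']
    linarith
  · have : twoArm γ Λ x y T ≤ twoArm γ Λ z y (insert s(x, z) T) := by
      rw [twoArm, twoArm, ind_of hxy, ind_of hzy, one_mul, one_mul, ← cl_eq_of_reach hxz]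
      exact mul_le_mul (sw_mono hγ (cl_mono (Finset.subset_insert _ _)))
        (sw_mono hγ (cl_mono (Finset.subset_insert _ _))) (sw_nonneg hγ _) (sw_nonneg hγ _)
    linarith

lemma twoArm_walk (hγ : ∀ x, γ x ∈ Set.Icc (0 : ℝ) 1) (hp : p ∈ Set.Icc (0 : ℝ) 1)
    (w : G.Walk x y) (hw : ∀ e ∈ w.edges, e ∈ E) (δ : Sym2 V → ℝ) (hδ0 : ∀ e, 0 ≤ δ e)
    (hδ : ∀ x z, s(x, z) ∈ w.edges →
      Ex (fun _ => p) E (fun T => twoArm γ Λ x z (T.erase s(x, z))) ≤ δ s(x, z)) :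
    p ^ w.length * Ex (fun _ => p) E (twoArm γ Λ x y) ≤ (w.edges.map δ).sum := by
  induction w with
  | nil =>
    rename_i u
    have : Ex (fun _ => p) E (twoArm γ Λ u u) = 0 := by
      rw [← Ex_const (fun _ => p) E 0]
      refine Ex_congr fun T _ => ?_
      rw [twoArm, ind_of_not (not_not.2 (Reach.refl _ _)), zero_mul]
    simp [this]
  | cons h w ih =>
    rename_i x z y
    simp only [SimpleGraph.Walk.edges_cons, List.mem_cons, forall_eq_or_imp] at hw
    have h1 := ih hw.2 fun a b hab => hδ a b (by simp [hab])
    have h2 := hδ x z (by simp)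
    have h3 : Ex (fun _ => p) E (twoArm γ Λ x y) ≤ δ s(x, z) +
        Ex (fun _ => p) E (fun T => twoArm γ Λ z y (insert s(x, z) T)) := by
      refine (Ex_mono (fun _ => hp) fun T _ => twoArm_step hγ x y z T).trans ?_
      rw [Ex_add]; linarith
    have h4 := Ex_insert_le (q := fun _ => p) (fun _ => hp) hw.1 (f := twoArm γ Λ z y)
      fun T _ => twoArm_nonneg hγ
    simp only [SimpleGraph.Walk.length_cons, SimpleGraph.Walk.edges_cons, List.map_cons,
      List.sum_cons]
    have h5 := mul_le_mul_of_nonneg_left h4 (pow_nonneg hp.1 w.length)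
    have h6 := mul_le_mul_of_nonneg_left h3 (pow_nonneg hp.1 (w.length + 1))
    have h7 : p ^ (w.length + 1) * δ s(x, z) ≤ δ s(x, z) :=
      mul_le_of_le_one_left (hδ0 _) (pow_le_one₀ hp.1 hp.2)
    rw [pow_succ] at h6 h7 ⊢
    linarith

lemma sw_cl_monotone (hγ : ∀ x, γ x ∈ Set.Icc (0 : ℝ) 1) (v : V) :
    Monotone fun T => sw γ (cl Λ T v) := fun _ _ h => sw_mono hγ (cl_mono h)

lemma le_Ex_twoArm (hγ : ∀ x, γ x ∈ Set.Icc (0 : ℝ) 1) (hp : p ∈ Set.Icc (0 : ℝ) 1)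
    {θ ζ : ℝ} (hθ0 : 0 ≤ θ) (hx : θ ≤ Ex (fun _ => p) E fun T => sw γ (cl Λ T x))
    (hy : θ ≤ Ex (fun _ => p) E fun T => sw γ (cl Λ T y))
    (hxy : Ex (fun _ => p) E (fun T => ind (Reach T x y)) ≤ ζ) :
    θ ^ 2 - ζ ≤ Ex (fun _ => p) E (twoArm γ Λ x y) := by
  have h1 := Ex_harris (E := E) (fun _ => hp) (sw_cl_monotone (Λ := Λ) hγ x)
    (sw_cl_monotone (Λ := Λ) hγ y)
  have h2 : Ex (fun _ => p) E (fun T => sw γ (cl Λ T x) * sw γ (cl Λ T y)) -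
      Ex (fun _ => p) E (fun T => ind (Reach T x y)) ≤ Ex (fun _ => p) E (twoArm γ Λ x y) := by
    rw [← Ex_sub]
    refine Ex_mono (fun _ => hp) fun T _ => ?_
    rw [twoArm, ind_not]
    have h3 : sw γ (cl Λ T x) * sw γ (cl Λ T y) ≤ 1 :=
      mul_le_one₀ (sw_le_one hγ _) (sw_nonneg hγ _) (sw_le_one hγ _)
    have h4 := ind_nonneg (Reach T x y)
    nlinarith
  nlinarith

/-- If clusters have large expected weight and every vertex of `W` has a nearby vertex to which it
is rarely connected, then the number of heavy clusters near `W` is of order `|W|`. -/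
lemma heavy_clusters (hγ : ∀ x, γ x ∈ Set.Icc (0 : ℝ) 1) (hp : p ∈ Set.Icc (0 : ℝ) 1)
    (hd : ∀ x, (G.neighborFinset x).card ≤ d) (hW : thick G r W ⊆ Λ)
    {θ ζ : ℝ} (hθ0 : 0 ≤ θ)
    (hθ : ∀ y ∈ Λ, θ ≤ Ex (fun _ => p) (edgesIn G Λ) fun T => sw γ (cl Λ T y))
    (hζ : ∀ x ∈ W, ∃ y, inBall G x r y ∧
      Ex (fun _ => p) (edgesIn G Λ) (fun T => ind (Reach T x y)) ≤ ζ)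
    (hθζ : ζ ≤ θ ^ 2)
    {a N : ℝ} (ha : 0 ≤ a) (ha2 : a ≤ 2) (hN : 0 ≤ N) :
    p * (1 - p) * p ^ r * (θ ^ 2 - ζ) * (thick G r W).card ≤ 2 * ((d + 1) ^ r) ^ 2 *
      (N * Ex (fun _ => p) (edgesIn G Λ)
        (fun T => ∑ K ∈ (thick G r W).image (cl Λ T), sw γ K) +
        d * (a + Real.exp (-(a ^ 2 * N / 4))) * (thick G r W).card) := by
  set E := edgesIn G Λ with hE
  set W' := thick G r W with hW'
  set B := edgesIn G W' with hB
  set δ : Sym2 V → ℝ := fun e => if e ∈ B then Ex (fun _ => p) E (fun T =>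
        touchWeight γ Λ W' e (T.erase e) - touchWeight γ Λ W' e (insert e T)) else 0 with hδ
  have hBE : B ⊆ E := edgesIn_mono hW
  have hkey := sum_touchWeight_le (γ := γ) (E := E) (B := B) (W := W') hγ hp edgesIn_subset hBE hW
    edgesIn_subset (card_edges_at hd) ha ha2 hN
  have hsumδ : ∑ e ∈ B, Ex (fun _ => p) E (fun T =>
      touchWeight γ Λ W' e (T.erase e) - touchWeight γ Λ W' e (insert e T)) = ∑ e ∈ B, δ e :=
    Finset.sum_congr rfl fun e he => by rw [hδ]; simp [he]
  rw [hsumδ] at hkey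
  have hδB : ∀ x z, s(x, z) ∈ B →
      Ex (fun _ => p) E (fun T => twoArm γ Λ x z (T.erase s(x, z))) ≤ δ s(x, z) := by
    intro x z hxz
    obtain ⟨hx, hz, _⟩ := mk_mem_edgesIn.1 hxz
    simp only [hδ, hxz, if_true]
    exact Ex_mono (fun _ => hp) fun T _ => touchWeight_sub hγ hW hx hz
  have hδ0 : ∀ e, 0 ≤ δ e := by
    intro e
    by_cases he : e ∈ B
    · induction e using Sym2.ind with
      | _ x z => exact (Ex_nonneg (fun _ => hp) fun T _ => twoArm_nonneg hγ).trans (hδB x z he)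
    · simp [hδ, he]
  clear_value δ
  have hpath : ∀ x : V, ∃ P : Finset (Sym2 V), x ∈ W → P ⊆ B ∧ (∀ e ∈ P, ∃ z ∈ e, x ∈ thick G r {z}) ∧
      p ^ r * (θ ^ 2 - ζ) ≤ ∑ e ∈ P, δ e := by
    intro x
    by_cases hx : x ∈ W
    swap
    · exact ⟨∅, fun h => absurd h hx⟩
    obtain ⟨y, ⟨w, hw⟩, hy⟩ := hζ x hx
    have hlen : w.bypass.length ≤ r := w.length_bypass_le_length.trans hw
    have hsupp : ∀ z ∈ w.bypass.support, z ∈ W' := fun z hz =>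
      thick_mono (Finset.singleton_subset_iff.2 hx) (mem_thick_of_walk w.bypass hlen hz)
    have hPB : ∀ e ∈ w.bypass.edges, e ∈ B := by
      intro e he
      induction e using Sym2.ind with
      | _ a b =>
        exact mk_mem_edgesIn.2 ⟨hsupp _ (w.bypass.fst_mem_support_of_mem_edges he),
          hsupp _ (w.bypass.snd_mem_support_of_mem_edges he), w.bypass.adj_of_mem_edges he⟩
    refine ⟨w.bypass.edges.toFinset, fun _ => ⟨fun e he => hPB e (List.mem_toFinset.1 he), ?_, ?_⟩⟩
    · intro e he
      have he := List.mem_toFinset.1 he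
      induction e using Sym2.ind with
      | _ a b =>
        exact ⟨a, Sym2.mem_mk_left _ _, mem_thick_symm.1
          (mem_thick_of_walk w.bypass hlen (w.bypass.fst_mem_support_of_mem_edges he))⟩
    · have h1 := twoArm_walk (Λ := Λ) hγ hp w.bypass (fun e he => hBE (hPB e he)) δ hδ0
        fun a b hab => hδB a b (hPB _ hab)
      rw [List.sum_toFinset _ w.bypass_isPath.isTrail.edges_nodup]
      refine le_trans ?_ h1
      have hmem : ∀ z ∈ W', z ∈ Λ := fun z hz => hW hz
      have h2 : θ ^ 2 - ζ ≤ Ex (fun _ => p) E (twoArm γ Λ x y) :=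
        le_Ex_twoArm hγ hp hθ0 (hθ x (hW (subset_thick hx)))
          (hθ y (hW (mem_thick.2 ⟨x, hx, w, hw⟩))) hy
      refine mul_le_mul (pow_le_pow_of_le_one hp.1 hp.2 hlen) h2 (sub_nonneg.2 hθζ)
        (pow_nonneg hp.1 _)
  choose P hP using hpath
  have hcount : ∑ x ∈ W, ∑ e ∈ P x, δ e ≤ (d + 1) ^ r * ((∑ e ∈ B, δ e) + ∑ e ∈ B, δ e) := by
    have h1 : ∀ x ∈ W, ∑ e ∈ P x, δ e = ∑ e ∈ B, if e ∈ P x then δ e else 0 := by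
      intro x hx
      rw [Finset.sum_ite_mem, Finset.inter_eq_right.2 (hP x hx).1]
    rw [Finset.sum_congr rfl h1, Finset.sum_comm, ← two_mul, ← mul_assoc, Finset.mul_sum]
    refine Finset.sum_le_sum fun e he => ?_
    rw [← Finset.sum_filter, Finset.sum_const, nsmul_eq_mul]
    refine mul_le_mul_of_nonneg_right ?_ (hδ0 e)
    induction e using Sym2.ind with
    | _ a b =>
      have hsub : W.filter (fun x => s(a, b) ∈ P x) ⊆ thick G r {a} ∪ thick G r {b} := by
        intro x hx
        obtain ⟨hx, he⟩ := Finset.mem_filter.1 hx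
        obtain ⟨z, hz, hxz⟩ := (hP x hx).2.1 _ he
        rcases Sym2.mem_iff.1 hz with rfl | rfl
        exacts [Finset.mem_union_left _ hxz, Finset.mem_union_right _ hxz]
      have h2 := (Finset.card_le_card hsub).trans (Finset.card_union_le _ _)
      have h3 := card_thick_le (A := {a}) (r := r) hd
      have h4 := card_thick_le (A := {b}) (r := r) hd
      simp only [Finset.card_singleton, mul_one] at h3 h4
      have h5 : (W.filter (fun x => s(a, b) ∈ P x)).card ≤ (d + 1) ^ r * 2 := by omega
      exact_mod_cast h5
  have hlow : W.card * (p ^ r * (θ ^ 2 - ζ)) ≤ ∑ x ∈ W, ∑ e ∈ P x, δ e := by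
    rw [← nsmul_eq_mul]
    exact Finset.card_nsmul_le_sum _ _ _ fun x hx => (hP x hx).2.2
  have hcard : (W'.card : ℝ) ≤ (d + 1) ^ r * W.card := by
    exact_mod_cast card_thick_le (A := W) (r := r) hd
  have hpp : 0 ≤ p * (1 - p) := mul_nonneg hp.1 (sub_nonneg.2 hp.2)
  have hD : (0 : ℝ) ≤ (d + 1) ^ r := by positivity
  have hc0 : 0 ≤ p ^ r * (θ ^ 2 - ζ) := mul_nonneg (pow_nonneg hp.1 _) (sub_nonneg.2 hθζ)
  calc p * (1 - p) * p ^ r * (θ ^ 2 - ζ) * W'.card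
      = p * (1 - p) * (p ^ r * (θ ^ 2 - ζ)) * W'.card := by ring
    _ ≤ p * (1 - p) * (p ^ r * (θ ^ 2 - ζ)) * ((d + 1) ^ r * W.card) :=
        mul_le_mul_of_nonneg_left hcard (mul_nonneg hpp hc0)
    _ = p * (1 - p) * (d + 1) ^ r * (W.card * (p ^ r * (θ ^ 2 - ζ))) := by ring
    _ ≤ p * (1 - p) * (d + 1) ^ r * ((d + 1) ^ r * ((∑ e ∈ B, δ e) + ∑ e ∈ B, δ e)) :=
        mul_le_mul_of_nonneg_left (hlow.trans hcount) (mul_nonneg hpp hD)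
    _ = 2 * ((d + 1) ^ r) ^ 2 * (p * (1 - p) * ∑ e ∈ B, δ e) := by ring
    _ ≤ _ := mul_le_mul_of_nonneg_left hkey (by positivity)

end TwoArm

section Boundary
open Classical

variable {V : Type*} [DecidableEq V] {G : SimpleGraph V} [G.LocallyFinite]
variable {Λ A W F : Finset V} {T E : Finset (Sym2 V)} {x y z v o : V} {r d : ℕ} {γ : V → ℝ} {p : ℝ}

lemma sum_boundary_le {S : Finset V} (hS : thick G 1 S ⊆ Λ) {φ : Sym2 V → ℝ}
    (hφ : ∀ e, 0 ≤ φ e) :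
    ∑ x ∈ S, ∑ y ∈ G.neighborFinset x \ S, φ s(x, y) ≤ ∑ e ∈ edgesIn G Λ, φ e := by
  rw [Finset.sum_sigma']
  set D := S.sigma fun x => G.neighborFinset x \ S with hD
  have hinj : Set.InjOn (fun q : (_ : V) × V => s(q.1, q.2)) D := by
    rintro ⟨x, y⟩ hxy ⟨x', y'⟩ hxy' h
    simp only [hD, Finset.coe_sigma, Set.mem_sigma_iff, Finset.mem_coe, Finset.mem_sdiff] at hxy hxy'
    rcases Sym2.eq_iff.1 h with ⟨h1, h2⟩ | ⟨h1, h2⟩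
    · simp only at h1 h2; subst h1; subst h2; rfl
    · simp only at h1 h2; subst h1; subst h2
      exact absurd hxy.1 hxy'.2.2
  rw [← Finset.sum_image (f := φ) hinj]
  refine Finset.sum_le_sum_of_subset_of_nonneg ?_ fun e _ _ => hφ e
  intro e he
  obtain ⟨⟨x, y⟩, hxy, rfl⟩ := Finset.mem_image.1 he
  simp only [hD, Finset.mem_sigma, Finset.mem_sdiff, SimpleGraph.mem_neighborFinset] at hxy
  refine mk_mem_edgesIn.2 ⟨hS (subset_thick hxy.1), hS ?_, hxy.2.1⟩
  exact mem_thick.2 ⟨x, hxy.1, SimpleGraph.Walk.cons hxy.2.1 SimpleGraph.Walk.nil, by simp⟩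

lemma Reach.off_of_avoids (h : ∀ a ∈ A, ¬ Reach T y a) (hr : Reach T y z) :
    Reach (off A T) y z := by
  induction hr with
  | refl => exact Reach.refl _ _
  | tail hb hbc ih =>
    refine ih.trans (Reach.single (mem_off.2 ⟨hbc, fun x hx hA => ?_⟩))
    rcases Sym2.mem_iff.1 hx with rfl | rfl
    · exact h _ hA hb
    · exact h _ hA (hb.trans (Reach.single hbc))

lemma exists_last_exit (w : G.Walk x y) (hy : y ∉ A) :
    (∀ z ∈ w.support, z ∉ A) ∨ ∃ a b, a ∈ A ∧ b ∉ A ∧ G.Adj a b ∧ ∃ w' : G.Walk b y,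
      w'.length ≤ w.length ∧ (∀ z ∈ w'.support, z ∉ A) ∧ ∀ z ∈ w'.support, z ∈ w.support := by
  induction w with
  | nil => left; simpa using hy
  | cons h w ih =>
    rename_i x b y
    rcases ih hy with h1 | ⟨a, b', h1, h2, h3, w', h4, h5, h6⟩
    · by_cases hx : x ∈ A
      · exact Or.inr ⟨x, b, hx, h1 _ w.start_mem_support, h, w, by simp, h1, by simp_all⟩
      · left
        intro z hz
        rcases List.mem_cons.1 hz with rfl | hz
        exacts [hx, h1 z hz]
    · exact Or.inr ⟨a, b', h1, h2, h3, w', h4.trans (by simp), h5,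
        fun z hz => List.mem_cons_of_mem _ (h6 z hz)⟩

lemma Ex_off_walk (hγ : ∀ x, γ x ∈ Set.Icc (0 : ℝ) 1) (hp : p ∈ Set.Icc (0 : ℝ) 1)
    (w : G.Walk x y) (hw : ∀ e ∈ w.edges, e ∈ E) (hA : ∀ z ∈ w.support, z ∉ A) :
    p ^ w.length * Ex (fun _ => p) E (fun T => sw γ (cl Λ (off A T) y)) ≤
      Ex (fun _ => p) E (fun T => sw γ (cl Λ (off A T) x)) := by
  induction w with
  | nil => simp
  | cons h w ih =>
    rename_i x z y
    have h1 := ih (fun e he => hw e (by simp [he])) (fun z hz => hA z (by simp [hz]))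
    have he : s(x, z) ∈ E := hw _ (by simp)
    have h2 := Ex_insert_le (q := fun _ => p) (fun _ => hp) he
      (f := fun T => sw γ (cl Λ (off A T) x)) fun T _ => sw_nonneg hγ _
    have h3 : Ex (fun _ => p) E (fun T => sw γ (cl Λ (off A T) z)) ≤
        Ex (fun _ => p) E (fun T => sw γ (cl Λ (off A (insert s(x, z) T)) x)) := by
      refine Ex_mono (fun _ => hp) fun T _ => sw_mono hγ ?_
      have hr : Reach (off A (insert s(x, z) T)) x z := by
        refine Reach.single (mem_off.2 ⟨Finset.mem_insert_self _ _, fun t ht => ?_⟩)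
        rcases Sym2.mem_iff.1 ht with rfl | rfl
        · exact hA _ (by simp)
        · exact hA _ (by simp)
      rw [cl_eq_of_reach hr]
      exact cl_mono (off_mono (Finset.subset_insert _ _))
    rw [SimpleGraph.Walk.length_cons, pow_succ']
    have h4 := mul_le_mul_of_nonneg_left (h1.trans h3) hp.1
    linarith

lemma sum_ind {ι : Type*} (s : Finset ι) (P : ι → Prop) [DecidablePred P] :
    ∑ x ∈ s, ind (P x) = ((s.filter P).card : ℝ) := by
  rw [Finset.card_filter]
  push_cast
  exact Finset.sum_congr rfl fun x _ => by by_cases h : P x <;> simp [ind, h]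

lemma sum_image_le {ι κ : Type*} [DecidableEq κ] (s : Finset ι) (f : ι → κ) (g : κ → ℝ)
    (hg : ∀ k, 0 ≤ g k) : ∑ k ∈ s.image f, g k ≤ ∑ i ∈ s, g (f i) := by
  rw [← Finset.sum_fiberwise_of_maps_to (fun i hi => Finset.mem_image_of_mem f hi)]
  refine Finset.sum_le_sum fun k hk => ?_
  obtain ⟨i, hi, rfl⟩ := Finset.mem_image.1 hk
  exact Finset.single_le_sum (f := fun j => g (f j)) (fun j _ => hg _)
    (Finset.mem_filter.2 ⟨hi, rfl⟩)

/-- The expected total weight of the clusters attached to the outside of `A` is at least of order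
`|A|`. -/
lemma boundary_weight (hγ : ∀ x, γ x ∈ Set.Icc (0 : ℝ) 1) (hp : p ∈ Set.Icc (0 : ℝ) 1)
    (hd : ∀ x, (G.neighborFinset x).card ≤ d) (hA : thick G r A ⊆ Λ)
    (hstar : 2 * (A.card : ℝ) ≤ Ex (fun _ => p) (edgesIn G Λ)
        (fun T => ∑ K ∈ (thick G r A).image (cl Λ T), sw γ K)) :
    p ^ r * A.card ≤ (d + 1) ^ r * ∑ a ∈ A, ∑ x ∈ G.neighborFinset a \ A,
      Ex (fun _ => p) (edgesIn G Λ) (fun T => sw γ (cl Λ (off A T) x)) := by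
  set E := edgesIn G Λ with hE
  set W := thick G r A with hW
  set g : V → ℝ := fun x => Ex (fun _ => p) E (fun T => sw γ (cl Λ (off A T) x)) with hg
  have hg0 : ∀ x, 0 ≤ g x := fun x => Ex_nonneg (fun _ => hp) fun T _ => sw_nonneg hγ _
  have hpt : ∀ T ⊆ E, ∑ K ∈ W.image (cl Λ T), sw γ K ≤ A.card +
      ∑ y ∈ W \ A, sw γ (cl Λ (off A T) y) := by
    intro T hT
    have hT' : T ⊆ Λ.sym2 := hT.trans edgesIn_subset
    have h1 : ∀ K ∈ W.image (cl Λ T), sw γ K ≤ ∑ a ∈ A, ind (K = cl Λ T a) +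
        ind (∀ a ∈ A, a ∉ K) * sw γ K := by
      intro K hK
      by_cases h : ∀ a ∈ A, a ∉ K
      · rw [ind_of h, one_mul]
        have : 0 ≤ ∑ a ∈ A, ind (K = cl Λ T a) := Finset.sum_nonneg fun _ _ => ind_nonneg _
        linarith
      · rw [ind_of_not h]
        push Not at h
        obtain ⟨a, ha, haK⟩ := h
        obtain ⟨y, hy, rfl⟩ := Finset.mem_image.1 hK
        have h2 : ind (cl Λ T y = cl Λ T a) = 1 :=
          ind_of (cl_eq_of_reach (mem_cl.1 haK).2)
        have h3 := Finset.single_le_sum (f := fun a => ind (cl Λ T y = cl Λ T a))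
          (fun _ _ => ind_nonneg _) ha
        simp only [h2] at h3
        linarith [sw_le_one hγ (cl Λ T y)]
    refine (Finset.sum_le_sum h1).trans ?_
    rw [Finset.sum_add_distrib]
    refine add_le_add ?_ ?_
    · rw [Finset.sum_comm]
      calc _ ≤ ∑ a ∈ A, (1 : ℝ) := Finset.sum_le_sum fun a _ => by
            rw [sum_ind]
            have h2 := Finset.card_le_card (s := (W.image (cl Λ T)).filter (fun K => K = cl Λ T a))
              (t := {cl Λ T a}) fun K hK => Finset.mem_singleton.2 (Finset.mem_filter.1 hK).2
            rw [Finset.card_singleton] at h2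
            exact_mod_cast h2
        _ = _ := by simp
    · refine (sum_image_le W (cl Λ T) (fun K => ind (∀ a ∈ A, a ∉ K) * sw γ K)
        fun K => mul_nonneg (ind_nonneg _) (sw_nonneg hγ _)).trans ?_
      rw [← Finset.sum_sdiff (s₁ := A) (s₂ := W) subset_thick]
      have h4 : ∑ y ∈ A, ind (∀ a ∈ A, a ∉ cl Λ T y) * sw γ (cl Λ T y) = 0 :=
        Finset.sum_eq_zero fun y hy => by
          rw [ind_of_not, zero_mul]
          exact fun h => h y hy (mem_cl_self (hA (subset_thick hy)))
      rw [h4, add_zero]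
      refine Finset.sum_le_sum fun y hy => ?_
      by_cases h : ∀ a ∈ A, a ∉ cl Λ T y
      · rw [ind_of h, one_mul]
        refine sw_mono hγ fun z hz => ?_
        refine mem_cl.2 ⟨(mem_cl.1 hz).1, (mem_cl.1 hz).2.off_of_avoids fun a ha hr => ?_⟩
        exact h a ha (mem_cl.2 ⟨hA (subset_thick ha), hr⟩)
      · rw [ind_of_not h, zero_mul]
        exact sw_nonneg hγ _
  have hC : (A.card : ℝ) ≤ ∑ y ∈ W \ A, g y := by
    have := hstar.trans (Ex_mono (fun _ => hp) hpt)
    rw [Ex_add, Ex_const, Ex_sum] at this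
    linarith
  have hDy : ∀ y ∈ W \ A, p ^ r * g y ≤
      ∑ a ∈ A, ∑ x ∈ G.neighborFinset a \ A, ind (y ∈ thick G r {x}) * g x := by
    intro y hy
    obtain ⟨hyW, hyA⟩ := Finset.mem_sdiff.1 hy
    obtain ⟨a₀, ha₀, w, hw⟩ := mem_thick.1 hyW
    rcases exists_last_exit (A := A) w hyA with h | ⟨a, x, ha, hx, hax, w', h1, h2, h3⟩
    · exact absurd ha₀ (h _ w.start_mem_support)
    · have hwE : ∀ e ∈ w'.edges, e ∈ E := by
        have hs : ∀ z ∈ w'.support, z ∈ Λ := fun z hz => hA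
          (thick_mono (Finset.singleton_subset_iff.2 ha₀) (mem_thick_of_walk w hw (h3 z hz)))
        intro e he
        induction e using Sym2.ind with
        | _ b c =>
          exact mk_mem_edgesIn.2 ⟨hs _ (w'.fst_mem_support_of_mem_edges he),
            hs _ (w'.snd_mem_support_of_mem_edges he), w'.adj_of_mem_edges he⟩
      have h4 : p ^ w'.length * g y ≤ g x := Ex_off_walk hγ hp w' hwE h2
      have h5 : p ^ r * g y ≤ g x :=
        (mul_le_mul_of_nonneg_right (pow_le_pow_of_le_one hp.1 hp.2 (h1.trans hw))
          (hg0 y)).trans h4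
      refine h5.trans ?_
      have h6 : ind (y ∈ thick G r {x}) * g x = g x := by
        rw [ind_of (mem_thick.2 ⟨x, Finset.mem_singleton_self _, w', h1.trans hw⟩), one_mul]
      have h7 : ∀ _ x' : V, 0 ≤ ind (y ∈ thick G r {x'}) * g x' :=
        fun _ x' => mul_nonneg (ind_nonneg _) (hg0 x')
      have h8 := Finset.single_le_sum (f := fun x => ind (y ∈ thick G r {x}) * g x)
        (fun x' _ => h7 a x') (Finset.mem_sdiff.2 ⟨(G.mem_neighborFinset a x).2 hax, hx⟩)
      have h9 := Finset.single_le_sum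
        (f := fun a => ∑ x ∈ G.neighborFinset a \ A, ind (y ∈ thick G r {x}) * g x)
        (fun a' _ => Finset.sum_nonneg fun x' _ => h7 a' x') ha
      linarith
  calc p ^ r * (A.card : ℝ) ≤ p ^ r * ∑ y ∈ W \ A, g y :=
        mul_le_mul_of_nonneg_left hC (pow_nonneg hp.1 _)
    _ = ∑ y ∈ W \ A, p ^ r * g y := Finset.mul_sum _ _ _
    _ ≤ ∑ y ∈ W \ A, ∑ a ∈ A, ∑ x ∈ G.neighborFinset a \ A, ind (y ∈ thick G r {x}) * g x :=
        Finset.sum_le_sum hDy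
    _ = ∑ a ∈ A, ∑ x ∈ G.neighborFinset a \ A, (∑ y ∈ W \ A, ind (y ∈ thick G r {x})) * g x := by
        rw [Finset.sum_comm]
        refine Finset.sum_congr rfl fun a _ => ?_
        rw [Finset.sum_comm]
        exact Finset.sum_congr rfl fun x _ => (Finset.sum_mul _ _ _).symm
    _ ≤ ∑ a ∈ A, ∑ x ∈ G.neighborFinset a \ A, (d + 1) ^ r * g x := by
        refine Finset.sum_le_sum fun a _ => Finset.sum_le_sum fun x _ =>
          mul_le_mul_of_nonneg_right ?_ (hg0 x)
        have h1 : ∑ y ∈ W \ A, ind (y ∈ thick G r {x}) =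
            (((W \ A).filter (fun y => y ∈ thick G r {x})).card : ℝ) := sum_ind _ _
        rw [h1]
        have h2 : ((W \ A).filter (fun y => y ∈ thick G r {x})).card ≤ (d + 1) ^ r := by
          refine (Finset.card_le_card (t := thick G r {x}) fun y hy =>
            (Finset.mem_filter.1 hy).2).trans ?_
          simpa using card_thick_le (A := {x}) (r := r) hd
        exact_mod_cast h2
    _ = _ := by simp only [Finset.mul_sum]

/-- The differential inequality behind the comparison of the edge parameter and the ghost field. -/
lemma mul_Ex_card_le (hγ : ∀ x, γ x ∈ Set.Icc (0 : ℝ) 1) (hp : p ∈ Set.Icc (0 : ℝ) 1)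
    (hγF : ∀ x ∉ F, γ x = 0) (hF : thick G 1 F ⊆ Λ) (ho : o ∈ Λ) {c : ℝ}
    (hc : ∀ A ⊆ F, c * A.card ≤ ∑ a ∈ A, ∑ x ∈ G.neighborFinset a \ A,
      Ex (fun _ => p) (edgesIn G Λ) (fun T => sw γ (cl Λ (off A T) x))) :
    c * Ex (fun _ => p) (edgesIn G Λ) (fun T => (cl Λ T o).card * tw γ (cl Λ T o)) ≤
      ∑ e ∈ edgesIn G Λ, Ex (fun _ => p) (edgesIn G Λ)
        (fun T => tw γ (cl Λ (T.erase e) o) - tw γ (cl Λ (insert e T) o)) := by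
  set E := edgesIn G Λ with hE
  have ho' : ({o} : Finset V) ⊆ Λ := Finset.singleton_subset_iff.2 ho
  rw [← Ex_mul_left, ← Ex_sum, Ex_sum_clU _ E _ Λ {o},
    Ex_sum_clU _ E (fun T => ∑ e ∈ E, _) Λ {o}]
  refine Finset.sum_le_sum fun A _ => ?_
  have hnn : ∀ T : Finset (Sym2 V), ∀ e, 0 ≤ tw γ (cl Λ (T.erase e) o) - tw γ (cl Λ (insert e T) o) :=
    fun T e => sub_nonneg.2 (tw_anti hγ (cl_mono
      ((Finset.erase_subset _ _).trans (Finset.subset_insert _ _))))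
  by_cases hAF : A ⊆ F
  swap
  · obtain ⟨x, hx, hxF⟩ := Finset.not_subset.1 hAF
    have h0 : tw γ A = 0 := Finset.prod_eq_zero hx (hγF x hxF)
    have : Ex (fun _ => p) E (fun T => ind (clU Λ T {o} = A) *
        (c * ((cl Λ T o).card * tw γ (cl Λ T o)))) = 0 := by
      rw [← Ex_const (fun _ => p) E 0]
      refine Ex_congr fun T _ => ?_
      by_cases h : clU Λ T {o} = A
      · rw [cl, h, h0]; simp
      · rw [ind_of_not h, zero_mul]
    rw [this]
    exact Ex_nonneg (fun _ => hp) fun T _ => mul_nonneg (ind_nonneg _)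
      (Finset.sum_nonneg fun e _ => hnn T e)
  have hleft : Ex (fun _ => p) E (fun T => ind (clU Λ T {o} = A) *
        (c * ((cl Λ T o).card * tw γ (cl Λ T o)))) =
      (c * A.card) * tw γ A * Ex (fun _ => p) E (fun T => ind (clU Λ T {o} = A)) := by
    rw [← Ex_mul_left]
    refine Ex_congr fun T _ => ?_
    by_cases h : clU Λ T {o} = A
    · rw [cl, h]; ring
    · rw [ind_of_not h]; ring
  have hright : Ex (fun _ => p) E (fun T => ind (clU Λ T {o} = A) *
      (tw γ A * ∑ a ∈ A, ∑ x ∈ G.neighborFinset a \ A, sw γ (cl Λ (off A T) x))) ≤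
      Ex (fun _ => p) E (fun T => ind (clU Λ T {o} = A) *
        ∑ e ∈ E, (tw γ (cl Λ (T.erase e) o) - tw γ (cl Λ (insert e T) o))) := by
    refine Ex_mono (fun _ => hp) fun T hT => ind_mul_mono fun hA => ?_
    have hT' : T ⊆ Λ.sym2 := hT.trans edgesIn_subset
    have hA' : cl Λ T o = A := hA
    refine le_trans ?_ (sum_boundary_le (S := A) (Finset.Subset.trans (thick_mono hAF) hF)
      (fun e => hnn T e))
    rw [Finset.mul_sum]
    refine Finset.sum_le_sum fun a ha => ?_
    rw [Finset.mul_sum]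
    refine Finset.sum_le_sum fun x hx => ?_
    obtain ⟨hax, hxA⟩ := Finset.mem_sdiff.1 hx
    have heT : s(a, x) ∉ T := fun h => hxA (by
      rw [← hA]; exact clU_closed hT' a x h (by rwa [hA]))
    rw [Finset.erase_eq_of_notMem heT, hA']
    have hdisj : Disjoint A (cl Λ (off A T) x) := by
      rw [Finset.disjoint_right]
      intro z hz
      have hcl : ∀ a b, s(a, b) ∈ off A T → a ∈ A → b ∈ A := fun a b h ha =>
        absurd ha ((mem_off.1 h).2 a (Sym2.mem_mk_left _ _))
      exact (Reach.off_of_closed hcl hxA (mem_cl.1 hz).2).2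
    have hsub : A ∪ cl Λ (off A T) x ⊆ cl Λ (insert s(a, x) T) o := by
      have hoa : Reach T o a := (mem_cl.1 (hA' ▸ ha : a ∈ cl Λ T o)).2
      refine Finset.union_subset ?_ fun z hz => ?_
      · rw [← hA']; exact cl_mono (Finset.subset_insert _ _)
      · refine mem_cl.2 ⟨(mem_cl.1 hz).1, ?_⟩
        exact ((hoa.mono (Finset.subset_insert _ _)).trans
          (Reach.single (Finset.mem_insert_self _ _))).trans
          ((mem_cl.1 hz).2.mono (off_subset.trans (Finset.subset_insert _ _)))
    have h1 := tw_anti hγ hsub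
    have h2 : tw γ (A ∪ cl Λ (off A T) x) = tw γ A * tw γ (cl Λ (off A T) x) :=
      Finset.prod_union hdisj
    rw [h2] at h1
    unfold sw
    linarith
  rw [hleft]
  refine le_trans ?_ hright
  have hind : Ex (fun _ => p) E (fun T => ind (clU Λ T {o} = A) *
      (tw γ A * ∑ a ∈ A, ∑ x ∈ G.neighborFinset a \ A, sw γ (cl Λ (off A T) x))) =
      tw γ A * (Ex (fun _ => p) E (fun T => ind (clU Λ T {o} = A)) *
      ∑ a ∈ A, ∑ x ∈ G.neighborFinset a \ A,
        Ex (fun _ => p) E (fun T => sw γ (cl Λ (off A T) x))) := by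
    have h1 := Ex_clU_indep (q := fun _ => p) (E := E) (Λ := Λ) edgesIn_subset ho' A
      (fun T => tw γ A * ∑ a ∈ A, ∑ x ∈ G.neighborFinset a \ A, sw γ (cl Λ T x))
    rw [h1, Ex_mul_left, Ex_sum]
    simp only [Ex_sum]
    ring
  rw [hind]
  have h1 : 0 ≤ Ex (fun _ => p) E (fun T => ind (clU Λ T {o} = A)) :=
    Ex_nonneg (fun _ => hp) fun T _ => ind_nonneg _
  have h2 := mul_le_mul_of_nonneg_left (hc A hAF) (mul_nonneg (tw_nonneg hγ A) h1)
  linarith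

end Boundary

section Ghost
open Classical

variable {V : Type*} [DecidableEq V] {G : SimpleGraph V} [G.LocallyFinite]
variable {Λ A W F : Finset V} {T E : Finset (Sym2 V)} {x y z v o : V} {r d : ℕ} {γ : V → ℝ} {p : ℝ}

/-- The factor attached to each vertex: `exp (-β)` inside `F` and `0` outside. -/
noncomputable def ghost (F : Finset V) (β : ℝ) (x : V) : ℝ := if x ∈ F then Real.exp (-β) else 0

lemma ghost_mem {β : ℝ} (hβ : 0 ≤ β) (x : V) : ghost F β x ∈ Set.Icc (0 : ℝ) 1 := by
  unfold ghost
  split_ifs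
  · exact ⟨(Real.exp_pos _).le, Real.exp_le_one_iff.2 (by linarith)⟩
  · simp

lemma ghost_of_notMem {β : ℝ} (hx : x ∉ F) : ghost F β x = 0 := if_neg hx

lemma tw_ghost {β : ℝ} (K : Finset V) :
    tw (ghost F β) K = ind (K ⊆ F) * Real.exp (-(β * K.card)) := by
  by_cases h : K ⊆ F
  · have h1 : tw (ghost F β) K = ∏ x ∈ K, Real.exp (-β) :=
      Finset.prod_congr rfl fun x hx => if_pos (h hx)
    rw [ind_of h, one_mul, h1, Finset.prod_const, ← Real.exp_nat_mul]
    congr 1; ring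
  · obtain ⟨x, hx, hxF⟩ := Finset.not_subset.1 h
    rw [ind_of_not h, zero_mul]
    exact Finset.prod_eq_zero hx (ghost_of_notMem hxF)

lemma sw_ghost_zero (K : Finset V) : sw (ghost F 0) K = ind (¬ K ⊆ F) := by
  rw [sw, tw_ghost, ind_not]; simp

/-- Continuation along a curve on which every function decreases as long as all of them stay below
a slightly larger threshold. -/
lemma le_of_deriv_bootstrap {ι : Type*} (s : Finset ι) {f f' : ι → ℝ → ℝ} {a b c c' : ℝ}
    (hab : a ≤ b) (hcc : c < c') (hf : ∀ i t, HasDerivAt (f i) (f' i t) t)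
    (h0 : ∀ i ∈ s, f i a ≤ c)
    (hd : ∀ t ∈ Set.Icc a b, (∀ i ∈ s, f i t ≤ c') → ∀ i ∈ s, f' i t ≤ 0) :
    ∀ i ∈ s, f i b ≤ c := by
  have hcont : ∀ i, Continuous (f i) := fun i =>
    continuous_iff_continuousAt.2 fun t => (hf i t).continuousAt
  set S : Set ℝ := {t | ∀ i ∈ s, f i t ≤ c} with hS
  have hcl : IsClosed S := by
    have : S = ⋂ i ∈ s, {t | f i t ≤ c} := by ext t; simp [hS]
    rw [this]
    exact isClosed_biInter fun i _ => isClosed_le (hcont i) continuous_const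
  refine (hcl.inter isClosed_Icc).Icc_subset_of_forall_mem_nhdsWithin h0 ?_ ⟨hab, le_rfl⟩
  rintro x ⟨hxS, hxa, hxb⟩
  have hev : ∀ᶠ t in nhds x, ∀ i ∈ s, f i t < c' := by
    rw [Filter.eventually_all_finset]
    intro i hi
    exact (hcont i).continuousAt.eventually_lt continuousAt_const ((hxS i hi).trans_lt hcc)
  obtain ⟨e, he, hball⟩ := Metric.eventually_nhds_iff.1 hev
  have hmem : Set.Ioo x (min (x + e) b) ∈ nhdsWithin x (Set.Ioi x) :=
    Ioo_mem_nhdsGT (lt_min (by linarith) hxb)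
  refine Filter.mem_of_superset hmem fun t ht i hi => ?_
  have hanti : AntitoneOn (f i) (Set.Icc x t) := by
    refine antitoneOn_of_deriv_nonpos (convex_Icc x t) (hcont i).continuousOn
      (fun u _ => (hf i u).differentiableAt.differentiableWithinAt) fun u hu => ?_
    rw [interior_Icc] at hu
    rw [(hf i u).deriv]
    have h1 := ht.2.trans_le (min_le_left _ _)
    have h2 := ht.2.trans_le (min_le_right _ _)
    refine hd u ⟨by linarith [hu.1], by linarith [hu.2]⟩ (fun j hj => (hball ?_ j hj).le) i hi
    rw [Real.dist_eq, abs_lt]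
    constructor <;> linarith [hu.1, hu.2]
  exact (hanti ⟨le_rfl, ht.1.le⟩ ⟨ht.1.le, le_rfl⟩ ht.1.le).trans (hxS i hi)

/-- Trading the ghost field for a small increase of the edge parameter. -/
lemma ghost_removal {p₁ p₂ β c θ : ℝ} (hp₁ : 0 ≤ p₁) (hp₂ : p₂ ≤ 1) (h12 : p₁ ≤ p₂)
    (hβ : β = c * (p₂ - p₁)) (hc0 : 0 ≤ c) (hθ : 0 < θ) (hF : thick G 1 F ⊆ Λ)
    (h0 : ∀ y ∈ Λ, θ ≤ Ex (fun _ => p₁) (edgesIn G Λ) (fun T => sw (ghost F β) (cl Λ T y)))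
    (hc : ∀ q ∈ Set.Icc p₁ p₂, ∀ b, 0 ≤ b →
      (∀ y ∈ Λ, θ / 2 ≤ Ex (fun _ => q) (edgesIn G Λ) (fun T => sw (ghost F b) (cl Λ T y))) →
      ∀ A ⊆ F, c * A.card ≤ ∑ a ∈ A, ∑ x ∈ G.neighborFinset a \ A,
      Ex (fun _ => q) (edgesIn G Λ) (fun T => sw (ghost F b) (cl Λ (off A T) x))) :
    ∀ y ∈ Λ, θ ≤ Ex (fun _ => p₂) (edgesIn G Λ) (fun T => ind (¬ cl Λ T y ⊆ F)) := by
  set E := edgesIn G Λ with hE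
  set b : ℝ → ℝ := fun q => c * (p₂ - q) with hb
  have hbd : ∀ q, HasDerivAt b (-c) q := fun q => by
    have := ((hasDerivAt_id q).const_sub p₂).const_mul c
    simpa [hb] using this
  set Fn : V → ℝ → Finset (Sym2 V) → ℝ := fun y q T => tw (ghost F (b q)) (cl Λ T y) with hFn
  set Fd : V → ℝ → Finset (Sym2 V) → ℝ := fun y q T =>
    c * ((cl Λ T y).card * tw (ghost F (b q)) (cl Λ T y)) with hFd
  have hder : ∀ y q T, HasDerivAt (fun q => Fn y q T) (Fd y q T) q := by
    intro y q T
    simp only [hFn, hFd, tw_ghost]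
    have h1 := (((hbd q).mul_const ((cl Λ T y).card : ℝ)).neg.exp).const_mul
      (ind (cl Λ T y ⊆ F))
    refine h1.congr_deriv ?_
    simp only [Pi.neg_apply]
    ring
  have hN := fun y q => Ex_hasDerivAt (fun T => hder y q T) E
  have hsub : ∀ (q : ℝ) y, Ex (fun _ => q) E (fun T => sw (ghost F (b q)) (cl Λ T y)) =
      1 - Ex (fun _ => q) E (Fn y q) := fun q y => by
    simp only [sw, hFn, Ex_sub, Ex_const]
  have hb1 : b p₁ = β := hβ.symm
  have hb2 : b p₂ = 0 := by simp [hb]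
  have key := le_of_deriv_bootstrap Λ (c := 1 - θ) (c' := 1 - θ / 2) h12 (by linarith) hN
    (fun y hy => by
      have h1 := h0 y hy
      rw [← hb1, hsub] at h1
      linarith)
    (fun q hq hall y hy => by
      have hq' : q ∈ Set.Icc (0 : ℝ) 1 := ⟨hp₁.trans hq.1, hq.2.trans hp₂⟩
      have hbq : 0 ≤ b q := mul_nonneg hc0 (sub_nonneg.2 hq.2)
      have h1 := hc q hq (b q) hbq fun y hy => by
        rw [hsub]; linarith [hall y hy]
      have h2 := mul_Ex_card_le (ghost_mem hbq) hq' (fun x hx => ghost_of_notMem hx) hF hy h1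
      have h3 : Ex (fun _ => q) E (Fd y q) = c * Ex (fun _ => q) E (fun T =>
        ((cl Λ T y).card * tw (ghost F (b q)) (cl Λ T y))) := Ex_mul_left _ _ _ _
      have h4 : ∑ e ∈ E, Ex (fun _ => q) E (fun T => Fn y q (insert e T) - Fn y q (T.erase e)) =
          -∑ e ∈ E, Ex (fun _ => q) E (fun T => Fn y q (T.erase e) - Fn y q (insert e T)) := by
        rw [← Finset.sum_neg_distrib]
        refine Finset.sum_congr rfl fun e _ => ?_
        rw [Ex_sub, Ex_sub]; ring
      rw [h3, h4]
      linarith)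
  intro y hy
  have h1 := key y hy
  have h2 := hsub p₂ y
  rw [hb2] at h2
  simp only [sw_ghost_zero] at h2
  rw [h2]
  linarith

/-- The boundary estimate needed to remove the ghost field, from lower bounds on cluster weights
and an upper bound on some nearby connection probability. -/
lemma boundary_estimate {p₁ p₃ h θ a N : ℝ} {r₀ : ℕ} (hγ : ∀ x, γ x ∈ Set.Icc (0 : ℝ) 1)
    (hp₁ : 0 ≤ p₁) (hp₃ : p₃ ≤ 1) (hp : p ∈ Set.Icc p₁ p₃)
    (hd : ∀ x, (G.neighborFinset x).card ≤ d) (h0 : 0 ≤ h)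
    (hexp : ∀ A : Finset V, (1 + h) * A.card ≤ ((thick G 1 A).card : ℝ))
    (hA : thick G (r₀ + r) A ⊆ Λ) (hθ0 : 0 ≤ θ)
    (hθ : ∀ y ∈ Λ, θ ≤ Ex (fun _ => p) (edgesIn G Λ) fun T => sw γ (cl Λ T y))
    (hζ : ∀ x, ∃ y, inBall G x r₀ y ∧
      Ex (fun _ => p) (edgesIn G Λ) (fun T => ind (Reach T x y)) ≤ θ ^ 2 / 2)
    (ha : 0 ≤ a) (ha2 : a ≤ 2) (hN : 0 < N)
    (hsmall : 2 * (((d : ℝ) + 1) ^ r₀) ^ 2 * (d * (a + Real.exp (-(a ^ 2 * N / 4)))) ≤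
      p₁ * (1 - p₃) * p₁ ^ r₀ * (θ ^ 2 / 2) / 2)
    (hlarge : 2 * (2 * (((d : ℝ) + 1) ^ r₀) ^ 2 * N) ≤
      p₁ * (1 - p₃) * p₁ ^ r₀ * (θ ^ 2 / 2) / 2 * (1 + h) ^ (r₀ + r)) :
    (p₁ / (d + 1)) ^ (r₀ + r) * A.card ≤ ∑ a ∈ A, ∑ x ∈ G.neighborFinset a \ A,
      Ex (fun _ => p) (edgesIn G Λ) (fun T => sw γ (cl Λ (off A T) x)) := by
  set E := edgesIn G Λ with hE
  have hp01 : p ∈ Set.Icc (0 : ℝ) 1 := ⟨hp₁.trans hp.1, hp.2.trans hp₃⟩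
  set S := Ex (fun _ => p) E (fun T => ∑ K ∈ (thick G (r₀ + r) A).image (cl Λ T), sw γ K) with hS
  have hS0 : 0 ≤ S := Ex_nonneg (fun _ => hp01) fun T _ =>
    Finset.sum_nonneg fun K _ => sw_nonneg hγ K
  set m : ℝ := ((thick G (r₀ + r) A).card : ℝ) with hm
  have hm0 : 0 ≤ m := Nat.cast_nonneg _
  set κ := p₁ * (1 - p₃) * p₁ ^ r₀ * (θ ^ 2 / 2) with hκ
  set D : ℝ := (((d : ℝ) + 1) ^ r₀) ^ 2 with hD
  have hD0 : 0 < D := by positivity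
  have h1 := heavy_clusters (W := thick G r A) hγ hp01 hd (by rwa [thick_thick]) hθ0 hθ
    (fun x _ => hζ x) (by nlinarith [sq_nonneg θ]) ha ha2 hN.le
  rw [thick_thick] at h1
  have h2 : κ ≤ p * (1 - p) * p ^ r₀ * (θ ^ 2 - θ ^ 2 / 2) := by
    have : θ ^ 2 - θ ^ 2 / 2 = θ ^ 2 / 2 := by ring
    rw [this, hκ]
    have := hp.1
    have := hp.2
    have := hp01.1
    have h3 : (0 : ℝ) ≤ 1 - p₃ := by linarith
    have h4 : (1 : ℝ) - p₃ ≤ 1 - p := by linarith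
    have h5 : (0 : ℝ) ≤ p * (1 - p) := mul_nonneg hp01.1 (sub_nonneg.2 hp01.2)
    gcongr
  have h3 : κ * m ≤ 2 * D * (N * S + d * (a + Real.exp (-(a ^ 2 * N / 4))) * m) :=
    (mul_le_mul_of_nonneg_right h2 hm0).trans h1
  have h4 : κ / 2 * m ≤ 2 * D * N * S := by
    have := mul_le_mul_of_nonneg_right hsmall hm0
    nlinarith
  have h5 : (1 + h) ^ (r₀ + r) * A.card ≤ m := le_card_thick h0 hexp
  have hκ0 : 0 ≤ κ := by
    have : (0 : ℝ) ≤ 1 - p₃ := by linarith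
    positivity
  have h6 : 2 * (A.card : ℝ) ≤ S := by
    have h7 : 2 * (2 * D * N) * A.card ≤ 2 * D * N * S := by
      calc 2 * (2 * D * N) * A.card ≤ κ / 2 * (1 + h) ^ (r₀ + r) * A.card :=
            mul_le_mul_of_nonneg_right hlarge (Nat.cast_nonneg _)
        _ = κ / 2 * ((1 + h) ^ (r₀ + r) * A.card) := by ring
        _ ≤ κ / 2 * m := mul_le_mul_of_nonneg_left h5 (by linarith)
        _ ≤ _ := h4
    have h8 : 0 < 2 * D * N := by positivity
    refine le_of_mul_le_mul_left (a := 2 * D * N) ?_ h8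
    linarith
  have h7 := boundary_weight hγ hp01 hd hA h6
  have hd1 : (0 : ℝ) < (d + 1) ^ (r₀ + r) := by positivity
  rw [div_pow, div_mul_eq_mul_div, div_le_iff₀ hd1, mul_comm _ (((d : ℝ) + 1) ^ (r₀ + r))]
  refine le_trans ?_ h7
  exact mul_le_mul_of_nonneg_right (pow_le_pow_left₀ hp₁ hp.1 _) (Nat.cast_nonneg _)

/-- Choice of the auxiliary constants in `boundary_estimate`. -/
lemma exists_constants (d r₀ : ℕ) {κ h : ℝ} (hκ : 0 < κ) (hh : 0 < h) :
    ∃ a N : ℝ, ∃ r : ℕ, 0 ≤ a ∧ a ≤ 2 ∧ 0 < N ∧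
      2 * (((d : ℝ) + 1) ^ r₀) ^ 2 * (d * (a + Real.exp (-(a ^ 2 * N / 4)))) ≤ κ / 2 ∧
      2 * (2 * (((d : ℝ) + 1) ^ r₀) ^ 2 * N) ≤ κ / 2 * (1 + h) ^ (r₀ + r) := by
  set D : ℝ := (((d : ℝ) + 1) ^ r₀) ^ 2 with hD
  have hD0 : 0 < D := by positivity
  set b : ℝ := κ / (8 * D * (d + 1)) with hb
  have hb0 : 0 < b := by positivity
  set a := min b 2 with ha
  have ha0 : 0 < a := lt_min hb0 two_pos
  obtain ⟨N, hN0, hN⟩ : ∃ N : ℝ, 0 < N ∧ Real.exp (-(a ^ 2 * N / 4)) ≤ b := by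
    have h1 : Tendsto (fun N : ℝ => Real.exp (-(a ^ 2 / 4 * N))) atTop (nhds 0) :=
      Real.tendsto_exp_neg_atTop_nhds_zero.comp
        (tendsto_id.const_mul_atTop (by positivity : 0 < a ^ 2 / 4))
    obtain ⟨N, hN, hN'⟩ := ((h1.eventually (gt_mem_nhds hb0)).and (eventually_gt_atTop 0)).exists
    refine ⟨N, hN', ?_⟩
    have : a ^ 2 * N / 4 = a ^ 2 / 4 * N := by ring
    rw [this]; exact hN.le
  obtain ⟨r, hr⟩ := pow_unbounded_of_one_lt (2 * (2 * D * N) / (κ / 2)) (by linarith : 1 < 1 + h)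
  refine ⟨a, N, r, ha0.le, min_le_right _ _, hN0, ?_, ?_⟩
  · have h1 : a + Real.exp (-(a ^ 2 * N / 4)) ≤ 2 * b := by linarith [min_le_left b 2]
    have hd : (0 : ℝ) ≤ d := Nat.cast_nonneg _
    calc 2 * D * (d * (a + Real.exp (-(a ^ 2 * N / 4)))) ≤ 2 * D * ((d + 1) * (2 * b)) := by
          gcongr
          linarith
      _ = κ / 2 := by rw [hb]; field_simp; ring
  · rw [div_lt_iff₀ (by positivity)] at hr
    have h1 : (1 + h) ^ r ≤ (1 + h) ^ (r₀ + r) :=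
      pow_le_pow_right₀ (by linarith) (by omega)
    nlinarith

end Ghost

section Transport
open Classical

lemma Reach.of_image {U V : Type*} [DecidableEq V] {ψ : U → V} (hψ : Function.Injective ψ)
    {T : Finset (Sym2 U)} {a : U} {y : V} (h : Reach (T.image (Sym2.map ψ)) (ψ a) y) :
    ∃ b, y = ψ b ∧ Reach T a b := by
  induction h with
  | refl => exact ⟨a, rfl, Reach.refl _ _⟩
  | tail _ hbc ih =>
    obtain ⟨b, rfl, hb⟩ := ih
    obtain ⟨e, he, heq⟩ := Finset.mem_image.1 hbc
    induction e using Sym2.ind with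
    | _ x z =>
      rw [Sym2.map_mk] at heq
      rcases Sym2.eq_iff.1 heq with ⟨h1, rfl⟩ | ⟨rfl, h1⟩
      · rw [hψ h1] at he
        exact ⟨z, rfl, hb.trans (Reach.single he)⟩
      · rw [hψ h1, Sym2.eq_swap] at he
        exact ⟨x, rfl, hb.trans (Reach.single he)⟩

lemma reach_image_iff {U V : Type*} [DecidableEq V] {ψ : U → V} (hψ : Function.Injective ψ)
    {T : Finset (Sym2 U)} {a b : U} :
    Reach (T.image (Sym2.map ψ)) (ψ a) (ψ b) ↔ Reach T a b := by
  constructor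
  · intro h
    obtain ⟨b', h1, h2⟩ := h.of_image hψ
    rwa [hψ h1]
  · intro h
    induction h with
    | refl => exact Reach.refl _ _
    | tail _ hbc ih =>
      exact ih.trans (Reach.single (by
        rw [← Sym2.map_mk]; exact Finset.mem_image_of_mem _ hbc))

variable {V : Type*} [DecidableEq V] {G : SimpleGraph V} [G.LocallyFinite]

lemma edgesIn_image (ψ : G ≃g G) (S : Finset V) :
    edgesIn G (S.image ψ) = (edgesIn G S).image (Sym2.map ψ) := by
  ext e
  constructor
  · induction e using Sym2.ind with
    | _ x y =>
      intro h
      obtain ⟨hx, hy, hxy⟩ := mk_mem_edgesIn.1 h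
      obtain ⟨a, ha, rfl⟩ := Finset.mem_image.1 hx
      obtain ⟨b, hb, rfl⟩ := Finset.mem_image.1 hy
      exact Finset.mem_image.2 ⟨s(a, b), mk_mem_edgesIn.2 ⟨ha, hb, ψ.map_adj_iff.1 hxy⟩,
        Sym2.map_mk _ _ _⟩
  · intro h
    obtain ⟨e', he', rfl⟩ := Finset.mem_image.1 h
    induction e' using Sym2.ind with
    | _ x y =>
      obtain ⟨hx, hy, hxy⟩ := mk_mem_edgesIn.1 he'
      exact mk_mem_edgesIn.2 ⟨Finset.mem_image_of_mem _ hx, Finset.mem_image_of_mem _ hy,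
        ψ.map_adj_iff.2 hxy⟩

lemma Ex_reach_image (ψ : G ≃g G) (S : Finset V) (p : ℝ) (a b : V) :
    Ex (fun _ => p) (edgesIn G (S.image ψ)) (fun T => ind (Reach T (ψ a) (ψ b))) =
      Ex (fun _ => p) (edgesIn G S) (fun T => ind (Reach T a b)) := by
  rw [edgesIn_image, Ex_image _ _ (Sym2.map.injective ψ.injective).injOn]
  exact Ex_congr fun T _ => ind_congr (reach_image_iff ψ.injective)

lemma inBall_image (ψ : G ≃g G) {x y : V} {r : ℕ} (h : inBall G x r y) :
    inBall G (ψ x) r (ψ y) := by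
  obtain ⟨w, hw⟩ := h
  exact ⟨w.map ψ.toHom, by simpa using hw⟩

/-- The expected number of open edges leaving `S` that are joined to `o` inside `S`. -/
noncomputable def phi (G : SimpleGraph V) [G.LocallyFinite] (p : ℝ) (S : Finset V) (o : V) : ℝ :=
  ∑ x ∈ S, ∑ _y ∈ G.neighborFinset x \ S,
    p * Ex (fun _ => p) (edgesIn G S) (fun T => ind (Reach T o x))

lemma phi_image (ψ : G ≃g G) (p : ℝ) (S : Finset V) (o : V) :
    phi G p (S.image ψ) (ψ o) = phi G p S o := by
  unfold phi
  rw [Finset.sum_image fun a _ b _ h => ψ.injective h]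
  refine Finset.sum_congr rfl fun x _ => ?_
  rw [Ex_reach_image, Finset.sum_const, Finset.sum_const]
  congr 1
  rw [← Finset.card_image_of_injective (G.neighborFinset x \ S) ψ.injective]
  congr 1
  ext y
  simp only [Finset.mem_sdiff, SimpleGraph.mem_neighborFinset, Finset.mem_image]
  constructor
  · rintro ⟨h1, h2⟩
    refine ⟨ψ.symm y, ⟨?_, fun h => h2 ⟨_, h, ψ.apply_symm_apply y⟩⟩, ψ.apply_symm_apply y⟩
    rw [← ψ.map_adj_iff, ψ.apply_symm_apply]
    exact h1
  · rintro ⟨z, ⟨h1, h2⟩, rfl⟩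
    refine ⟨ψ.map_adj_iff.2 h1, ?_⟩
    rintro ⟨z', hz', h⟩
    exact h2 (ψ.injective h ▸ hz')

end Transport

section Subcritical
open Classical

variable {V : Type*} [DecidableEq V] {G : SimpleGraph V} [G.LocallyFinite]
variable {Λ A B S : Finset V} {T E : Finset (Sym2 V)} {x y z v w o : V} {r d : ℕ} {p : ℝ}

/-- The cluster of `w` inside `S`. -/
noncomputable def inner (G : SimpleGraph V) (S : Finset V) (w : V) (T : Finset (Sym2 V)) :
    Finset V := cl S (T ∩ edgesIn G S) w

lemma inner_subset : inner G S w T ⊆ S := cl_subset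

lemma mem_inner : x ∈ inner G S w T ↔ x ∈ S ∧ Reach (T ∩ edgesIn G S) w x := mem_cl

lemma inner_insert_iff (hw : w ∈ S) {e : Sym2 V} (he : ∀ x ∈ e, x ∉ A) :
    inner G S w (insert e T) = A ↔ inner G S w T = A := by
  unfold inner
  by_cases heS : e ∈ edgesIn G S
  · rw [Finset.insert_inter_of_mem heS]
    exact clU_eq_iff_insert (Finset.singleton_subset_iff.2 hw)
      (Finset.inter_subset_right.trans edgesIn_subset) (edgesIn_subset heS) he
  · rw [Finset.insert_inter_of_notMem heS]

lemma card_cl_le (hw : w ∈ S) (hT : T ⊆ edgesIn G Λ) :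
    ((cl Λ T w).card : ℝ) ≤ S.card + ∑ x ∈ S, ∑ y ∈ G.neighborFinset x \ S,
      ind (x ∈ inner G S w T) *
        (ind (s(x, y) ∈ T) * ((cl Λ (off (inner G S w T) T) y).card : ℝ)) := by
  set C := inner G S w T with hC
  set Q : V → V → Finset V := fun x y =>
    if x ∈ C ∧ s(x, y) ∈ T then cl Λ (off C T) y else ∅ with hQ
  have hsub : cl Λ T w ⊆ S ∪ S.biUnion fun x => (G.neighborFinset x \ S).biUnion fun y => Q x y := by
    intro z hz
    obtain ⟨hzΛ, hr⟩ := mem_cl.1 hz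
    by_cases hzS : z ∈ S
    · exact Finset.mem_union_left _ hzS
    refine Finset.mem_union_right _ ?_
    have hzC : z ∉ C := fun h => hzS (inner_subset h)
    rcases hr.last_exit hzC with ⟨_, h⟩ | ⟨a, b, ha, hb, _, hab, hbz⟩
    · exact absurd (mem_inner.2 ⟨hw, Reach.refl _ _⟩) h
    · have haS : a ∈ S := inner_subset ha
      have hadj := (mk_mem_edgesIn.1 (hT hab)).2.2
      have hbS : b ∉ S := fun h => hb (mem_inner.2 ⟨h, (mem_inner.1 ha).2.trans
        (Reach.single (Finset.mem_inter.2 ⟨hab, mk_mem_edgesIn.2 ⟨haS, h, hadj⟩⟩))⟩)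
      refine Finset.mem_biUnion.2 ⟨a, haS, Finset.mem_biUnion.2 ⟨b, Finset.mem_sdiff.2
        ⟨(G.mem_neighborFinset a b).2 hadj, hbS⟩, ?_⟩⟩
      simp only [hQ]
      rw [if_pos ⟨ha, hab⟩]
      exact mem_cl.2 ⟨hzΛ, hbz⟩
  have h1 : (cl Λ T w).card ≤ S.card + ∑ x ∈ S, ∑ y ∈ G.neighborFinset x \ S, (Q x y).card :=
    (Finset.card_le_card hsub).trans ((Finset.card_union_le _ _).trans (Nat.add_le_add_left
      (Finset.card_biUnion_le.trans (Finset.sum_le_sum fun x _ => Finset.card_biUnion_le)) _))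
  have h2 : ((cl Λ T w).card : ℝ) ≤
      S.card + ∑ x ∈ S, ∑ y ∈ G.neighborFinset x \ S, ((Q x y).card : ℝ) := by exact_mod_cast h1
  refine h2.trans (le_of_eq ?_)
  congr 1
  refine Finset.sum_congr rfl fun x _ => Finset.sum_congr rfl fun y _ => ?_
  simp only [hQ]
  by_cases hx : x ∈ C <;> by_cases hxy : s(x, y) ∈ T <;> simp [ind, hx, hxy]

lemma Ex_ind_mem_le (hp : p ∈ Set.Icc (0 : ℝ) 1) (e : Sym2 V) {f : Finset (Sym2 V) → ℝ}
    (hf : ∀ T, 0 ≤ f T) (hfe : ∀ T, f (insert e T) = f T) :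
    Ex (fun _ => p) E (fun T => f T * ind (e ∈ T)) ≤ p * Ex (fun _ => p) E f := by
  by_cases he : e ∈ E
  · rw [Ex_split he]
    have h1 : Ex (fun _ => p) E (fun T => f (T.erase e) * ind (e ∈ T.erase e)) = 0 := by
      rw [← Ex_const (fun _ => p) E 0]
      exact Ex_congr fun T _ => by rw [ind_of_not (Finset.notMem_erase e T), mul_zero]
    have h2 : Ex (fun _ => p) E (fun T => f (insert e T) * ind (e ∈ insert e T)) =
        Ex (fun _ => p) E f :=
      Ex_congr fun T _ => by rw [ind_of (Finset.mem_insert_self e T), mul_one, hfe]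
    rw [h1, h2]
    simp
  · have h1 : Ex (fun _ => p) E (fun T => f T * ind (e ∈ T)) = 0 := by
      rw [← Ex_const (fun _ => p) E 0]
      exact Ex_congr fun T hT => by rw [ind_of_not fun h => he (hT h), mul_zero]
    rw [h1]
    exact mul_nonneg hp.1 (Ex_nonneg (fun _ => hp) fun T _ => hf T)

lemma Ex_exit_le (hp : p ∈ Set.Icc (0 : ℝ) 1) (hw : w ∈ S) (hy : y ∉ S)
    {N : Finset (Sym2 V) → ℝ} (hN : ∀ T, 0 ≤ N T) {M : ℝ}
    (hM : ∀ A, Ex (fun _ => p) E (fun T => N (off A T)) ≤ M) :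
    Ex (fun _ => p) E (fun T => ind (x ∈ inner G S w T) *
        (ind (s(x, y) ∈ T) * N (off (inner G S w T) T))) ≤
      p * M * Ex (fun _ => p) E (fun T => ind (x ∈ inner G S w T)) := by
  have hdec : ∀ f : Finset (Sym2 V) → ℝ, Ex (fun _ => p) E f =
      ∑ A ∈ S.powerset, Ex (fun _ => p) E (fun T => ind (inner G S w T = A) * f T) := by
    intro f
    rw [← Ex_sum]
    refine Ex_congr fun T _ => ?_
    rw [← Finset.sum_mul, Finset.sum_eq_single_of_mem (inner G S w T)
      (Finset.mem_powerset.2 inner_subset) fun A _ h => ind_of_not (Ne.symm h), ind_of rfl, one_mul]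
  rw [hdec, hdec (fun T => ind (x ∈ inner G S w T)), Finset.mul_sum]
  refine Finset.sum_le_sum fun A _ => ?_
  by_cases hxA : x ∈ A
  swap
  · have h0 : ∀ c : Finset (Sym2 V) → ℝ, Ex (fun _ => p) E (fun T => ind (inner G S w T = A) *
        (ind (x ∈ inner G S w T) * c T)) = 0 := fun c => by
      rw [← Ex_const (fun _ => p) E 0]
      refine Ex_congr fun T _ => ?_
      by_cases h : inner G S w T = A
      · rw [h, ind_of_not hxA]; ring
      · rw [ind_of_not h, zero_mul]
    have h1 := h0 fun _ => 1
    simp only [mul_one] at h1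
    rw [h0, h1, mul_zero]
  have h1 : Ex (fun _ => p) E (fun T => ind (inner G S w T = A) * (ind (x ∈ inner G S w T) *
        (ind (s(x, y) ∈ T) * N (off (inner G S w T) T)))) =
      Ex (fun _ => p) E (fun T => (ind (inner G S w T = A) * ind (s(x, y) ∈ T)) * N (off A T)) :=
    Ex_congr fun T _ => by
      rw [mul_assoc]
      exact ind_mul_congr fun h => by rw [h, ind_of hxA, one_mul]
  have h2 : Ex (fun _ => p) E (fun T => ind (inner G S w T = A) * ind (x ∈ inner G S w T)) =
      Ex (fun _ => p) E (fun T => ind (inner G S w T = A)) :=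
    Ex_congr fun T _ => by
      rw [ind_mul_congr (b := 1) fun h => by rw [h, ind_of hxA], mul_one]
  rw [h1, h2, Ex_indep]
  · have h3 := Ex_ind_mem_le (E := E) hp s(x, y) (f := fun T => ind (inner G S w T = A))
      (fun _ => ind_nonneg _) fun T => ind_congr (by
        unfold inner
        rw [Finset.insert_inter_of_notMem fun h => hy (mk_mem_edgesIn.1 h).2.1])
    have h4 : 0 ≤ Ex (fun _ => p) E (fun T => N (off A T)) :=
      Ex_nonneg (fun _ => hp) fun T _ => hN _
    have h5 : 0 ≤ Ex (fun _ => p) E (fun T => ind (inner G S w T = A)) :=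
      Ex_nonneg (fun _ => hp) fun T _ => ind_nonneg _
    calc _ ≤ p * Ex (fun _ => p) E (fun T => ind (inner G S w T = A)) * M :=
          mul_le_mul h3 (hM A) h4 (mul_nonneg hp.1 h5)
      _ = _ := by ring
  · intro e _
    by_cases he : ∃ z ∈ e, z ∈ A
    · exact Or.inr fun T _ _ => by rw [off_insert he]
    · push Not at he
      refine Or.inl fun T _ _ => ?_
      have hne : s(x, y) ≠ e := fun h => he x (h ▸ Sym2.mem_mk_left x y) hxA
      rw [ind_congr (inner_insert_iff hw he), ind_congr
        (show s(x, y) ∈ insert e T ↔ s(x, y) ∈ T by simp [hne])]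

lemma Ex_inner_le (hp : p ∈ Set.Icc (0 : ℝ) 1) :
    Ex (fun _ => p) E (fun T => ind (x ∈ inner G S w T)) ≤
      Ex (fun _ => p) (edgesIn G S) (fun T => ind (Reach T w x)) := by
  calc _ ≤ Ex (fun _ => p) E (fun T => ind (Reach (T ∩ edgesIn G S) w x)) :=
        Ex_mono (fun _ => hp) fun T _ => ind_mono fun h => (mem_inner.1 h).2
    _ ≤ Ex (fun _ => p) (E ∪ edgesIn G S) (fun T => ind (Reach (T ∩ edgesIn G S) w x)) :=
        Ex_mono_set (fun _ => hp) Finset.subset_union_left fun T T' h =>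
          ind_mono fun h' => h'.mono (Finset.inter_subset_inter_right h)
    _ = _ := Ex_inter (f := fun T => ind (Reach T w x)) Finset.subset_union_right

lemma Ex_card_cl_le (hp : p ∈ Set.Icc (0 : ℝ) 1) {s : ℕ} {φ : ℝ} (hφ : φ < 1)
    (hS : ∀ w, ∃ S : Finset V, w ∈ S ∧ S.card ≤ s ∧ phi G p S w ≤ φ) (hw : w ∈ Λ) :
    Ex (fun _ => p) (edgesIn G Λ) (fun T => ((cl Λ T w).card : ℝ)) ≤ s / (1 - φ) := by
  set E := edgesIn G Λ with hE
  set X : V → ℝ := fun w => Ex (fun _ => p) E (fun T => ((cl Λ T w).card : ℝ)) with hX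
  obtain ⟨m, hm, hmax⟩ := Finset.exists_max_image Λ X ⟨w, hw⟩
  have hX0 : ∀ w, 0 ≤ X w := fun w => Ex_nonneg (fun _ => hp) fun T _ => Nat.cast_nonneg _
  obtain ⟨S, hmS, hSs, hSφ⟩ := hS m
  have key : X m ≤ S.card + phi G p S m * X m := by
    have h1 := Ex_mono (q := fun _ => p) (fun _ => hp) fun T (hT : T ⊆ E) => card_cl_le hmS hT
    rw [Ex_add, Ex_const, Ex_sum] at h1
    refine h1.trans (add_le_add le_rfl ?_)
    unfold phi
    rw [Finset.sum_mul]
    refine Finset.sum_le_sum fun x hx => ?_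
    rw [Ex_sum, Finset.sum_mul]
    refine Finset.sum_le_sum fun y hy => ?_
    obtain ⟨_, hyS⟩ := Finset.mem_sdiff.1 hy
    by_cases hyΛ : y ∈ Λ
    · have h2 := Ex_exit_le (G := G) (E := E) (x := x) hp hmS hyS (N := fun T => ((cl Λ T y).card : ℝ))
        (fun _ => Nat.cast_nonneg _) (M := X m) fun A => le_trans
          (Ex_mono (fun _ => hp) fun T _ => by exact_mod_cast Finset.card_le_card (cl_mono off_subset))
          (hmax y hyΛ)
      refine h2.trans ?_
      have h3 := mul_le_mul_of_nonneg_left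
        (Ex_inner_le (G := G) (E := E) (S := S) (w := m) (x := x) hp) (mul_nonneg hp.1 (hX0 m))
      linarith
    · have h2 : Ex (fun _ => p) E (fun T => ind (x ∈ inner G S m T) *
          (ind (s(x, y) ∈ T) * ((cl Λ (off (inner G S m T) T) y).card : ℝ))) = 0 := by
        rw [← Ex_const (fun _ => p) E 0]
        refine Ex_congr fun T hT => ?_
        rw [ind_of_not fun h => hyΛ (mk_mem_edgesIn.1 (hT h)).2.1]
        ring
      rw [h2]
      exact mul_nonneg (mul_nonneg hp.1 (Ex_nonneg (fun _ => hp) fun T _ => ind_nonneg _)) (hX0 m)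
  have h2 : (S.card : ℝ) ≤ s := by exact_mod_cast hSs
  have h3 := mul_le_mul_of_nonneg_right hSφ (hX0 m)
  rw [le_div_iff₀ (by linarith)]
  have h4 := mul_le_mul_of_nonneg_right (hmax w hw) (by linarith : 0 ≤ 1 - φ)
  linarith

end Subcritical

section Sharpness
open Classical

variable {V : Type*} [DecidableEq V] {G : SimpleGraph V} [G.LocallyFinite]
variable {Λ A B S F : Finset V} {T E : Finset (Sym2 V)} {x y z v w o : V} {r d : ℕ} {p : ℝ}

lemma monotone_ind_reach (x y : V) : Monotone fun T : Finset (Sym2 V) => ind (Reach T x y) :=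
  fun _ _ h => ind_mono fun h' => h'.mono h

lemma chain_connection (hp : p ∈ Set.Icc (0 : ℝ) 1) {ζ : ℝ} (hζ0 : 0 ≤ ζ) {r₀ : ℕ}
    (hfar : ∀ x y, inBall G x r₀ y →
      ∃ Λ : Finset V, ζ ≤ Ex (fun _ => p) (edgesIn G Λ) (fun T => ind (Reach T x y)))
    (x : V) (j : ℕ) : ∀ y ∈ thick G (j * r₀) {x},
      ∃ Λ : Finset V, ζ ^ j ≤ Ex (fun _ => p) (edgesIn G Λ) (fun T => ind (Reach T x y)) := by
  induction j with
  | zero =>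
    intro y hy
    rw [zero_mul, thick_zero, Finset.mem_singleton] at hy
    subst hy
    refine ⟨∅, ?_⟩
    rw [pow_zero, ← Ex_const (fun _ => p) (edgesIn G ∅) 1]
    exact Ex_mono (fun _ => hp) fun T _ => by rw [ind_of (Reach.refl _ _)]
  | succ j ih =>
    intro y hy
    rw [add_mul, one_mul, add_comm, ← thick_thick] at hy
    obtain ⟨z, hz, hzy⟩ := mem_thick.1 hy
    obtain ⟨Λ₁, h1⟩ := ih z hz
    obtain ⟨Λ₂, h2⟩ := hfar z y hzy
    refine ⟨Λ₁ ∪ Λ₂, ?_⟩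
    have hm1 := Ex_mono_set (q := fun _ => p) (fun _ => hp)
      (edgesIn_mono (G := G) (Finset.subset_union_left (s₁ := Λ₁) (s₂ := Λ₂)))
      (monotone_ind_reach x z)
    have hm2 := Ex_mono_set (q := fun _ => p) (fun _ => hp)
      (edgesIn_mono (G := G) (Finset.subset_union_right (s₁ := Λ₁) (s₂ := Λ₂)))
      (monotone_ind_reach z y)
    have hh := Ex_harris (q := fun _ => p) (E := edgesIn G (Λ₁ ∪ Λ₂)) (fun _ => hp)
      (monotone_ind_reach x z) (monotone_ind_reach z y)
    calc ζ ^ (j + 1) = ζ ^ j * ζ := pow_succ _ _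
      _ ≤ Ex (fun _ => p) (edgesIn G (Λ₁ ∪ Λ₂)) (fun T => ind (Reach T x z)) *
          Ex (fun _ => p) (edgesIn G (Λ₁ ∪ Λ₂)) (fun T => ind (Reach T z y)) :=
          mul_le_mul (h1.trans hm1) (h2.trans hm2) hζ0
            (Ex_nonneg (fun _ => hp) fun T _ => ind_nonneg _)
      _ ≤ _ := hh
      _ ≤ _ := Ex_mono (fun _ => hp) fun T _ => by
          by_cases h : Reach T x z
          · by_cases h' : Reach T z y
            · rw [ind_of (h.trans h')]
              exact mul_le_one₀ (ind_le_one _) (ind_nonneg _) (ind_le_one _)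
            · rw [ind_of_not h', mul_zero]; exact ind_nonneg _
          · rw [ind_of_not h, zero_mul]; exact ind_nonneg _

/-- In the subcritical regime of a transitive graph of exponential growth, every vertex has a
nearby vertex to which it is unlikely to be connected. -/
lemma exists_unlikely_connection (hp : p ∈ Set.Icc (0 : ℝ) 1) (htr : IsTransitive G)
    {h ζ : ℝ} (h0 : 0 ≤ h)
    (hexp : ∀ A : Finset V, (1 + h) * A.card ≤ ((thick G 1 A).card : ℝ))
    (hζ0 : 0 ≤ ζ) {r₀ : ℕ} (hr₀ : 2 ≤ ζ * (1 + h) ^ r₀) (ho : o ∈ S) (hφ : phi G p S o < 1)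
    (Λ : Finset V) (x : V) :
    ∃ y, inBall G x r₀ y ∧ Ex (fun _ => p) (edgesIn G Λ) (fun T => ind (Reach T x y)) ≤ ζ := by
  by_contra! hcon
  have hfar : ∀ x' y', inBall G x' r₀ y' → ∃ Λ : Finset V,
      ζ ≤ Ex (fun _ => p) (edgesIn G Λ) (fun T => ind (Reach T x' y')) := by
    intro x' y' hxy
    obtain ⟨ψ, rfl⟩ := htr x x'
    have h1 := inBall_image ψ.symm hxy
    rw [ψ.symm_apply_apply] at h1
    refine ⟨Λ.image ψ, ?_⟩
    have h2 := Ex_reach_image ψ Λ p x (ψ.symm y')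
    rw [ψ.apply_symm_apply] at h2
    rw [h2]
    exact (hcon _ h1).le
  have hS : ∀ w, ∃ S' : Finset V, w ∈ S' ∧ S'.card ≤ S.card ∧ phi G p S' w ≤ phi G p S o := by
    intro w
    obtain ⟨ψ, rfl⟩ := htr o w
    exact ⟨S.image ψ, Finset.mem_image_of_mem _ ho, Finset.card_image_le, (phi_image ψ p S o).le⟩
  obtain ⟨j, hj⟩ := pow_unbounded_of_one_lt ((S.card : ℝ) / (1 - phi G p S o)) one_lt_two
  have hch := chain_connection hp hζ0 hfar x j
  set D := thick G (j * r₀) {x} with hD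
  choose! L hL using hch
  set M : Finset V := D ∪ D.biUnion L with hM
  have hxM : x ∈ M := Finset.mem_union_left _ (subset_thick (Finset.mem_singleton_self x))
  have h1 := Ex_card_cl_le hp hφ hS hxM
  have h2 : ζ ^ j * D.card ≤ Ex (fun _ => p) (edgesIn G M) (fun T => ((cl M T x).card : ℝ)) := by
    calc ζ ^ j * D.card = ∑ y ∈ D, ζ ^ j := by rw [Finset.sum_const, nsmul_eq_mul, mul_comm]
      _ ≤ ∑ y ∈ D, Ex (fun _ => p) (edgesIn G M) (fun T => ind (Reach T x y)) :=
          Finset.sum_le_sum fun y hy => (hL y hy).trans (Ex_mono_set (fun _ => hp)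
            (edgesIn_mono ((Finset.subset_biUnion_of_mem L hy).trans Finset.subset_union_right))
            (monotone_ind_reach x y))
      _ = Ex (fun _ => p) (edgesIn G M) (fun T => ∑ y ∈ D, ind (Reach T x y)) :=
          (Ex_sum _ _ _ _).symm
      _ ≤ _ := Ex_mono (fun _ => hp) fun T _ => by
          rw [sum_ind]
          exact_mod_cast Finset.card_le_card fun y hy => by
            obtain ⟨hyD, hr⟩ := Finset.mem_filter.1 hy
            exact mem_cl.2 ⟨Finset.mem_union_left _ hyD, hr⟩
  have h3 : (1 + h) ^ (j * r₀) * (1 : ℝ) ≤ D.card := by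
    have := le_card_thick (A := {x}) (r := j * r₀) h0 hexp
    simpa using this
  have h4 : (2 : ℝ) ^ j ≤ ζ ^ j * D.card := by
    calc (2 : ℝ) ^ j ≤ (ζ * (1 + h) ^ r₀) ^ j := pow_le_pow_left₀ (by norm_num) hr₀ j
      _ = ζ ^ j * (1 + h) ^ (j * r₀) := by rw [mul_pow, ← pow_mul, mul_comm j]
      _ ≤ _ := mul_le_mul_of_nonneg_left (by linarith) (pow_nonneg hζ0 _)
  linarith

lemma phi_mono {p' : ℝ} (hp : p ∈ Set.Icc (0 : ℝ) 1) (hq : p' ∈ Set.Icc (0 : ℝ) 1) (h : p ≤ p') :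
    phi G p S o ≤ phi G p' S o := by
  unfold phi
  refine Finset.sum_le_sum fun x _ => Finset.sum_le_sum fun y _ => ?_
  refine mul_le_mul h (Ex_mono_param (fun _ => hp) (fun _ => hq) (fun _ => h)
    (monotone_ind_reach o x)) (Ex_nonneg (fun _ => hp) fun T _ => ind_nonneg _) hq.1

/-- The differential inequality for the probability of reaching the complement of `F`. -/
lemma one_sub_le_deriv (hp : p ∈ Set.Icc (0 : ℝ) 1) (hF : thick G 1 F ⊆ Λ) (hoF : o ∈ F)
    (hφ : ∀ S : Finset V, o ∈ S → 1 ≤ phi G p S o) :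
    1 - Ex (fun _ => p) (edgesIn G Λ) (fun T => ind (o ∈ clU Λ T (Λ \ F))) ≤
      ∑ e ∈ edgesIn G Λ, Ex (fun _ => p) (edgesIn G Λ) (fun T =>
        ind (o ∈ clU Λ (insert e T) (Λ \ F)) - ind (o ∈ clU Λ (T.erase e) (Λ \ F))) := by
  set E := edgesIn G Λ with hE
  set U := Λ \ F with hU
  have hUΛ : U ⊆ Λ := Finset.sdiff_subset
  have hoΛ : o ∈ Λ := hF (subset_thick hoF)
  have h1 : 1 - Ex (fun _ => p) E (fun T => ind (o ∈ clU Λ T U)) =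
      Ex (fun _ => p) E (fun T => ind (o ∉ clU Λ T U)) := by
    simp only [ind_not, Ex_sub, Ex_const]
  have hnn : ∀ T : Finset (Sym2 V), ∀ e,
      0 ≤ ind (o ∈ clU Λ (insert e T) U) - ind (o ∈ clU Λ (T.erase e) U) := fun T e =>
    sub_nonneg.2 (ind_mono fun h => clU_mono
      ((Finset.erase_subset _ _).trans (Finset.subset_insert _ _)) h)
  rw [h1, ← Ex_sum, Ex_sum_clU _ E _ Λ U, Ex_sum_clU _ E (fun T => ∑ e ∈ E, _) Λ U]
  refine Finset.sum_le_sum fun A hA => ?_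
  have hAΛ := Finset.mem_powerset.1 hA
  by_cases hoA : o ∈ A
  · have h2 : Ex (fun _ => p) E (fun T => ind (clU Λ T U = A) * ind (o ∉ clU Λ T U)) = 0 := by
      rw [← Ex_const (fun _ => p) E 0]
      refine Ex_congr fun T _ => ?_
      by_cases h : clU Λ T U = A
      · rw [h, ind_of_not (not_not.2 hoA), mul_zero]
      · rw [ind_of_not h, zero_mul]
    rw [h2]
    exact Ex_nonneg (fun _ => hp) fun T _ => mul_nonneg (ind_nonneg _)
      (Finset.sum_nonneg fun e _ => hnn T e)
  have h2 : Ex (fun _ => p) E (fun T => ind (clU Λ T U = A) * ind (o ∉ clU Λ T U)) =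
      Ex (fun _ => p) E (fun T => ind (clU Λ T U = A)) :=
    Ex_congr fun T _ => by
      rw [ind_mul_congr (b := 1) fun h => by rw [h, ind_of hoA], mul_one]
  rw [h2]
  by_cases hUA : U ⊆ A
  swap
  · have h3 : Ex (fun _ => p) E (fun T => ind (clU Λ T U = A)) = 0 := by
      rw [← Ex_const (fun _ => p) E 0]
      exact Ex_congr fun T _ => ind_of_not fun h => hUA (h ▸ subset_clU hUΛ)
    rw [h3]
    exact Ex_nonneg (fun _ => hp) fun T _ => mul_nonneg (ind_nonneg _)
      (Finset.sum_nonneg fun e _ => hnn T e)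
  set S := Λ \ A with hS
  have hoS : o ∈ S := Finset.mem_sdiff.2 ⟨hoΛ, hoA⟩
  have hSF : S ⊆ F := fun x hx => by
    obtain ⟨h3, h4⟩ := Finset.mem_sdiff.1 hx
    by_contra h5
    exact h4 (hUA (Finset.mem_sdiff.2 ⟨h3, h5⟩))
  have hSΛ : thick G 1 S ⊆ Λ := (thick_mono hSF).trans hF
  have hpt : ∀ T ⊆ E, ind (clU Λ T U = A) * ∑ x ∈ S, ∑ _y ∈ G.neighborFinset x \ S,
      ind (Reach (off A T) o x) ≤ ind (clU Λ T U = A) * ∑ e ∈ E,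
        (ind (o ∈ clU Λ (insert e T) U) - ind (o ∈ clU Λ (T.erase e) U)) := by
    intro T hT
    refine ind_mul_mono fun hcl => le_trans ?_ (sum_boundary_le hSΛ (fun e => hnn T e))
    refine Finset.sum_le_sum fun x hx => Finset.sum_le_sum fun y hy => ?_
    by_cases hr : Reach (off A T) o x
    swap
    · rw [ind_of_not hr]; exact hnn T _
    obtain ⟨hxy, hyS⟩ := Finset.mem_sdiff.1 hy
    have hyΛ : y ∈ Λ := hSΛ (mem_thick.2 ⟨x, hx, SimpleGraph.Walk.cons
      ((G.mem_neighborFinset x y).1 hxy) SimpleGraph.Walk.nil, by simp⟩)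
    have hyA : y ∈ A := by
      by_contra h
      exact hyS (Finset.mem_sdiff.2 ⟨hyΛ, h⟩)
    have h3 : o ∉ clU Λ (T.erase s(x, y)) U := fun h => hoA (by
      rw [← hcl]; exact clU_mono (Finset.erase_subset _ _) h)
    have h4 : o ∈ clU Λ (insert s(x, y) T) U := by
      obtain ⟨_, u, hu, huy⟩ := mem_clU.1 (hcl ▸ hyA : y ∈ clU Λ T U)
      refine mem_clU.2 ⟨hoΛ, u, hu, (huy.mono (Finset.subset_insert _ _)).trans ?_⟩
      refine (Reach.single ?_).trans (hr.symm.mono (off_subset.trans (Finset.subset_insert _ _)))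
      rw [Sym2.eq_swap]
      exact Finset.mem_insert_self _ _
    rw [ind_of h4, ind_of_not h3, sub_zero]
    exact ind_le_one _
  refine le_trans ?_ (Ex_mono (fun _ => hp) hpt)
  rw [Ex_clU_indep (q := fun _ => p) (E := E) (Λ := Λ) edgesIn_subset hUΛ A
    (fun T => ∑ x ∈ S, ∑ _y ∈ G.neighborFinset x \ S, ind (Reach T o x))]
  have h5 : 0 ≤ Ex (fun _ => p) E (fun T => ind (clU Λ T U = A)) :=
    Ex_nonneg (fun _ => hp) fun T _ => ind_nonneg _
  refine le_mul_of_one_le_right h5 ((hφ S hoS).trans ?_)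
  rw [Ex_sum]
  unfold phi
  refine Finset.sum_le_sum fun x _ => ?_
  rw [Ex_sum]
  refine Finset.sum_le_sum fun y _ => ?_
  have h6 : Ex (fun _ => p) E (fun T => ind (Reach (off A T) o x)) =
      Ex (fun _ => p) (edgesIn G S) (fun T => ind (Reach T o x)) := by
    rw [← Ex_inter (edgesIn_mono (G := G) (Finset.sdiff_subset : S ⊆ Λ))]
    refine Ex_congr fun T hT => ?_
    congr 2
    ext e
    rw [mem_off, Finset.mem_inter]
    refine and_congr_right fun he => ?_
    have := hT he
    induction e using Sym2.ind with
    | _ a b =>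
      obtain ⟨ha, hb, hab⟩ := mk_mem_edgesIn.1 this
      rw [mk_mem_edgesIn]
      simp [ha, hb, hab]
  rw [h6]
  exact mul_le_of_le_one_left (Ex_nonneg (fun _ => hp) fun T _ => ind_nonneg _) hp.2

lemma escape_lower_bound {p₀ p₁ : ℝ} (hp₀ : 0 ≤ p₀) (hp₁ : p₁ ≤ 1) (h01 : p₀ ≤ p₁)
    (hF : thick G 1 F ⊆ Λ) (hoF : o ∈ F) (hφ : ∀ S : Finset V, o ∈ S → 1 ≤ phi G p₀ S o) :
    1 - Real.exp (-(p₁ - p₀)) ≤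
      Ex (fun _ => p₁) (edgesIn G Λ) (fun T => ind (o ∈ clU Λ T (Λ \ F))) := by
  set E := edgesIn G Λ with hE
  set f : ℝ → ℝ := fun p => Ex (fun _ => p) E (fun T => ind (o ∈ clU Λ T (Λ \ F))) with hf
  set f' : ℝ → ℝ := fun p => ∑ e ∈ E, Ex (fun _ => p) E (fun T =>
        ind (o ∈ clU Λ (insert e T) (Λ \ F)) - ind (o ∈ clU Λ (T.erase e) (Λ \ F))) with hf'
  have hder : ∀ p, HasDerivAt f (f' p) p := fun p => by
    have := Ex_hasDerivAt (p := p) (F := fun _ T => ind (o ∈ clU Λ T (Λ \ F))) (F' := fun _ => 0)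
      (fun T => hasDerivAt_const p _) E
    rw [Ex_const, add_zero] at this
    exact this
  set g : ℝ → ℝ := fun p => (1 - f p) * Real.exp p with hg
  have hgd : ∀ p, HasDerivAt g (-(f' p) * Real.exp p + (1 - f p) * Real.exp p) p := fun p =>
    ((hder p).const_sub 1).mul (Real.hasDerivAt_exp p)
  have hanti : AntitoneOn g (Set.Icc p₀ p₁) := by
    refine antitoneOn_of_deriv_nonpos (convex_Icc _ _)
      (fun u _ => (hgd u).continuousAt.continuousWithinAt)
      (fun u _ => (hgd u).differentiableAt.differentiableWithinAt) fun u hu => ?_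
    rw [interior_Icc] at hu
    rw [(hgd u).deriv, ← add_mul]
    have hu01 : u ∈ Set.Icc (0 : ℝ) 1 := ⟨hp₀.trans hu.1.le, hu.2.le.trans hp₁⟩
    have hp01 : p₀ ∈ Set.Icc (0 : ℝ) 1 := ⟨hp₀, h01.trans hp₁⟩
    have := one_sub_le_deriv hu01 hF hoF fun S hS => (hφ S hS).trans (phi_mono hp01 hu01 hu.1.le)
    refine mul_nonpos_of_nonpos_of_nonneg ?_ (Real.exp_pos _).le
    simp only [hf, hf']
    linarith
  have h1 := hanti ⟨le_rfl, h01⟩ ⟨h01, le_rfl⟩ h01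
  have h2 : 0 ≤ f p₀ := Ex_nonneg (fun _ => ⟨hp₀, h01.trans hp₁⟩) fun T _ => ind_nonneg _
  simp only [hg] at h1
  have h3 : 1 - f p₁ ≤ Real.exp (-(p₁ - p₀)) := by
    have h4 : (1 - f p₁) * Real.exp p₁ ≤ Real.exp p₀ :=
      h1.trans (mul_le_of_le_one_left (Real.exp_pos _).le (by linarith))
    rw [neg_sub, Real.exp_sub, le_div_iff₀ (Real.exp_pos _)]
    exact h4
  linarith

end Sharpness

section Critical
open Classical

variable {V : Type*} [DecidableEq V] {G : SimpleGraph V}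
variable {T E : Finset (Sym2 V)} {x y v : V} {p q : ℝ}

lemma cylProb_eq (p : ℝ) (E : Finset (Sym2 V)) (A : Finset (Sym2 V) → Prop) :
    cylProb p E A = Ex (fun _ => p) E (fun T => ind (A T)) := by
  unfold cylProb Ex
  refine Finset.sum_congr rfl fun T hT => ?_
  have hT' := Finset.mem_powerset.1 hT
  by_cases h : A T
  · simp [h, ind_of, Finset.card_sdiff_of_subset hT']
  · simp [h, ind_of_not]

lemma Reach.connectedVia (hT : ∀ e ∈ T, e ∈ G.edgeSet) (h : Reach T x y) :
    connectedVia G T x y := by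
  induction h with
  | refl => exact ⟨SimpleGraph.Walk.nil, by simp⟩
  | @tail b c _ hbc ih =>
    obtain ⟨w, hw⟩ := ih
    have hadj : G.Adj b c := hT _ hbc
    refine ⟨w.concat hadj, fun e he => ?_⟩
    rw [SimpleGraph.Walk.edges_concat, List.concat_eq_append, List.mem_append, List.mem_singleton] at he
    rcases he with he | rfl
    · exact hw e he
    · exact hbc

lemma cylProb_le_one (hp : p ∈ Set.Icc (0 : ℝ) 1) (E : Finset (Sym2 V))
    (A : Finset (Sym2 V) → Prop) : cylProb p E A ≤ 1 := by
  rw [cylProb_eq, ← Ex_const (fun _ => p) E 1]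
  exact Ex_mono (fun _ => hp) fun T _ => ind_le_one _

lemma cylProb_nonneg (hp : p ∈ Set.Icc (0 : ℝ) 1) (E : Finset (Sym2 V))
    (A : Finset (Sym2 V) → Prop) : 0 ≤ cylProb p E A := by
  rw [cylProb_eq]
  exact Ex_nonneg (fun _ => hp) fun T _ => ind_nonneg _

lemma cylProb_le_prob (hp : p ∈ Set.Icc (0 : ℝ) 1) (E : Finset (Sym2 V))
    (A : Finset (Sym2 V) → Prop) : cylProb p E A ≤ prob p A :=
  le_ciSup (f := fun E => cylProb p E A)
    ⟨1, by rintro _ ⟨E, rfl⟩; exact cylProb_le_one hp E A⟩ E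

lemma prob_nonneg (hp : p ∈ Set.Icc (0 : ℝ) 1) (A : Finset (Sym2 V) → Prop) : 0 ≤ prob p A :=
  (cylProb_nonneg hp ∅ A).trans (cylProb_le_prob hp ∅ A)

lemma le_theta {t : ℝ} (hp : p ∈ Set.Icc (0 : ℝ) 1)
    (h : ∀ L : ℕ, ∃ E : Finset (Sym2 V), t ≤ cylProb p E
      (fun S => ∃ x : V, ¬ inBall G v L x ∧ connectedVia G S v x)) : t ≤ theta G p v :=
  le_ciInf fun L => by
    obtain ⟨E, hE⟩ := h L
    exact hE.trans (cylProb_le_prob hp E _)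

lemma theta_le (hp : p ∈ Set.Icc (0 : ℝ) 1) (L : ℕ) :
    theta G p v ≤ prob p (fun S => ∃ x : V, ¬ inBall G v L x ∧ connectedVia G S v x) :=
  ciInf_le (f := fun n : ℕ => prob p (fun S => ∃ x : V, ¬ inBall G v n x ∧ connectedVia G S v x))
    ⟨0, by rintro _ ⟨n, rfl⟩; exact prob_nonneg hp _⟩ L

lemma exists_cylProb (hp : p ∈ Set.Icc (0 : ℝ) 1) {t : ℝ} (ht : t < theta G p v) (L : ℕ) :
    ∃ E : Finset (Sym2 V), t < cylProb p E
      (fun S => ∃ x : V, ¬ inBall G v L x ∧ connectedVia G S v x) :=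
  exists_lt_of_lt_ciSup (ht.trans_le (theta_le hp L))

lemma pc_le (hp : p ∈ Set.Icc (0 : ℝ) 1) (h : 0 < theta G p v) : pc G ≤ p :=
  csInf_le ⟨0, fun _ h => h.1⟩ ⟨hp.1, hp.2, v, h⟩

lemma pc_nonneg (G : SimpleGraph V) : 0 ≤ pc G := Real.sInf_nonneg fun _ h => h.1

lemma pc_le_one (G : SimpleGraph V) : pc G ≤ 1 := by
  unfold pc
  rcases Set.eq_empty_or_nonempty {p : ℝ | 0 ≤ p ∧ p ≤ 1 ∧ ∃ v : V, 0 < theta G p v} with h | h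
  · rw [h, Real.sInf_empty]; norm_num
  · obtain ⟨p, hp⟩ := h
    exact (csInf_le ⟨0, fun _ h => h.1⟩ hp).trans hp.2.1

lemma exists_not_inBall [G.LocallyFinite] [Infinite V] (v : V) (L : ℕ) : ∃ x, ¬ inBall G v L x := by
  obtain ⟨x, hx⟩ := Infinite.exists_notMem_finset (thick G L {v})
  exact ⟨x, fun h => hx (mem_thick.2 ⟨v, by simp, h⟩)⟩

lemma theta_one [G.LocallyFinite] [Infinite V] (hG : G.Connected) (v : V) : 1 ≤ theta G 1 v := by
  refine le_theta ⟨zero_le_one, le_rfl⟩ fun L => ?_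
  obtain ⟨x, hx⟩ := exists_not_inBall (G := G) v L
  obtain ⟨w⟩ := hG.preconnected v x
  refine ⟨w.edges.toFinset, ?_⟩
  unfold cylProb
  rw [Finset.sum_eq_single w.edges.toFinset]
  · rw [if_pos ⟨x, hx, w, by simp⟩]; simp
  · intro S hS hne
    have hlt := Finset.card_lt_card
      (Finset.ssubset_iff_subset_ne.2 ⟨Finset.mem_powerset.1 hS, hne⟩)
    split_ifs
    · rw [sub_self, zero_pow (by omega), mul_zero]
    · rfl
  · intro h; simp at h

lemma exists_theta_pos [G.LocallyFinite] [Infinite V] (hG : G.Connected) (hq : pc G < q) :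
    ∃ p, 0 ≤ p ∧ p ≤ 1 ∧ p < q ∧ ∃ v : V, 0 < theta G p v := by
  obtain ⟨v⟩ := hG.nonempty
  obtain ⟨p, ⟨h0, h1, h2⟩, h3⟩ := exists_lt_of_csInf_lt
    (s := {p : ℝ | 0 ≤ p ∧ p ≤ 1 ∧ ∃ v : V, 0 < theta G p v})
    ⟨1, zero_le_one, le_rfl, v, zero_lt_one.trans_le (theta_one hG v)⟩ hq
  exact ⟨p, h0, h1, h3, h2⟩

/-- Escaping every ball with probability at least `t > 0` shows that `p` is not subcritical. -/
lemma pc_le_of_escape [G.LocallyFinite] {t : ℝ} {o : V} (hp : p ∈ Set.Icc (0 : ℝ) 1) (ht : 0 < t)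
    (h : ∀ L : ℕ, ∃ Λ : Finset V, t ≤ Ex (fun _ => p) (edgesIn G Λ)
      (fun T => ind (¬ cl Λ T o ⊆ thick G L {o}))) : pc G ≤ p := by
  refine pc_le (v := o) hp (ht.trans_le (le_theta hp fun L => ?_))
  obtain ⟨Λ, hΛ⟩ := h L
  refine ⟨edgesIn G Λ, hΛ.trans ?_⟩
  rw [cylProb_eq]
  refine Ex_mono (fun _ => hp) fun T hT => ind_mono fun hcl => ?_
  obtain ⟨x, hx, hxL⟩ := Finset.not_subset.1 hcl
  refine ⟨x, fun hb => hxL (mem_thick.2 ⟨o, by simp, hb⟩), (mem_cl.1 hx).2.connectedVia ?_⟩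
  exact fun e he => (Finset.mem_filter.1 (hT he)).2

end Critical

section Expansion
open Classical

variable {V : Type*} [DecidableEq V] {G : SimpleGraph V} [G.LocallyFinite]

/-- A positive spectral gap yields vertex expansion. -/
lemma expansion_of_lambda1 {c : ℝ} {d : ℕ} (hc : 0 < c) (hlam : c ≤ lambda1 G)
    (hreg : ∀ x, (G.neighborSet x).ncard = d) (A : Finset V) :
    (1 + c) * A.card ≤ ((thick G 1 A).card : ℝ) := by
  rcases A.eq_empty_or_nonempty with rfl | hA
  · simp
  have hcard : ∀ x, (G.neighborFinset x).card = d := fun x => by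
    rw [← hreg x, Set.ncard_eq_toFinset_card', SimpleGraph.neighborFinset]
  set f : V →₀ ℝ := Finsupp.indicator A (fun _ _ => 1) with hf
  have hfx : ∀ x, f x = if x ∈ A then 1 else 0 := fun x => by
    simp [hf, Finsupp.indicator_apply]
  have hsupp : f.support = A := by
    ext x; simp [hfx]
  have hsum : ∀ x, ∑' y : G.neighborSet x, f (y : V) = (((G.neighborFinset x) ∩ A).card : ℝ) := by
    intro x
    rw [tsum_fintype, ← Finset.sum_subtype (G.neighborFinset x) (by simp) (fun y => f y)]
    simp [hfx]
  have hf0 : f ≠ 0 := by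
    rw [← Finsupp.support_nonempty_iff, hsupp]; exact hA
  have hbdd : c ≤ (∑ x ∈ f.support,
          (((G.neighborSet x).ncard : ℝ) * f x - ∑' y : G.neighborSet x, f (y : V)) * f x) /
        (∑ x ∈ f.support, ((G.neighborSet x).ncard : ℝ) * f x ^ 2) := by
    refine hlam.trans (csInf_le ?_ ⟨f, hf0, rfl⟩)
    by_contra hb
    have := Real.sInf_of_not_bddBelow hb
    unfold lambda1 at hlam
    rw [this] at hlam
    linarith
  have hnum : ∑ x ∈ f.support,
      (((G.neighborSet x).ncard : ℝ) * f x - ∑' y : G.neighborSet x, f (y : V)) * f x =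
      ∑ x ∈ A, ((G.neighborFinset x \ A).card : ℝ) := by
    rw [hsupp]
    refine Finset.sum_congr rfl fun x hx => ?_
    rw [hsum, hfx, if_pos hx, hreg, mul_one, mul_one, ← hcard x,
      ← Finset.card_sdiff_add_card_inter (G.neighborFinset x) A]
    push_cast; ring
  have hden : ∑ x ∈ f.support, ((G.neighborSet x).ncard : ℝ) * f x ^ 2 = d * A.card := by
    rw [hsupp, Finset.sum_congr rfl (g := fun _ => (d : ℝ)) fun x hx => by
      rw [hfx, if_pos hx, hreg]; simp]
    simp [mul_comm]
  rw [hnum, hden] at hbdd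
  have hd : 0 < (d : ℝ) := by
    rcases Nat.eq_zero_or_pos d with h | h
    · rw [h] at hbdd; simp at hbdd; linarith
    · exact_mod_cast h
  have hA0 : 0 < (A.card : ℝ) := by exact_mod_cast hA.card_pos
  rw [le_div_iff₀ (by positivity)] at hbdd
  set B := thick G 1 A \ A with hB
  have hle : ∑ x ∈ A, (G.neighborFinset x \ A).card ≤ B.card * d := by
    have h1 : ∀ x ∈ A, (G.neighborFinset x \ A).card ≤ (B.filter fun y => G.Adj x y).card := by
      intro x hx
      refine Finset.card_le_card fun y hy => ?_
      obtain ⟨hy1, hy2⟩ := Finset.mem_sdiff.1 hy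
      rw [SimpleGraph.mem_neighborFinset] at hy1
      refine Finset.mem_filter.2 ⟨Finset.mem_sdiff.2 ⟨mem_thick.2 ⟨x, hx, hy1.toWalk, ?_⟩, hy2⟩, hy1⟩
      simp
    refine (Finset.sum_le_sum h1).trans ?_
    have h2 := Finset.sum_card_bipartiteAbove_eq_sum_card_bipartiteBelow
      (s := A) (t := B) (fun x y => G.Adj x y)
    unfold Finset.bipartiteAbove Finset.bipartiteBelow at h2
    rw [h2]
    refine Finset.sum_le_card_nsmul _ _ _ fun y _ => ?_
    rw [← hcard y]
    refine Finset.card_le_card fun x hx => ?_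
    rw [SimpleGraph.mem_neighborFinset]
    exact (Finset.mem_filter.1 hx).2.symm
  have hBc : (B.card : ℝ) + A.card = (thick G 1 A).card := by
    exact_mod_cast Finset.card_sdiff_add_card_eq_card subset_thick
  have hle' : (∑ x ∈ A, ((G.neighborFinset x \ A).card : ℝ)) ≤ B.card * d := by exact_mod_cast hle
  have : c * A.card ≤ B.card := le_of_mul_le_mul_right (by linarith) hd
  linarith

end Expansion

section Local
open Classical

variable {V : Type*} [DecidableEq V] {G : SimpleGraph V} [G.LocallyFinite]
variable {Λ F : Finset V} {T : Finset (Sym2 V)} {x y v : V} {p : ℝ}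

lemma card_cl_of_connectedVia {R : ℕ} (h : connectedVia G T v x)
    (hx : ¬ inBall G v (R + 1) x) :
    R + 2 ≤ (cl (thick G (R + 1) {v}) (T ∩ edgesIn G (thick G (R + 1) {v})) v).card := by
  obtain ⟨w₀, hw₀⟩ := h
  set w := w₀.bypass with hw
  have hpath : w.IsPath := w₀.bypass_isPath
  have hlen : R + 1 < w.length := by
    by_contra hc
    exact hx ⟨w, not_lt.1 hc⟩
  have hB : ∀ i ≤ R + 1, w.getVert i ∈ thick G (R + 1) {v} := fun i hi =>
    mem_thick.2 ⟨v, by simp, w.take i, by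
      rw [SimpleGraph.Walk.take_length]; exact (min_le_left _ _).trans hi⟩
  have hR : ∀ i ≤ R + 1, Reach (T ∩ edgesIn G (thick G (R + 1) {v})) v (w.getVert i) := by
    intro i
    induction i with
    | zero => intro _; rw [SimpleGraph.Walk.getVert_zero]; exact Reach.refl _ _
    | succ i ih =>
      intro hi
      refine (ih (by omega)).trans (Reach.single (Finset.mem_inter.2 ⟨hw₀ _ ?_, ?_⟩))
      · exact w₀.edges_bypass_subset_edges (SimpleGraph.Walk.adj_toSubgraph_iff_mem_edges.1
          (w.toSubgraph_adj_getVert (by omega)))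
      · exact mk_mem_edgesIn.2 ⟨hB i (by omega), hB _ hi, w.adj_getVert_succ (by omega)⟩
  have hcard : ((Finset.range (R + 2)).image w.getVert).card = R + 2 := by
    rw [Finset.card_image_of_injOn, Finset.card_range]
    refine hpath.getVert_injOn.mono fun i hi => ?_
    have := Finset.mem_range.1 (Finset.mem_coe.1 hi)
    show i ≤ w.length
    omega
  rw [← hcard]
  refine Finset.card_le_card fun z hz => ?_
  obtain ⟨i, hi, rfl⟩ := Finset.mem_image.1 hz
  have hi' : i ≤ R + 1 := by have := Finset.mem_range.1 hi; omega
  exact mem_cl.2 ⟨hB i hi', hR i hi'⟩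

lemma monotone_ind_card_cl (m : ℕ) : Monotone fun T => ind (m ≤ (cl Λ T v).card) :=
  fun _ _ h => ind_mono fun h' => h'.trans (Finset.card_le_card (cl_mono h))

lemma large_cluster_of_theta {t : ℝ} (hp : p ∈ Set.Icc (0 : ℝ) 1) (ht : t < theta G p v)
    (R : ℕ) : t ≤ Ex (fun _ => p) (edgesIn G (thick G (R + 1) {v}))
      (fun T => ind (R + 2 ≤ (cl (thick G (R + 1) {v}) T v).card)) := by
  obtain ⟨E, hE⟩ := exists_cylProb hp ht (R + 1)
  set B := thick G (R + 1) {v} with hB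
  rw [cylProb_eq] at hE
  have hm : Monotone fun T => ind (R + 2 ≤ (cl B (T ∩ edgesIn G B) v).card) := fun _ _ h =>
    monotone_ind_card_cl (R + 2) (Finset.inter_subset_inter_right h)
  refine hE.le.trans ((Ex_mono (g := fun T => ind (R + 2 ≤ (cl B (T ∩ edgesIn G B) v).card))
    (fun _ => hp) fun T _ => ind_mono ?_).trans ?_)
  · rintro ⟨x, hx, hc⟩
    exact card_cl_of_connectedVia hc hx
  · refine (Ex_mono_set (fun _ => hp) (Finset.subset_union_left (s₂ := edgesIn G B)) hm).trans ?_
    exact (Ex_inter (f := fun T => ind (R + 2 ≤ (cl B T v).card))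
      (Finset.subset_union_right (s₁ := E))).le

lemma edgesIn_image_univ {U : Type*} [Fintype U] [DecidableEq U] (ψ : U → V) :
    edgesIn G (Finset.univ.image ψ) =
      ((Finset.univ : Finset U).sym2.filter fun e => e ∈ (G.comap ψ).edgeSet).image
        (Sym2.map ψ) := by
  ext e
  constructor
  · induction e using Sym2.ind with
    | _ x y =>
      intro h
      obtain ⟨hx, hy, hxy⟩ := mk_mem_edgesIn.1 h
      obtain ⟨a, -, rfl⟩ := Finset.mem_image.1 hx
      obtain ⟨b, -, rfl⟩ := Finset.mem_image.1 hy
      refine Finset.mem_image.2 ⟨s(a, b), Finset.mem_filter.2 ⟨by simp, ?_⟩, Sym2.map_mk _ _ _⟩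
      exact hxy
  · intro h
    obtain ⟨e', he', rfl⟩ := Finset.mem_image.1 h
    induction e' using Sym2.ind with
    | _ x y =>
      exact mk_mem_edgesIn.2 ⟨Finset.mem_image_of_mem _ (Finset.mem_univ _),
        Finset.mem_image_of_mem _ (Finset.mem_univ _), (Finset.mem_filter.1 he').2⟩

lemma Ex_card_cl_image {U : Type*} [Fintype U] [DecidableEq U] {ψ : U → V}
    (hψ : Function.Injective ψ) (p : ℝ) (o : U) (m : ℕ) :
    Ex (fun _ => p) (edgesIn G (Finset.univ.image ψ))
      (fun T => ind (m ≤ (cl (Finset.univ.image ψ) T (ψ o)).card)) =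
    Ex (fun _ => p) ((Finset.univ : Finset U).sym2.filter fun e => e ∈ (G.comap ψ).edgeSet)
      (fun T => ind (m ≤ (cl Finset.univ T o).card)) := by
  rw [edgesIn_image_univ, Ex_image _ _ (Sym2.map.injective hψ).injOn]
  refine Ex_congr fun T _ => ind_congr ?_
  have : cl (Finset.univ.image ψ) (T.image (Sym2.map ψ)) (ψ o) = (cl Finset.univ T o).image ψ := by
    ext y
    rw [mem_cl]
    constructor
    · rintro ⟨-, h⟩
      obtain ⟨b, rfl, hb⟩ := h.of_image hψ
      exact Finset.mem_image_of_mem _ (mem_cl.2 ⟨Finset.mem_univ _, hb⟩)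
    · intro h
      obtain ⟨b, hb, rfl⟩ := Finset.mem_image.1 h
      exact ⟨Finset.mem_image_of_mem _ (Finset.mem_univ _), (reach_image_iff hψ).2 (mem_cl.1 hb).2⟩
  rw [this, Finset.card_image_of_injective _ hψ]

lemma Ex_card_cl_ballIso {W : Type*} [DecidableEq W] {H : SimpleGraph W} [H.LocallyFinite]
    {w : W} {R : ℕ} (h : BallIso G H v w R) (p : ℝ) (m : ℕ) :
    Ex (fun _ => p) (edgesIn G (thick G R {v})) (fun T => ind (m ≤ (cl (thick G R {v}) T v).card)) =
    Ex (fun _ => p) (edgesIn H (thick H R {w}))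
      (fun T => ind (m ≤ (cl (thick H R {w}) T w).card)) := by
  obtain ⟨φ, hφ, hadj⟩ := h
  let : Fintype {x : V // inBall G v R x} :=
    Fintype.subtype (thick G R {v}) fun x => by simp [mem_thick]
  set o : {x : V // inBall G v R x} := ⟨v, SimpleGraph.Walk.nil, by simp⟩ with ho
  have h1 : Function.Injective fun x : {x : V // inBall G v R x} => (x : V) :=
    Subtype.val_injective
  have h2 : Function.Injective fun x : {x : V // inBall G v R x} => (φ x : W) :=
    Subtype.val_injective.comp φ.injective
  have e1 : Finset.univ.image (fun x : {x : V // inBall G v R x} => (x : V)) = thick G R {v} := by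
    ext x; simp [mem_thick]
  have e2 : Finset.univ.image (fun x : {x : V // inBall G v R x} => (φ x : W)) =
      thick H R {w} := by
    ext y
    simp only [Finset.mem_image, Finset.mem_univ, true_and, mem_thick, Finset.mem_singleton,
      exists_eq_left]
    constructor
    · rintro ⟨a, rfl⟩; exact (φ a).2
    · intro hy; exact ⟨φ.symm ⟨y, hy⟩, by simp⟩
  have hcomap : G.comap (fun x : {x : V // inBall G v R x} => (x : V)) =
      H.comap (fun x : {x : V // inBall G v R x} => (φ x : W)) := by
    ext a b; exact hadj a b
  have k1 := Ex_card_cl_image (G := G) h1 p o m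
  have k2 := Ex_card_cl_image (G := H) h2 p o m
  rw [e1] at k1
  rw [e2] at k2
  simp only [← hcomap] at k2
  have hφ' : (φ o : W) = w := hφ
  simp only [hφ'] at k2
  exact k1.trans k2.symm

lemma Ex_card_cl_mono {q : ℝ} (hp : 0 ≤ p) (hq : q ≤ 1) (hpq : p ≤ q) {B : Finset V} (hB : B ⊆ Λ)
    (m : ℕ) :
    Ex (fun _ => p) (edgesIn G B) (fun T => ind (m ≤ (cl B T v).card)) ≤
      Ex (fun _ => q) (edgesIn G Λ) (fun T => ind (m ≤ (cl Λ T v).card)) := by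
  have hp' : p ∈ Set.Icc (0 : ℝ) 1 := ⟨hp, hpq.trans hq⟩
  refine (Ex_mono (g := fun T => ind (m ≤ (cl Λ T v).card)) (fun _ => hp') fun T _ =>
    ind_mono fun h => h.trans (Finset.card_le_card fun x hx =>
      mem_cl.2 ⟨hB (mem_cl.1 hx).1, (mem_cl.1 hx).2⟩)).trans ?_
  exact (Ex_mono_set (fun _ => hp') (edgesIn_mono hB) (monotone_ind_card_cl m)).trans
    (Ex_mono_param (fun _ => hp') (fun _ => ⟨hp.trans hpq, hq⟩) (fun _ => hpq)
      (monotone_ind_card_cl m))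

lemma half_ind_le_sw_ghost {β : ℝ} (hβ : 0 ≤ β) {m : ℕ} (hm : 1 ≤ β * m) (K : Finset V) :
    1 / 2 * ind (m ≤ K.card) ≤ sw (ghost F β) K := by
  by_cases h : m ≤ K.card
  · rw [ind_of h, sw, tw_ghost]
    have h1 : Real.exp (-(β * K.card)) ≤ 1 / 2 := by
      have h2 : (1 : ℝ) ≤ β * K.card := hm.trans (mul_le_mul_of_nonneg_left (by exact_mod_cast h) hβ)
      have h3 := Real.add_one_le_exp (β * K.card)
      rw [Real.exp_neg, one_div]
      exact inv_anti₀ two_pos (by linarith)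
    have h4 := mul_le_mul (ind_le_one (K ⊆ F)) h1 (Real.exp_pos _).le zero_le_one
    linarith
  · rw [ind_of_not h, mul_zero]
    exact sw_nonneg (ghost_mem hβ) K

/-- Initial lower bound for the ghost field, transported from the limiting graph. -/
lemma ghost_lower_bound {W : Type*} [DecidableEq W] {H : SimpleGraph W} [H.LocallyFinite]
    {w : W} {R : ℕ} {p₀ p₁ t β : ℝ} (hiso : ∀ v, BallIso G H v w (R + 1)) (hp₀ : 0 ≤ p₀)
    (h01 : p₀ ≤ p₁) (hp₁ : p₁ ≤ 1) (ht1 : t ≤ 1) (ht : t < theta H p₀ w) (hβ : 0 ≤ β)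
    (hβR : 1 ≤ β * (R + 2)) (hF : thick G (R + 1) F ⊆ Λ) :
    ∀ y ∈ Λ, t / 2 ≤ Ex (fun _ => p₁) (edgesIn G Λ) (fun T => sw (ghost F β) (cl Λ T y)) := by
  intro y hy
  have hp' : p₁ ∈ Set.Icc (0 : ℝ) 1 := ⟨hp₀.trans h01, hp₁⟩
  by_cases hyF : y ∈ F
  · have h1 := large_cluster_of_theta ⟨hp₀, h01.trans hp₁⟩ ht R
    rw [← Ex_card_cl_ballIso (hiso y)] at h1
    have hB : thick G (R + 1) {y} ⊆ Λ :=
      (thick_mono (Finset.singleton_subset_iff.2 hyF)).trans hF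
    have h2 := h1.trans (Ex_card_cl_mono hp₀ hp₁ h01 hB (R + 2))
    have h3 : Ex (fun _ => p₁) (edgesIn G Λ) (fun T => 1 / 2 * ind (R + 2 ≤ (cl Λ T y).card)) ≤
        Ex (fun _ => p₁) (edgesIn G Λ) (fun T => sw (ghost F β) (cl Λ T y)) :=
      Ex_mono (fun _ => hp') fun T _ =>
        half_ind_le_sw_ghost hβ (by push_cast; linarith) _
    rw [Ex_mul_left] at h3
    linarith
  · rw [← Ex_const (fun _ => p₁) (edgesIn G Λ) (t / 2)]
    refine Ex_mono (fun _ => hp') fun T _ => ?_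
    rw [sw, tw_ghost, ind_of_not fun h => hyF (h (mem_cl_self hy))]
    linarith

end Local

section Main
open Classical

variable {V : Type*} [DecidableEq V] {G : SimpleGraph V} [G.LocallyFinite]

lemma exists_phi_lt_one {p p' : ℝ} (o : V) (hp : 0 ≤ p) (hpp : p < p') (hp' : p' ≤ 1)
    (hpc : p' < pc G) : ∃ S : Finset V, o ∈ S ∧ phi G p S o < 1 := by
  by_contra! hS
  refine hpc.not_ge (pc_le_of_escape (o := o) (t := 1 - Real.exp (-(p' - p)))
    ⟨hp.trans hpp.le, hp'⟩ (sub_pos.2 (Real.exp_lt_one_iff.2 (by linarith))) fun L =>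
    ⟨thick G 1 (thick G L {o}), ?_⟩)
  refine (escape_lower_bound (Λ := thick G 1 (thick G L {o})) hp hp' hpp.le
    (Finset.Subset.refl _) (subset_thick (Finset.mem_singleton_self o)) hS).trans ?_
  refine Ex_mono (fun _ => ⟨hp.trans hpp.le, hp'⟩) fun T _ => ind_mono fun h hsub => ?_
  obtain ⟨-, u, hu, hr⟩ := mem_clU.1 h
  obtain ⟨hu1, hu2⟩ := Finset.mem_sdiff.1 hu
  exact hu2 (hsub (mem_cl.2 ⟨hu1, hr.symm⟩))

lemma pc_le_of_local_lower_bound [Nonempty V] {W : Type*} [DecidableEq W] {H : SimpleGraph W}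
    [H.LocallyFinite] {w : W} {d r₀ r R : ℕ} {h p₀ p₁ p₃ θ a N : ℝ} (htr : IsTransitive G)
    (hd : ∀ x, (G.neighborFinset x).card ≤ d) (h0 : 0 ≤ h)
    (hexp : ∀ A : Finset V, (1 + h) * A.card ≤ ((thick G 1 A).card : ℝ))
    (hiso : ∀ v, BallIso G H v w (R + 1)) (hp₀ : 0 ≤ p₀) (h01 : p₀ ≤ p₁)
    (h13 : p₁ < p₃) (hp₃ : p₃ ≤ 1) (hθ0 : 0 < θ) (hθ1 : 2 * θ ≤ 1) (hθ : 2 * θ < theta H p₀ w)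
    (hr₀ : 2 ≤ (θ / 2) ^ 2 / 2 * (1 + h) ^ r₀) (ha : 0 ≤ a) (ha2 : a ≤ 2) (hN : 0 < N)
    (hsmall : 2 * (((d : ℝ) + 1) ^ r₀) ^ 2 * (d * (a + Real.exp (-(a ^ 2 * N / 4)))) ≤
      p₁ * (1 - p₃) * p₁ ^ r₀ * ((θ / 2) ^ 2 / 2) / 2)
    (hlarge : 2 * (2 * (((d : ℝ) + 1) ^ r₀) ^ 2 * N) ≤
      p₁ * (1 - p₃) * p₁ ^ r₀ * ((θ / 2) ^ 2 / 2) / 2 * (1 + h) ^ (r₀ + r))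
    (hR : 1 ≤ (p₁ / (d + 1)) ^ (r₀ + r) * ((p₃ - p₁) / 2) * (R + 2)) : pc G ≤ p₃ := by
  by_contra! hlt
  obtain ⟨o⟩ := ‹Nonempty V›
  have hp₁ : 0 ≤ p₁ := hp₀.trans h01
  set p₂ := (p₁ + p₃) / 2 with hp₂
  have h12 : p₁ < p₂ := by rw [hp₂]; linarith
  have h23 : p₂ < p₃ := by rw [hp₂]; linarith
  set c := (p₁ / (d + 1)) ^ (r₀ + r) with hc
  have hc0 : 0 ≤ c := by positivity
  obtain ⟨S, hoS, hS⟩ := exists_phi_lt_one o (hp₁.trans h12.le) h23 hp₃ hlt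
  refine hlt.not_ge ((pc_le_of_escape (o := o) (p := p₂) ⟨hp₁.trans h12.le, h23.le.trans hp₃⟩ hθ0
    fun L => ?_).trans h23.le)
  set F := thick G L {o} with hF
  refine ⟨thick G (R + 1 + (r₀ + r)) F, ?_⟩
  have hFΛ : ∀ k ≤ R + 1 + (r₀ + r), thick G k F ⊆ thick G (R + 1 + (r₀ + r)) F := fun k hk =>
    thick_mono_radius hk
  have hβ : c * ((p₃ - p₁) / 2) = c * (p₂ - p₁) := by rw [hp₂]; ring
  have hβ0 : 0 ≤ c * ((p₃ - p₁) / 2) := mul_nonneg hc0 (by linarith)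
  refine ghost_removal hp₁ (h23.le.trans hp₃) h12.le hβ hc0 hθ0 (hFΛ 1 (by omega)) ?_ ?_ o ?_
  · have := ghost_lower_bound (F := F) hiso hp₀ h01 (h13.le.trans hp₃) hθ1 hθ hβ0 hR
      (hFΛ (R + 1) (by omega))
    intro y hy
    have := this y hy
    linarith
  · intro q hq b hb hqb A hA
    refine boundary_estimate (ghost_mem hb) hp₁ hp₃ ⟨hq.1, hq.2.trans h23.le⟩ hd h0 hexp
      ((thick_mono hA).trans (hFΛ _ (by omega))) (by positivity) hqb ?_ ha ha2 hN hsmall hlarge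
    have hq01 : q ∈ Set.Icc (0 : ℝ) 1 := ⟨hp₁.trans hq.1, hq.2.trans (h23.le.trans hp₃)⟩
    exact fun x => exists_unlikely_connection hq01 htr h0 hexp (by positivity) hr₀ hoS
      ((phi_mono hq01 ⟨hp₁.trans h12.le, h23.le.trans hp₃⟩ hq.2).trans_lt hS) _ x
  · exact subset_thick (subset_thick (Finset.mem_singleton_self o))

end Main

lemma BallIso.ncard_neighborSet {V W : Type*} {G : SimpleGraph V} {H : SimpleGraph W} {v : V}
    {w : W} (h : BallIso G H v w 1) : (G.neighborSet v).ncard = (H.neighborSet w).ncard := by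
  obtain ⟨φ, hφ, hadj⟩ := h
  have hG : ∀ x, G.Adj v x → inBall G v 1 x := fun x hx => ⟨hx.toWalk, by simp⟩
  have hH : ∀ y, H.Adj w y → inBall H w 1 y := fun y hy => ⟨hy.toWalk, by simp⟩
  refine Set.ncard_congr (fun x hx => (φ ⟨x, hG x hx⟩ : W)) (fun x hx => ?_)
    (fun x y hx hy hxy => ?_) fun y hy => ?_
  · have := (hadj ⟨v, SimpleGraph.Walk.nil, by simp⟩ ⟨x, hG x hx⟩).1 hx
    rwa [hφ] at this
  · exact congrArg Subtype.val (φ.injective (Subtype.ext hxy))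
  · have h1 : H.Adj (φ ⟨v, SimpleGraph.Walk.nil, by simp⟩).1 (φ (φ.symm ⟨y, hH y hy⟩)).1 := by
      rw [hφ, φ.apply_symm_apply]; exact hy
    refine ⟨(φ.symm ⟨y, hH y hy⟩).1, (hadj _ _).2 h1, ?_⟩
    simp

/-- Lemma 4 of the paper, upper bound.  In the setting of the locality
theorem, for every `ε > 0` and `ε₁ > 0` there is `N` such that
`p_c(G n) ≤ p_c(H) + 2ε + ε₁` for all `n ≥ N`. -/
theorem pc_upper_bound
    {Vn : ℕ → Type*} {W : Type*} (G : ∀ n, SimpleGraph (Vn n)) (H : SimpleGraph W)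
    (hGconn : ∀ n, (G n).Connected) (hGinf : ∀ n, Infinite (Vn n))
    (hGlf : ∀ n, ∀ v : Vn n, ((G n).neighborSet v).Finite)
    (hGtrans : ∀ n, IsTransitive (G n))
    (hunif : ∃ c : ℝ, 0 < c ∧ ∀ n, c ≤ lambda1 (G n))
    (hHconn : H.Connected) (hHinf : Infinite W)
    (hHlf : ∀ w : W, (H.neighborSet w).Finite) (hHtrans : IsTransitive H)
    (d : ℕ) (hHreg : ∀ w : W, (H.neighborSet w).ncard = d)
    (hconv : ConvergesLocally G H)
    (hA1 : Assumption1i H d) (hA2 : Assumption1ii H) :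
    ∀ ε ε₁ : ℝ, 0 < ε → 0 < ε₁ →
      ∃ N : ℕ, ∀ n, N ≤ n → pc (G n) ≤ pc H + 2 * ε + ε₁ := by
  classical
  intro ε ε₁ hε hε₁
  obtain ⟨h, hh, hlam⟩ := hunif
  let : H.LocallyFinite := fun w => (hHlf w).fintype
  set p₃ := pc H + 2 * ε + ε₁ with hp₃
  rcases le_or_gt 1 p₃ with h3 | h3
  · exact ⟨0, fun n _ => (pc_le_one (G n)).trans h3⟩
  set p₁ := (pc H + p₃) / 2 with hp₁
  have hpc := pc_nonneg H
  have hp₁0 : 0 < p₁ := by rw [hp₁, hp₃]; linarith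
  have h13 : p₁ < p₃ := by rw [hp₁, hp₃]; linarith
  obtain ⟨p₀, hp₀, -, h01, w, hw⟩ :=
    exists_theta_pos hHconn (show pc H < p₁ by rw [hp₁, hp₃]; linarith)
  obtain ⟨θ, hθ0, hθ1, hθ⟩ : ∃ θ : ℝ, 0 < θ ∧ 2 * θ ≤ 1 ∧ 2 * θ < theta H p₀ w := by
    have h1 := min_le_left (theta H p₀ w) 1
    have h2 := min_le_right (theta H p₀ w) 1
    have h4 : 0 < min (theta H p₀ w) 1 := lt_min hw one_pos
    exact ⟨min (theta H p₀ w) 1 / 4, by linarith, by linarith, by linarith⟩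
  obtain ⟨r₀, hr₀⟩ := pow_unbounded_of_one_lt (2 / ((θ / 2) ^ 2 / 2)) (by linarith : 1 < 1 + h)
  have hr₀' : 2 ≤ (θ / 2) ^ 2 / 2 * (1 + h) ^ r₀ := by
    rw [div_lt_iff₀' (by positivity)] at hr₀
    exact hr₀.le
  have h3' : 0 < 1 - p₃ := by linarith
  obtain ⟨a, N, r, ha, ha2, hN, hsmall, hlarge⟩ := exists_constants d r₀
    (κ := p₁ * (1 - p₃) * p₁ ^ r₀ * ((θ / 2) ^ 2 / 2)) (by positivity) hh
  set b := (p₁ / (d + 1)) ^ (r₀ + r) * ((p₃ - p₁) / 2) with hb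
  have hb0 : 0 < b := by
    have : 0 < p₃ - p₁ := by linarith
    positivity
  obtain ⟨R, hR⟩ := exists_nat_gt (1 / b)
  have hR' : 1 ≤ b * (R + 2) := by
    rw [div_lt_iff₀' hb0] at hR
    linarith
  obtain ⟨N₁, hN₁⟩ := hconv 1
  obtain ⟨N₂, hN₂⟩ := hconv (R + 1)
  refine ⟨max N₁ N₂, fun n hn => ?_⟩
  let : (G n).LocallyFinite := fun v => (hGlf n v).fintype
  have := hGinf n
  have hreg : ∀ v, ((G n).neighborSet v).ncard = d := fun v =>
    (hN₁ n ((le_max_left _ _).trans hn) v w).ncard_neighborSet.trans (hHreg w)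
  refine pc_le_of_local_lower_bound (hGtrans n) (fun x => ?_) hh.le
    (expansion_of_lambda1 hh (hlam n) hreg) (fun v => hN₂ n ((le_max_right _ _).trans hn) v w)
    hp₀ h01.le h13 h3.le hθ0 hθ1 hθ hr₀' ha ha2 hN hsmall hlarge hR'
  rw [← hreg x, Set.ncard_eq_toFinset_card', SimpleGraph.neighborFinset]

end Loc
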